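/- Let K be a number field such that condition cond_A(K) or condition cond_B(K) holds, let L be a quadratic extension of K, and let (t, X₁, X₃) be a non-trivial point of the curve 𝒞 over L with t ∉ 𝒯. Then either t and X₁ both lie in (the image of) K, or t and X₃ both lie in (the image of) K. -/

import Mathlib

noncomputable section

/-- `x` lies in the image of `ℚ`. -/
def inQ {L : Type*} [DivisionRing L] [CharZero L] (x : L) : Prop :=
  ∃ q : ℚ, (q : L) = x

/-- `cond_A(K)`: every `K`-point of `E₁`, `E₁⁻¹`, `E₄`, `E₆`, `E₆⁻¹` is rational. -/
def condA (K : Type*) [Field K] [CharZero K] : Prop :=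
  (∀ x y : K, y ^ 2 = x ^ 3 - x ^ 2 + x → inQ x ∧ inQ y) ∧
  (∀ x y : K, y ^ 2 = x ^ 3 + x ^ 2 + x → inQ x ∧ inQ y) ∧
  (∀ x y : K, y ^ 2 = x ^ 3 - x ^ 2 - 64 * x + 220 → inQ x ∧ inQ y) ∧
  (∀ x y : K, y ^ 2 = x ^ 3 - x ^ 2 - 4 * x + 4 → inQ x ∧ inQ y) ∧
  (∀ x y : K, y ^ 2 = x ^ 3 + x ^ 2 - 4 * x - 4 → inQ x ∧ inQ y)

/-- `cond_B(K)`: `E₁(K)` and `E₁⁻¹(K)` are finite (rank `0`), and `[K:ℚ] < 8` or `[K:ℚ]` odd. -/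
def condB (K : Type*) [Field K] [CharZero K] : Prop :=
  {p : K × K | p.2 ^ 2 = p.1 ^ 3 - p.1 ^ 2 + p.1}.Finite ∧
  {p : K × K | p.2 ^ 2 = p.1 ^ 3 + p.1 ^ 2 + p.1}.Finite ∧
  (Module.finrank ℚ K < 8 ∨ Odd (Module.finrank ℚ K))

/-- `(t, X₁, X₃)` is a point of the genus-5 curve `𝒞`: `X₁² = G(t)` and `X₃² = G(-t)`,
where `G(x) = x⁴ - 2x³ + 2x² + 2x + 1`. -/
def CPt {L : Type*} [Field L] (t X₁ X₃ : L) : Prop :=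
  X₁ ^ 2 = t ^ 4 - 2 * t ^ 3 + 2 * t ^ 2 + 2 * t + 1 ∧
  X₃ ^ 2 = t ^ 4 + 2 * t ^ 3 + 2 * t ^ 2 - 2 * t + 1

/-- The point `(t, X₁, X₃)` of `𝒞` is non-trivial. -/
def CNontrivial {L : Type*} [Field L] (t X₁ X₃ : L) : Prop :=
  t ≠ 0 ∧ t ≠ 1 ∧ t ≠ -1 ∧ X₁ ≠ 0 ∧ X₃ ≠ 0 ∧
  t ^ 2 + 1 ≠ 0 ∧ t ^ 2 - 2 * t - 1 ≠ 0 ∧ t ^ 2 + 2 * t - 1 ≠ 0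

/-- `t` belongs to the set `𝒯` of roots of `(x⁴ + x³ + 2x² - x + 1)(x⁴ - x³ + 2x² + x + 1)`. -/
def inT {L : Type*} [Field L] (t : L) : Prop :=
  (t ^ 4 + t ^ 3 + 2 * t ^ 2 - t + 1) * (t ^ 4 - t ^ 3 + 2 * t ^ 2 + t + 1) = 0

open IntermediateField in
theorem quad_step {F K : Type*} [Field F] [Field K] [Algebra F K] [FiniteDimensional F K]
    (z : K) (c : F) (hz : z ^ 2 = algebraMap F K c) (hc : ¬ IsSquare c) :
    Module.finrank F K = 2 * Module.finrank F⟮z⟯ K ∧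
      ∀ x ∈ F⟮z⟯, ∃ a b : F, x = algebraMap F K a + algebraMap F K b * z := by
  have hzint : IsIntegral F z := IsIntegral.of_finite F z
  have hirr : Irreducible (Polynomial.X ^ 2 - Polynomial.C c : Polynomial F) := by
    apply X_pow_sub_C_irreducible_of_prime Nat.prime_two
    intro b hb
    exact hc ⟨b, by rw [← hb, sq]⟩
  have hmin : minpoly F z = Polynomial.X ^ 2 - Polynomial.C c := by
    symm
    apply minpoly.eq_of_irreducible_of_monic hirr
    · simp [hz]
    · exact Polynomial.monic_X_pow_sub_C c (by norm_num)
  have hdeg : (minpoly F z).natDegree = 2 := by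
    rw [hmin]; exact Polynomial.natDegree_X_pow_sub_C
  constructor
  · rw [← Module.finrank_mul_finrank F F⟮z⟯ K, adjoin.finrank hzint, hdeg]
  · intro x hx
    obtain ⟨f, hf, hfx⟩ := (adjoin.powerBasis hzint).exists_eq_aeval ⟨x, hx⟩
    rw [adjoin.powerBasis_dim, hdeg] at hf
    obtain ⟨a, b, rfl⟩ := Polynomial.exists_eq_X_add_C_of_natDegree_le_one (by omega : f.natDegree ≤ 1)
    refine ⟨b, a, ?_⟩
    have := congrArg (algebraMap F⟮z⟯ K) hfx
    simp at this
    rw [this]; ring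

/-- Main degree lemma. -/
theorem deg8 {K : Type*} [Field K] [CharZero K] [FiniteDimensional ℚ K]
    (h8 : ¬ 8 ∣ Module.finrank ℚ K) (a p q u0 u1 w0 w1 : ℚ) (w ρ y : K)
    (hw : w ^ 2 = a) (hρ : ρ ^ 2 = p + q * w) (hy : y ^ 2 = (u0 + u1 * w) + (w0 + w1 * w) * ρ)
    (ha : ¬ IsSquare a) (hc : ¬ ∃ r s : ℚ, r ^ 2 + a * s ^ 2 = p ∧ 2 * r * s = q) :
    ∃ r0 r1 s0 s1 : ℚ, y = (r0 + r1 * w) + (s0 + s1 * w) * ρ := by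
  obtain ⟨hd1, he1⟩ := quad_step (F := ℚ) w a (by simpa using hw) ha
  set F1 := IntermediateField.adjoin ℚ {w} with hF1
  have hwF : w ∈ F1 := IntermediateField.mem_adjoin_simple_self ℚ w
  have hcl : ∀ x : ℚ, (x : K) ∈ F1 := fun x => by simp
  have hlin : ∀ x : ℚ, ∀ r s : ℚ, (r : K) + s * w = 0 → r = 0 ∧ s = 0 := by
    intro _ r s h
    have hs : s = 0 := by
      by_contra hs
      apply ha
      refine ⟨-r / s, ?_⟩
      have : w = ((-r / s : ℚ) : K) := by
        push_cast
        have : (s : K) ≠ 0 := by exact_mod_cast hs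
        field_simp
        linear_combination h
      rw [this] at hw
      have h2 : ((-r / s : ℚ) ^ 2) = a := by exact_mod_cast hw
      rw [← h2]; ring
    subst hs
    simp at h
    exact ⟨h, rfl⟩
  let c : F1 := ⟨(p : K) + q * w, F1.add_mem (hcl _) (F1.mul_mem (hcl _) hwF)⟩
  have hc' : ¬ IsSquare c := by
    rintro ⟨⟨d, hd⟩, hdd⟩
    obtain ⟨r, s, hrs⟩ := he1 d hd
    have h1 : (p : K) + q * w = d * d := congrArg Subtype.val hdd
    simp at hrs
    apply hc
    have h2 := hlin 0 (r ^ 2 + a * s ^ 2 - p) (2 * r * s - q) (by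
      push_cast
      rw [hrs] at h1
      linear_combination -h1 - s ^ 2 * hw)
    exact ⟨r, s, by linarith [h2.1], by linarith [h2.2]⟩
  obtain ⟨hd2, he2⟩ := quad_step (F := F1) ρ c (by rw [hρ]; rfl) hc'
  set F2 := IntermediateField.adjoin F1 {ρ} with hF2
  have hρF : ρ ∈ F2 := IntermediateField.mem_adjoin_simple_self F1 ρ
  have hcl2 : ∀ x ∈ F1, x ∈ F2 := fun x hx => F2.algebraMap_mem ⟨x, hx⟩
  let d : F2 := ⟨((u0 : K) + u1 * w) + (w0 + w1 * w) * ρ,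
    F2.add_mem (hcl2 _ (F1.add_mem (hcl _) (F1.mul_mem (hcl _) hwF)))
      (F2.mul_mem (hcl2 _ (F1.add_mem (hcl _) (F1.mul_mem (hcl _) hwF))) hρF)⟩
  have hd' : IsSquare d := by
    by_contra hd
    obtain ⟨hd3, -⟩ := quad_step (F := F2) y d (by rw [hy]; rfl) hd
    apply h8
    exact ⟨_, by rw [hd1, hd2, hd3]; ring⟩
  obtain ⟨⟨z, hz⟩, hzz⟩ := hd'
  have h1 : ((u0 : K) + u1 * w) + (w0 + w1 * w) * ρ = z * z := congrArg Subtype.val hzz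
  obtain ⟨⟨r, hr⟩, ⟨s, hs⟩, hrs⟩ := he2 z hz
  obtain ⟨r0, r1, hr'⟩ := he1 r hr
  obtain ⟨s0, s1, hs'⟩ := he1 s hs
  have hzv : z = (r0 + r1 * w) + (s0 + s1 * w) * ρ := by
    have : z = r + s * ρ := hrs
    rw [this, hr', hs']; simp
  rw [← hy] at h1
  have : (y - z) * (y + z) = 0 := by linear_combination h1
  rcases mul_eq_zero.mp this with h | h
  · exact ⟨r0, r1, s0, s1, by rw [← hzv]; linear_combination h⟩
  · refine ⟨-r0, -r1, -s0, -s1, ?_⟩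
    push_cast
    linear_combination h - hzv

theorem lin_indep {K : Type*} [Field K] [CharZero K] (a : ℚ) (w : K) (hw : w ^ 2 = a)
    (ha : ¬ IsSquare a) (r s : ℚ) (h : (r : K) + s * w = 0) : r = 0 ∧ s = 0 := by
  have hs : s = 0 := by
    by_contra hs
    apply ha
    refine ⟨-r / s, ?_⟩
    have : w = ((-r / s : ℚ) : K) := by
      push_cast
      have : (s : K) ≠ 0 := by exact_mod_cast hs
      field_simp
      linear_combination h
    rw [this] at hw
    have h2 : ((-r / s : ℚ) ^ 2) = a := by exact_mod_cast hw
    rw [← h2]; ring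
  subst hs
  simp at h
  exact ⟨h, rfl⟩

theorem lin_indep2 {K : Type*} [Field K] [CharZero K] (a p q : ℚ) (w ρ : K) (hw : w ^ 2 = a)
    (hρ : ρ ^ 2 = p + q * w)
    (ha : ¬ IsSquare a) (hc : ¬ ∃ r s : ℚ, r ^ 2 + a * s ^ 2 = p ∧ 2 * r * s = q)
    (r0 r1 s0 s1 : ℚ) (h : ((r0 : K) + r1 * w) + (s0 + s1 * w) * ρ = 0) :
    r0 = 0 ∧ r1 = 0 ∧ s0 = 0 ∧ s1 = 0 := by
  by_cases hs : (s0 : ℚ) ^ 2 - a * s1 ^ 2 = 0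
  · have hs1 : s1 = 0 := by
      by_contra hs1
      apply ha
      exact ⟨s0 / s1, by field_simp; linarith⟩
    subst hs1
    have hs0 : s0 = 0 := by simpa using hs
    subst hs0
    have := lin_indep a w hw ha r0 r1 (by simpa using h)
    exact ⟨this.1, this.2, rfl, rfl⟩
  · exfalso
    set D : ℚ := s0 ^ 2 - a * s1 ^ 2 with hD
    have hDK : (D : K) ≠ 0 := by exact_mod_cast hs
    have hDe : (D : K) = s0 ^ 2 - a * s1 ^ 2 := by rw [hD]; push_cast; ring
    -- ρ = (-(r0 + r1 w)(s0 - s1 w))/D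
    let e0 : ℚ := (-(r0 * s0) + a * r1 * s1) / D
    let e1 : ℚ := (r0 * s1 - r1 * s0) / D
    have hρe : ρ = (e0 : K) + e1 * w := by
      simp only [e0, e1]; push_cast
      field_simp
      rw [hDe]
      linear_combination (s0 - s1 * w) * h + (r1 * s1) * hw + s1 ^ 2 * ρ * hw
    rw [hρe] at hρ
    have := lin_indep a w hw ha (e0 ^ 2 + a * e1 ^ 2 - p) (2 * e0 * e1 - q) (by
      push_cast; linear_combination hρ - e1 ^ 2 * hw)
    exact hc ⟨e0, e1, by linarith [this.1], by linarith [this.2]⟩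

/-- `p + q √a` is a square in `ℚ(√a)`. -/
def SqQ (a p q : ℚ) : Prop := ∃ r s : ℚ, r ^ 2 + a * s ^ 2 = p ∧ 2 * r * s = q

theorem SqQ.norm {a p q : ℚ} (h : SqQ a p q) : IsSquare (p ^ 2 - a * q ^ 2) := by
  obtain ⟨r, s, rfl, rfl⟩ := h
  exact ⟨r ^ 2 - a * s ^ 2, by ring⟩

theorem SqQ.finer {a p q : ℚ} (h : SqQ a p q) (n : ℚ) (hn : p ^ 2 - a * q ^ 2 = n ^ 2) :
    IsSquare ((p + n) / 2) ∨ IsSquare ((p - n) / 2) := by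
  obtain ⟨r, s, rfl, rfl⟩ := h
  have : (r ^ 2 - a * s ^ 2 - n) * (r ^ 2 - a * s ^ 2 + n) = 0 := by linear_combination hn
  rcases mul_eq_zero.mp this with h | h
  · left; exact ⟨r, by linear_combination -h / 2⟩
  · right; exact ⟨r, by linear_combination -h / 2⟩

theorem SqQ.rat {a p : ℚ} (h : SqQ a p 0) : IsSquare p ∨ IsSquare (a * p) := by
  obtain ⟨r, s, rfl, h⟩ := h
  rcases mul_eq_zero.mp h with h | h
  · have : r = 0 := by linarith
    subst this
    right; exact ⟨a * s, by ring⟩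
  · subst h
    left; exact ⟨r, by ring⟩

/-- Degree condition for the fixed field of `σ`, elementary form. -/
def Deg8 {L : Type*} [Field L] [CharZero L] (σ : L →+* L) : Prop :=
  ∀ (a p q u0 u1 w0 w1 : ℚ) (w ρ y : L), σ w = w → σ ρ = ρ → σ y = y →
    w ^ 2 = a → ρ ^ 2 = p + q * w → y ^ 2 = (u0 + u1 * w) + (w0 + w1 * w) * ρ →
    ¬ IsSquare a → ¬ SqQ a p q →
    ∃ r0 r1 s0 s1 : ℚ, y = (r0 + r1 * w) + (s0 + s1 * w) * ρ

section
variable {L : Type*} [Field L] [CharZero L] {σ : L →+* L}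

theorem Deg8.eqs (h : Deg8 σ) (a p q u0 u1 w0 w1 : ℚ) (w ρ y : L)
    (fw : σ w = w) (fρ : σ ρ = ρ) (fy : σ y = y)
    (hw : w ^ 2 = a) (hρ : ρ ^ 2 = p + q * w) (hy : y ^ 2 = (u0 + u1 * w) + (w0 + w1 * w) * ρ)
    (ha : ¬ IsSquare a) (hc : ¬ SqQ a p q) :
    ∃ r0 r1 s0 s1 : ℚ,
      u0 = r0 ^ 2 + a * r1 ^ 2 + (s0 ^ 2 + a * s1 ^ 2) * p + 2 * a * s0 * s1 * q ∧
      u1 = 2 * r0 * r1 + 2 * s0 * s1 * p + (s0 ^ 2 + a * s1 ^ 2) * q ∧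
      w0 = 2 * (r0 * s0 + a * r1 * s1) ∧ w1 = 2 * (r0 * s1 + r1 * s0) := by
  obtain ⟨r0, r1, s0, s1, h⟩ := h a p q u0 u1 w0 w1 w ρ y fw fρ fy hw hρ hy ha hc
  have := lin_indep2 a p q w ρ hw hρ ha hc
    (r0 ^ 2 + a * r1 ^ 2 + (s0 ^ 2 + a * s1 ^ 2) * p + 2 * a * s0 * s1 * q - u0)
    (2 * r0 * r1 + 2 * s0 * s1 * p + (s0 ^ 2 + a * s1 ^ 2) * q - u1)
    (2 * (r0 * s0 + a * r1 * s1) - w0) (2 * (r0 * s1 + r1 * s0) - w1) (by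
      push_cast
      rw [h] at hy
      linear_combination hy - (s0 + s1 * w) ^ 2 * hρ -
        (r1 ^ 2 + 2 * r1 * s1 * ρ + s1 ^ 2 * (p + q * w) + 2 * s0 * s1 * q) * hw)
  obtain ⟨h1, h2, h3, h4⟩ := this
  exact ⟨r0, r1, s0, s1, by linarith, by linarith, by linarith, by linarith⟩

/-- `D8b`. -/
theorem Deg8.normSq (h : Deg8 σ) (a p q u0 u1 w0 w1 : ℚ) (w ρ y : L)
    (fw : σ w = w) (fρ : σ ρ = ρ) (fy : σ y = y)
    (hw : w ^ 2 = a) (hρ : ρ ^ 2 = p + q * w) (hy : y ^ 2 = (u0 + u1 * w) + (w0 + w1 * w) * ρ)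
    (ha : ¬ IsSquare a) (hc : ¬ SqQ a p q) :
    SqQ a (u0 ^ 2 + a * u1 ^ 2 - p * (w0 ^ 2 + a * w1 ^ 2) - 2 * a * q * w0 * w1)
      (2 * u0 * u1 - q * (w0 ^ 2 + a * w1 ^ 2) - 2 * p * w0 * w1) := by
  obtain ⟨r0, r1, s0, s1, rfl, rfl, rfl, rfl⟩ :=
    h.eqs a p q u0 u1 w0 w1 w ρ y fw fρ fy hw hρ hy ha hc
  exact ⟨r0 ^ 2 + a * r1 ^ 2 - (s0 ^ 2 + a * s1 ^ 2) * p - 2 * a * s0 * s1 * q,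
    2 * r0 * r1 - 2 * s0 * s1 * p - (s0 ^ 2 + a * s1 ^ 2) * q, by ring, by ring⟩

/-- `D8a`. -/
theorem Deg8.two (h : Deg8 σ) (a p q u0 u1 : ℚ) (w ρ y : L)
    (fw : σ w = w) (fρ : σ ρ = ρ) (fy : σ y = y)
    (hw : w ^ 2 = a) (hρ : ρ ^ 2 = p + q * w) (hy : y ^ 2 = u0 + u1 * w)
    (ha : ¬ IsSquare a) (hc : ¬ SqQ a p q) :
    SqQ a u0 u1 ∨ SqQ a (u0 * p + a * u1 * q) (u0 * q + u1 * p) := by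
  obtain ⟨r0, r1, s0, s1, rfl, rfl, h3, h4⟩ :=
    h.eqs a p q u0 u1 0 0 w ρ y fw fρ fy hw hρ (by rw [hy]; push_cast; ring) ha hc
  by_cases hs : s0 ^ 2 - a * s1 ^ 2 = 0
  · have hs1 : s1 = 0 := by
      by_contra hs1
      apply ha
      exact ⟨s0 / s1, by field_simp; linarith⟩
    subst hs1
    have hs0 : s0 = 0 := by simpa using hs
    subst hs0
    left; exact ⟨r0, r1, by ring, by ring⟩
  · have hr0 : r0 = 0 := by
      have : r0 * (s0 ^ 2 - a * s1 ^ 2) = 0 := by linear_combination (-s0 * h3 + a * s1 * h4) / 2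
      exact (mul_eq_zero.mp this).resolve_right hs
    have hr1 : r1 = 0 := by
      have : r1 * (s0 ^ 2 - a * s1 ^ 2) = 0 := by linear_combination (-s0 * h4 + s1 * h3) / 2
      exact (mul_eq_zero.mp this).resolve_right hs
    subst hr0 hr1
    right
    exact ⟨s0 * p + a * s1 * q, s0 * q + s1 * p, by ring, by ring⟩

/-- Norm form of `D8a`. -/
theorem Deg8.contra (h : Deg8 σ) (a p q u0 u1 : ℚ) (w ρ y : L)
    (fw : σ w = w) (fρ : σ ρ = ρ) (fy : σ y = y)
    (hw : w ^ 2 = a) (hρ : ρ ^ 2 = p + q * w) (hy : y ^ 2 = u0 + u1 * w)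
    (ha : ¬ IsSquare a) (hc : ¬ SqQ a p q) (h1 : ¬ IsSquare (u0 ^ 2 - a * u1 ^ 2))
    (h2 : ¬ IsSquare ((u0 ^ 2 - a * u1 ^ 2) * (p ^ 2 - a * q ^ 2))) : False := by
  rcases h.two a p q u0 u1 w ρ y fw fρ fy hw hρ hy ha hc with h | h
  · exact h1 h.norm
  · apply h2
    convert h.norm using 1
    ring

/-- `D8c`. -/
theorem Deg8.three (h : Deg8 σ) (a b c : ℚ) (w ρ y : L)
    (fw : σ w = w) (fρ : σ ρ = ρ) (fy : σ y = y)
    (hw : w ^ 2 = a) (hρ : ρ ^ 2 = b) (hy : y ^ 2 = c)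
    (ha : ¬ IsSquare a) (hb : ¬ IsSquare b) (hc : ¬ IsSquare c) (hab : ¬ IsSquare (a * b))
    (hac : ¬ IsSquare (a * c)) (hbc : ¬ IsSquare (b * c)) (habc : ¬ IsSquare (a * (b * c))) :
    False := by
  have hn : ¬ SqQ a b 0 := fun hh => hh.rat.elim hb hab
  rcases h.two a b 0 c 0 w ρ y fw fρ fy hw (by rw [hρ]; simp) (by rw [hy]; simp) ha hn with h | h
  · exact h.rat.elim hc hac
  · simp only [mul_zero, add_zero, zero_mul] at h
    rw [mul_comm c b] at h
    exact h.rat.elim hbc habc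

theorem Deg8.ofCond {K : Type*} [Field K] [CharZero K] [FiniteDimensional ℚ K]
    (h8 : ¬ 8 ∣ Module.finrank ℚ K) : Deg8 (RingHom.id K) := by
  intro a p q u0 u1 w0 w1 w ρ y _ _ _ h1 h2 h3 h4 h5
  exact deg8 h8 a p q u0 u1 w0 w1 w ρ y h1 h2 h3 h4 h5

theorem Deg8.transfer {K : Type*} [Field K] [CharZero K] (h : Deg8 (RingHom.id K)) (f : K →+* L)
    (hf : ∀ x, σ x = x → ∃ k, f k = x) : Deg8 σ := by
  intro a p q u0 u1 w0 w1 w ρ y fw fρ fy h1 h2 h3 h4 h5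
  obtain ⟨w, rfl⟩ := hf w fw
  obtain ⟨ρ, rfl⟩ := hf ρ fρ
  obtain ⟨y, rfl⟩ := hf y fy
  obtain ⟨r0, r1, s0, s1, h⟩ := h a p q u0 u1 w0 w1 w ρ y rfl rfl rfl
    (by apply f.injective; simpa using h1) (by apply f.injective; simpa using h2)
    (by apply f.injective; simpa using h3) h4 h5
  exact ⟨r0, r1, s0, s1, by rw [h]; simp⟩
end


/-- Existence of a place above `2` whose ramification index is not divisible by `8`. -/
theorem exists_ord (K : Type*) [Field K] [NumberField K] (h8 : ¬ 8 ∣ Module.finrank ℚ K) :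
    ∃ (o : K → ℤ) (e : ℤ), 0 < e ∧ ¬ (8 ∣ e) ∧ o 2 = e ∧
      (∀ x y, x ≠ 0 → y ≠ 0 → o (x * y) = o x + o y) ∧
      (∀ x y, x ≠ 0 → y ≠ 0 → x + y ≠ 0 → min (o x) (o y) ≤ o (x + y)) := by
  classical
  let R := NumberField.RingOfIntegers K
  let p : Ideal ℤ := Ideal.span {2}
  have hp0 : p ≠ ⊥ := by simp [p]
  have hpp : p.IsPrime := by
    rw [Ideal.span_singleton_prime (by norm_num)]; exact Int.prime_two
  have : p.IsMaximal := hpp.isMaximal hp0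
  have : Fintype (p.primesOver R) := Fintype.ofFinite _
  have hsum := Ideal.sum_ramification_inertia_eq_finrank (R := ℤ) (S := R) (p := p)
  have hrk : Module.finrank ℤ R = Module.finrank ℚ K := NumberField.RingOfIntegers.rank K
  rw [hrk] at hsum
  have hex : ∃ q : p.primesOver R, ¬ 8 ∣ q.1.ramificationIdx ℤ := by
    by_contra hcon
    push Not at hcon
    apply h8
    rw [← hsum]
    exact Finset.dvd_sum fun q _ => Dvd.dvd.mul_right (hcon q) _
  obtain ⟨⟨q, hq1, hq2⟩, hq⟩ := hex
  have hmap : p.map (algebraMap ℤ R) = Ideal.span {(2 : R)} := by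
    simp [p, Ideal.map_span]
  have hmap0 : p.map (algebraMap ℤ R) ≠ ⊥ := by rw [hmap]; simp
  have hq0 : q ≠ ⊥ := Ideal.ne_bot_of_liesOver_of_ne_bot hp0 q
  have hmul := Ideal.IsDedekindDomain.ramificationIdx_eq_multiplicity p q hmap0
  let v : IsDedekindDomain.HeightOneSpectrum R := ⟨q, hq1, hq0⟩
  have h2 : v.valuation K (2 : K) = WithZero.exp (-(q.ramificationIdx ℤ : ℤ)) := by
    have : (2 : K) = algebraMap R K 2 := (map_ofNat (algebraMap R K) 2).symm
    rw [this, IsDedekindDomain.HeightOneSpectrum.valuation_of_algebraMap,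
      v.intValuation_eq_exp_neg_multiplicity (by norm_num), hmul, hmap]
  refine ⟨fun x => - WithZero.log (v.valuation K x), q.ramificationIdx ℤ, ?_, ?_, ?_, ?_, ?_⟩
  · rcases Nat.eq_zero_or_pos (q.ramificationIdx ℤ) with h | h
    · rw [h] at hq; simp at hq
    · exact_mod_cast h
  · intro h; apply hq; exact_mod_cast h
  · simp [h2]
  · intro x y hx hy
    have hx' : v.valuation K x ≠ 0 := by simpa using hx
    have hy' : v.valuation K y ≠ 0 := by simpa using hy
    simp only [map_mul, WithZero.log_mul hx' hy']; ring
  · intro x y hx hy hxy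
    have hx' : v.valuation K x ≠ 0 := by simpa using hx
    have hy' : v.valuation K y ≠ 0 := by simpa using hy
    have hxy' : v.valuation K (x + y) ≠ 0 := by simpa using hxy
    rcases (v.valuation K).map_add' x y with h | h
    · have := (WithZero.log_le_log hxy' hx').mpr h
      exact min_le_iff.mpr (Or.inl (by linarith))
    · have := (WithZero.log_le_log hxy' hy').mpr h
      exact min_le_iff.mpr (Or.inr (by linarith))


/-- Laws of an additive order function (away from `0`). -/
structure IsOrd {K : Type*} [Field K] (o : K → ℤ) : Prop where
  mul : ∀ x y, x ≠ 0 → y ≠ 0 → o (x * y) = o x + o y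
  add : ∀ x y, x ≠ 0 → y ≠ 0 → x + y ≠ 0 → min (o x) (o y) ≤ o (x + y)

namespace IsOrd
variable {K : Type*} [Field K] {o : K → ℤ}

theorem one (h : IsOrd o) : o 1 = 0 := by
  have := h.mul 1 1 one_ne_zero one_ne_zero
  simp at this; exact this

theorem neg_one (h : IsOrd o) : o (-1) = 0 := by
  have h1 := h.mul (-1) (-1) (by simp) (by simp)
  have h2 := h.one
  simp at h1; omega

theorem neg (h : IsOrd o) (x : K) : o (-x) = o x := by
  by_cases hx : x = 0
  · simp [hx]
  have := h.mul (-1) x (by simp) hx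
  rw [h.neg_one] at this
  simpa using this

theorem sq (h : IsOrd o) (x : K) (hx : x ≠ 0) : o (x ^ 2) = 2 * o x := by
  rw [pow_two, h.mul x x hx hx]; ring

/-- `x + y` has order exactly `o x` when `y` has larger order. -/
theorem add_eq (h : IsOrd o) {x y : K} (hx : x ≠ 0) (hy : y = 0 ∨ o x < o y) : x + y ≠ 0 ∧ o (x + y) = o x := by
  rcases eq_or_ne y 0 with rfl | hy0
  · simp [hx]
  replace hy := hy.resolve_left hy0
  have hne : x + y ≠ 0 := by
    intro h0
    have : x = -y := by linear_combination h0
    rw [this, h.neg] at hy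
    omega
  refine ⟨hne, le_antisymm ?_ ?_⟩
  · have := h.add (x + y) (-y) hne (by simpa using hy0) (by simpa using hx)
    rw [h.neg] at this
    simp only [add_neg_cancel_right] at this
    omega
  · have := h.add x y hx hy0 hne
    omega

theorem add_ge (h : IsOrd o) {x y : K} {k : ℤ} (hx : x = 0 ∨ k ≤ o x) (hy : y = 0 ∨ k ≤ o y) :
    x + y = 0 ∨ k ≤ o (x + y) := by
  by_cases hx0 : x = 0
  · subst hx0; simpa using hy
  by_cases hy0 : y = 0
  · subst hy0; simpa using hx
  by_cases hxy : x + y = 0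
  · exact Or.inl hxy
  right
  have := h.add x y hx0 hy0 hxy
  have h1 := hx.resolve_left hx0
  have h2 := hy.resolve_left hy0
  omega

theorem mul_ge (h : IsOrd o) {x y : K} {k l : ℤ} (hx : x = 0 ∨ k ≤ o x) (hy : y = 0 ∨ l ≤ o y) :
    x * y = 0 ∨ k + l ≤ o (x * y) := by
  by_cases hx0 : x = 0
  · subst hx0; simp
  by_cases hy0 : y = 0
  · subst hy0; simp
  right
  rw [h.mul x y hx0 hy0]
  have h1 := hx.resolve_left hx0
  have h2 := hy.resolve_left hy0
  omega

/-- First order step: away from order zero, doubling increases `|ord s|`. -/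
theorem grow (h : IsOrd o) (e : ℤ) (he : 0 < e) (h2 : o 2 = e) (h20 : (2 : K) ≠ 0) (a s y s' : K)
    (ha : a ^ 2 = 1) (hy : y ^ 2 = s ^ 3 + a * s ^ 2 + s)
    (hy0 : y ≠ 0) (hs' : s' ≠ 0) (hd : 4 * y ^ 2 * s' = (s ^ 2 - 1) ^ 2) (hk : o s ≠ 0) :
    |o s| < |o s'| := by
  have hs0 : s ≠ 0 := by rintro rfl; apply hy0; simpa using hy
  have ha0 : a ≠ 0 := by rintro rfl; simp at ha
  have hoa : o a = 0 := by
    have := h.sq a ha0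
    rw [ha, h.one] at this; omega
  have h4 : o 4 = 2 * e := by
    have := h.sq 2 h20
    rw [h2] at this
    norm_num at this
    exact this
  have h40 : (4 : K) ≠ 0 := by
    have : (4 : K) = 2 ^ 2 := by norm_num
    rw [this]; exact pow_ne_zero _ h20
  have hyy := h.sq y hy0
  have e1 : y ^ 2 = s * (s ^ 2 + a * s + 1) := by rw [hy]; ring
  have hq0 : s ^ 2 + a * s + 1 ≠ 0 := by
    intro hq; rw [hq] at e1; apply hy0; simpa using e1
  have e2 := h.mul _ _ hs0 hq0
  rw [← e1, hyy] at e2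
  have hm0 : s ^ 2 - 1 ≠ 0 := by
    intro hq; rw [hq] at hd
    have : 4 * y ^ 2 * s' ≠ 0 := mul_ne_zero (mul_ne_zero h40 (pow_ne_zero _ hy0)) hs'
    apply this; rw [hd]; ring
  have e3 := h.sq _ hm0
  rw [← hd, h.mul _ _ (mul_ne_zero h40 (pow_ne_zero _ hy0)) hs',
    h.mul _ _ h40 (pow_ne_zero _ hy0), hyy, h4] at e3
  have hs2 := h.sq s hs0
  have has : o (a * s) = o s := by rw [h.mul _ _ ha0 hs0, hoa]; ring
  have h1 := h.one
  have hm1 := h.neg_one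
  rcases lt_or_gt_of_ne hk with hk | hk
  · -- negative order
    have f1 := (h.add_eq (x := s ^ 2) (y := a * s) (pow_ne_zero _ hs0) (Or.inr (by omega)))
    have f2 := (h.add_eq (x := s ^ 2 + a * s) (y := 1) f1.1 (Or.inr (by omega)))
    have f3 := (h.add_eq (x := s ^ 2) (y := -1) (pow_ne_zero _ hs0) (Or.inr (by omega)))
    rw [← sub_eq_add_neg] at f3
    rw [abs_of_neg hk, abs_of_neg (by omega)]; omega
  · have f1 := (h.add_eq (x := 1) (y := a * s) one_ne_zero (Or.inr (by omega)))
    have f2 := (h.add_eq (x := 1 + a * s) (y := s ^ 2) f1.1 (Or.inr (by omega)))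
    have f3 := (h.add_eq (x := -1) (y := s ^ 2) (by simp) (Or.inr (by omega)))
    have g2 : 1 + a * s + s ^ 2 = s ^ 2 + a * s + 1 := by ring
    have g3 : -1 + s ^ 2 = s ^ 2 - 1 := by ring
    rw [g2] at f2; rw [g3] at f3
    rw [abs_of_pos hk, abs_of_neg (by omega)]; omega

/-- order of `d`. -/
theorem ord_d (h : IsOrd o) (e : ℤ) (he : 0 < e) (h2 : o 2 = e) (h20 : (2 : K) ≠ 0) (d d' : K)
    (hd1 : 1 + d ≠ 0) (hd2 : o (1 + d) = 0) (hd1' : 1 + d' ≠ 0) (hd2' : o (1 + d') = 0)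
    (hq : 1 + d + d ^ 2 ≠ 0)
    (hE : (d * (2 + d)) ^ 2 = 4 * (1 + d) * (1 + d + d ^ 2) * (1 + d')) :
    d ≠ 0 ∧ 2 * o d = e := by
  have h4 : o 4 = 2 * e := by
    have := h.sq 2 h20
    rw [h2] at this
    norm_num at this
    exact this
  have h40 : (4 : K) ≠ 0 := by
    have : (4 : K) = 2 ^ 2 := by norm_num
    rw [this]; exact pow_ne_zero _ h20
  have hR : 4 * (1 + d) * (1 + d + d ^ 2) * (1 + d') ≠ 0 :=
    mul_ne_zero (mul_ne_zero (mul_ne_zero h40 hd1) hq) hd1'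
  have hd0 : d ≠ 0 := by rintro rfl; apply hR; rw [← hE]; simp
  have hd20 : 2 + d ≠ 0 := by intro h0; apply hR; rw [← hE, h0]; simp
  refine ⟨hd0, ?_⟩
  have e1 := h.sq (d * (2 + d)) (mul_ne_zero hd0 hd20)
  rw [hE, h.mul _ _ hd0 hd20, h.mul _ _ (mul_ne_zero (mul_ne_zero h40 hd1) hq) hd1',
    h.mul _ _ (mul_ne_zero h40 hd1) hq, h.mul _ _ h40 hd1, h4, hd2, hd2'] at e1
  have hdn : 0 ≤ o d := by
    have := h.add_ge (x := 1 + d) (y := -1) (k := 0) (Or.inr (by omega))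
      (Or.inr (by rw [h.neg_one]))
    have e : 1 + d + -1 = d := by ring
    rw [e] at this
    exact this.resolve_left hd0
  have hqn : 0 ≤ o (1 + d + d ^ 2) := by
    have := h.add_ge (x := 1 + d) (y := d ^ 2) (k := 0) (Or.inr (by omega))
      (Or.inr (by rw [h.sq d hd0]; omega))
    exact this.resolve_left hq
  have h2d := h.add 2 d h20 hd0 hd20
  rcases lt_trichotomy (o d) e with hlt | heq | hgt
  · have f := h.add_eq (x := d) (y := 2) hd0 (Or.inr (by omega))
    rw [add_comm] at f
    have hpos : 0 < o d := by omega
    have f2 := h.add_eq (x := 1) (y := d) one_ne_zero (Or.inr (by rw [h.one]; omega))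
    have f3 := h.add_eq (x := 1 + d) (y := d ^ 2) f2.1
      (Or.inr (by rw [f2.2, h.one, h.sq d hd0]; omega))
    have := h.one
    omega
  · have f2 := h.add_eq (x := 1) (y := d) one_ne_zero (Or.inr (by rw [h.one]; omega))
    have f3 := h.add_eq (x := 1 + d) (y := d ^ 2) f2.1
      (Or.inr (by rw [f2.2, h.one, h.sq d hd0]; omega))
    have := h.one
    omega
  · have f2 := h.add_eq (x := 1) (y := d) one_ne_zero (Or.inr (by rw [h.one]; omega))
    have f3 := h.add_eq (x := 1 + d) (y := d ^ 2) f2.1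
      (Or.inr (by rw [f2.2, h.one, h.sq d hd0]; omega))
    have := h.one
    omega

theorem ord_T (h : IsOrd o) (e : ℤ) (he : 0 < e) (h2 : o 2 = e) (h20 : (2 : K) ≠ 0) (d d' : K)
    (hd1 : 1 + d ≠ 0) (hd2 : o (1 + d) = 0) (hq : 1 + d + d ^ 2 ≠ 0)
    (hd0 : d ≠ 0) (hd : 2 * o d = e) (hd0' : d' ≠ 0) (hd' : 2 * o d' = e)
    (hE : (d * (2 + d)) ^ 2 = 4 * (1 + d) * (1 + d + d ^ 2) * (1 + d')) :
    (d ^ 2 - 2 ≠ 0 ∧ 4 * o (d ^ 2 - 2) = 5 * e) ∧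
    d * (d ^ 2 - 2) + 4 * d + 2 * d ^ 2 ≠ 0 ∧ 4 * o (d * (d ^ 2 - 2) + 4 * d + 2 * d ^ 2) = 7 * e := by
  have h4 : o 4 = 2 * e := by
    have := h.sq 2 h20
    rw [h2] at this
    norm_num at this
    exact this
  have h40 : (4 : K) ≠ 0 := by
    have : (4 : K) = 2 ^ 2 := by norm_num
    rw [this]; exact pow_ne_zero _ h20
  have h8 : o (8 * (1 + d)) = 3 * e := by
    have : (8 : K) * (1 + d) = 2 * (4 * (1 + d)) := by ring
    rw [this, h.mul _ _ h20 (mul_ne_zero h40 hd1), h.mul _ _ h40 hd1]; omega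
  have f2 := h.add_eq (x := 1) (y := d) one_ne_zero (Or.inr (by rw [h.one]; omega))
  have f3 := h.add_eq (x := 1 + d) (y := d ^ 2) f2.1
      (Or.inr (by rw [f2.2, h.one, h.sq d hd0]; omega))
  have h1 := h.one
  have hid : 4 * (1 + d) * (1 + d + d ^ 2) * d' + 8 * (1 + d) = (d ^ 2 - 2) ^ 2 := by
    linear_combination -hE
  have hL0 : 4 * (1 + d) * (1 + d + d ^ 2) * d' ≠ 0 :=
    mul_ne_zero (mul_ne_zero (mul_ne_zero h40 hd1) hq) hd0'
  have hL : o (4 * (1 + d) * (1 + d + d ^ 2) * d') = 2 * e + o d' := by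
    rw [h.mul _ _ (mul_ne_zero (mul_ne_zero h40 hd1) hq) hd0',
      h.mul _ _ (mul_ne_zero h40 hd1) hq, h.mul _ _ h40 hd1, h4, hd2]; omega
  have f4 := h.add_eq hL0 (y := 8 * (1 + d)) (Or.inr (by omega))
  rw [hid] at f4
  have hm0 : d ^ 2 - 2 ≠ 0 := by intro h0; rw [h0] at f4; simp at f4
  have hm := h.sq _ hm0
  have hm4 : 4 * o (d ^ 2 - 2) = 5 * e := by omega
  refine ⟨⟨hm0, hm4⟩, ?_⟩
  have g1 : o (d * (d ^ 2 - 2)) = o d + o (d ^ 2 - 2) := h.mul _ _ hd0 hm0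
  have g2 : o (4 * d) = 2 * e + o d := by rw [h.mul _ _ h40 hd0, h4]
  have g3 : o (2 * d ^ 2) = e + 2 * o d := by
    rw [h.mul _ _ h20 (pow_ne_zero _ hd0), h2, h.sq d hd0]
  have k1 := h.add_eq (mul_ne_zero hd0 hm0) (y := 4 * d) (Or.inr (by omega))
  have k2 := h.add_eq k1.1 (y := 2 * d ^ 2) (Or.inr (by omega))
  exact ⟨k2.1, by omega⟩

/-- `a = -1` : contradiction. -/
theorem final_neg (h : IsOrd o) (e : ℤ) (he : 0 < e) (h8 : ¬ 8 ∣ e) (h2 : o 2 = e) (h20 : (2 : K) ≠ 0) (d y : K)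
    (hT0 : d * (d ^ 2 - 2) + 4 * d + 2 * d ^ 2 ≠ 0)
    (hT : 4 * o (d * (d ^ 2 - 2) + 4 * d + 2 * d ^ 2) = 7 * e)
    (hy : y ^ 2 = (1 + d) * (1 + d + d ^ 2)) : False := by
  set T := d * (d ^ 2 - 2) + 4 * d + 2 * d ^ 2 with hTd
  have hc : (y - 1) * ((y - 1) + 2) = T := by rw [hTd]; linear_combination hy
  generalize y - 1 = c at hc
  have hc0 : c ≠ 0 := by rintro rfl; apply hT0; rw [← hc]; simp
  have hc20 : c + 2 ≠ 0 := by intro h0; apply hT0; rw [← hc, h0]; simp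
  have e1 := h.mul _ _ hc0 hc20
  rw [hc] at e1
  by_cases hlt : o c < e
  · have := h.add_eq hc0 (y := 2) (Or.inr (by omega))
    omega
  · have := h.add c 2 hc0 h20 hc20
    omega

theorem final_pos (h : IsOrd o) (e : ℤ) (he : 0 < e) (h8 : ¬ 8 ∣ e) (h2 : o 2 = e) (h20 : (2 : K) ≠ 0) (d y : K)
    (hd0 : d ≠ 0) (hd : 2 * o d = e)
    (hm0 : d ^ 2 - 2 ≠ 0) (hm : 4 * o (d ^ 2 - 2) = 5 * e)
    (hT0 : d * (d ^ 2 - 2) + 4 * d + 2 * d ^ 2 ≠ 0)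
    (hT : 4 * o (d * (d ^ 2 - 2) + 4 * d + 2 * d ^ 2) = 7 * e)
    (hy : y ^ 2 = -((1 + d) * (1 + d + d ^ 2))) : False := by
  have h4 : o 4 = 2 * e := by
    have := h.sq 2 h20
    rw [h2] at this
    norm_num at this
    exact this
  have h40 : (4 : K) ≠ 0 := by
    have : (4 : K) = 2 ^ 2 := by norm_num
    rw [this]; exact pow_ne_zero _ h20
  set T := d * (d ^ 2 - 2) + 4 * d + 2 * d ^ 2 with hTd
  have hc : (y - 1) ^ 2 + 2 * (y - 1) + 2 = -T := by rw [hTd]; linear_combination hy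
  generalize y - 1 = c at hc
  have hoT : o (-T) = o T := h.neg T
  have hc0 : c ≠ 0 := by
    rintro rfl
    have : (2 : K) = -T := by rw [← hc]; ring
    rw [this, hoT] at h2; omega
  have hcc := h.sq c hc0
  have h2c : o (2 * c) = e + o c := by rw [h.mul _ _ h20 hc0, h2]
  have hg : 2 * o c = e := by
    rcases lt_trichotomy (2 * o c) e with hlt | heq | hgt
    · have f1 := h.add_eq (pow_ne_zero 2 hc0) (y := 2 * c) (Or.inr (by omega))
      have f2 := h.add_eq f1.1 (y := 2) (Or.inr (by omega))
      rw [hc] at f2; omega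
    · exact heq
    · have f1 := h.add_eq h20 (y := 2 * c) (Or.inr (by omega))
      have f2 := h.add_eq f1.1 (y := c ^ 2) (Or.inr (by omega))
      have : 2 + 2 * c + c ^ 2 = -T := by rw [← hc]; ring
      rw [this] at f2; omega
  have hid : -(d ^ 2 - 2) + (-4) + (-(2 * c)) + (-T) = (c - d) * (c - d + 2 * d) := by
    linear_combination -hc
  have k1 := h.add_eq (x := -(d ^ 2 - 2)) (neg_ne_zero.mpr hm0) (y := -4)
    (Or.inr (by rw [h.neg, h.neg]; omega))
  rw [h.neg] at k1
  have k2 := h.add_eq k1.1 (y := -(2 * c)) (Or.inr (by rw [h.neg]; omega))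
  have k3 := h.add_eq k2.1 (y := -T) (Or.inr (by omega))
  rw [hid] at k3
  have hm1 : c - d ≠ 0 := left_ne_zero_of_mul k3.1
  have hm2 : c - d + 2 * d ≠ 0 := right_ne_zero_of_mul k3.1
  rw [h.mul _ _ hm1 hm2] at k3
  have h2d : o (2 * d) = e + o d := by rw [h.mul _ _ h20 hd0, h2]
  by_cases hlt : o (c - d) < o (2 * d)
  · have := h.add_eq hm1 (y := 2 * d) (Or.inr (by omega))
    omega
  · have := h.add (c - d) (2 * d) hm1 (mul_ne_zero h20 hd0) hm2
    omega

end IsOrd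

/-- No finite doubling-invariant set of non-2-torsion points. -/
theorem no_orbit (K : Type*) [Field K] [NumberField K] (h8 : ¬ 8 ∣ Module.finrank ℚ K)
    (a : K) (ha : a = 1 ∨ a = -1) (B : Set (K × K)) (hfin : B.Finite) (hne : B.Nonempty)
    (hcur : ∀ p ∈ B, p.2 ^ 2 = p.1 ^ 3 + a * p.1 ^ 2 + p.1) (hy : ∀ p ∈ B, p.2 ≠ 0)
    (hinv : ∀ p ∈ B, ∃ p' ∈ B, 4 * p.2 ^ 2 * p'.1 = (p.1 ^ 2 - 1) ^ 2) : False := by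
  obtain ⟨o, e, he, h8e, h2, hmul, hadd⟩ := exists_ord K h8
  have h : IsOrd o := ⟨hmul, hadd⟩
  have h20 : (2 : K) ≠ 0 := two_ne_zero
  have ha2 : a ^ 2 = 1 := by rcases ha with rfl | rfl <;> norm_num
  have hs0 : ∀ p ∈ B, p.1 ≠ 0 := by
    intro p hp h0
    apply hy p hp
    have := hcur p hp
    rw [h0] at this; simpa using this
  have hoz : ∀ p ∈ B, o p.1 = 0 := by
    obtain ⟨p, hp, hmax⟩ := Set.exists_max_image B (fun p => |o p.1|) hfin hne
    have hpz : o p.1 = 0 := by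
      by_contra hk
      obtain ⟨p', hp', hd⟩ := hinv p hp
      have := h.grow e he h2 h20 a p.1 p.2 p'.1 ha2 (hcur p hp) (hy p hp) (hs0 p' hp') hd hk
      have h3 := hmax p' hp'
      exact absurd this (not_lt.mpr h3)
    intro q hq
    have := hmax q hq
    simp only [hpz, abs_zero] at this
    exact abs_eq_zero.mp (le_antisymm this (abs_nonneg _))
  have ha0 : a ≠ 0 := by rintro rfl; simp at ha2
  have hna : o (-a) = 0 := by
    rcases ha with rfl | rfl
    · exact h.neg_one
    · simpa using h.one
  -- d-parametrisation
  have key : ∀ p ∈ B, (1 + (-a * p.1 - 1) ≠ 0 ∧ o (1 + (-a * p.1 - 1)) = 0) ∧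
      1 + (-a * p.1 - 1) + (-a * p.1 - 1) ^ 2 ≠ 0 := by
    intro p hp
    have e1 : 1 + (-a * p.1 - 1) = -a * p.1 := by ring
    refine ⟨⟨?_, ?_⟩, ?_⟩
    · rw [e1]; exact mul_ne_zero (neg_ne_zero.mpr ha0) (hs0 p hp)
    · rw [e1, h.mul _ _ (neg_ne_zero.mpr ha0) (hs0 p hp), hna, hoz p hp]; rfl
    · intro h0
      apply hy p hp
      have := hcur p hp
      have h3 : p.2 ^ 2 = 0 := by
        linear_combination this + p.1 * h0 - p.1 ^ 3 * ha2
      simpa using h3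
  have hE : ∀ p p' : K × K, p ∈ B → 4 * p.2 ^ 2 * p'.1 = (p.1 ^ 2 - 1) ^ 2 →
      ((-a * p.1 - 1) * (2 + (-a * p.1 - 1))) ^ 2 = 4 * (1 + (-a * p.1 - 1)) *
        (1 + (-a * p.1 - 1) + (-a * p.1 - 1) ^ 2) * (1 + (-a * p'.1 - 1)) := by
    intro p p' hp hd
    have h1 := hcur p hp
    rw [h1] at hd
    rcases ha with rfl | rfl
    · linear_combination -hd
    · linear_combination -hd
  obtain ⟨p, hp⟩ := hne
  obtain ⟨p', hp', hd⟩ := hinv p hp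
  obtain ⟨p'', hp'', hd'⟩ := hinv p' hp'
  obtain ⟨⟨k1, k2⟩, k3⟩ := key p hp
  obtain ⟨⟨k1', k2'⟩, k3'⟩ := key p' hp'
  obtain ⟨⟨k1'', k2''⟩, k3''⟩ := key p'' hp''
  have E1 := hE p p' hp hd
  have E2 := hE p' p'' hp' hd'
  obtain ⟨d0, od⟩ := h.ord_d e he h2 h20 _ _ k1 k2 k1' k2' k3 E1
  obtain ⟨d0', od'⟩ := h.ord_d e he h2 h20 _ _ k1' k2' k1'' k2'' k3' E2
  obtain ⟨⟨m0, om⟩, T0, oT⟩ := h.ord_T e he h2 h20 _ _ k1 k2 k3 d0 od d0' od' E1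
  have hc := hcur p hp
  rcases ha with rfl | rfl
  · exact h.final_pos e he h8e h2 h20 _ p.2 d0 od m0 om T0 oT (by rw [hc]; ring)
  · exact h.final_neg e he h8e h2 h20 _ p.2 T0 oT (by rw [hc]; ring)


theorem dbl_on {K : Type*} [Field K] [CharZero K] (a s y : K) (hy : y ^ 2 = s ^ 3 + a * s ^ 2 + s)
    (hy0 : y ≠ 0) :
    ((s ^ 2 - 1) * (s ^ 4 + 2 * a * s ^ 3 + 6 * s ^ 2 + 2 * a * s + 1) / (8 * y ^ 3)) ^ 2 =
      ((s ^ 2 - 1) ^ 2 / (4 * y ^ 2)) ^ 3 + a * ((s ^ 2 - 1) ^ 2 / (4 * y ^ 2)) ^ 2 +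
        (s ^ 2 - 1) ^ 2 / (4 * y ^ 2) := by
  have h6 : (8 * y ^ 3) ^ 2 = 64 * (y ^ 2) ^ 3 := by ring
  rw [div_pow, h6]
  have hf : s ^ 3 + a * s ^ 2 + s ≠ 0 := by rw [← hy]; exact pow_ne_zero _ hy0
  rw [hy]
  generalize hg : s ^ 3 + a * s ^ 2 + s = f at hf
  field_simp
  rw [← hg]; ring

section
variable {L : Type*} [Field L] [CharZero L] {σ : L →+* L}

/-- Halving on `E₁`. -/
theorem half_E1 (h : Deg8 σ) (s y s' y' : L) (fs : σ s = s) (fy : σ y = y) (fs' : σ s' = s')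
    (fy' : σ y' = y') (hy : y ^ 2 = s ^ 3 - s ^ 2 + s) (hy0 : y ≠ 0)
    (hy' : y' ^ 2 = s' ^ 3 - s' ^ 2 + s') (hd : 4 * y ^ 2 * s' = (s ^ 2 - 1) ^ 2)
    (hl : s' = 0 ∨ s' = 1 ∨ s' = -1 ∨ s' ^ 2 - s' + 1 = 0 ∨ s' ^ 2 + 1 = 0 ∨
      s' ^ 2 - 4 * s' + 1 = 0) :
    s = 1 ∨ s = -1 ∨ s ^ 2 + 1 = 0 ∨ s ^ 2 - 4 * s + 1 = 0 := by
  have hs0 : s ≠ 0 := by rintro rfl; apply hy0; simpa using hy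
  obtain ⟨u, hu⟩ : ∃ u, u = s + s⁻¹ := ⟨_, rfl⟩
  obtain ⟨y1, hy1⟩ : ∃ y1, y1 = y / s := ⟨_, rfl⟩
  have fu : σ u = u := by rw [hu]; simp [map_ofNat, fs]
  have fy1 : σ y1 = y1 := by rw [hy1]; simp [map_ofNat, fs, fy]
  have hus : u * s = s ^ 2 + 1 := by rw [hu]; field_simp
  have e1 : y1 ^ 2 = u - 1 := by
    rw [hy1, hu, div_pow, hy]; field_simp; ring
  have e2 : 4 * (u - 1) * s' = u ^ 2 - 4 := by
    rw [← e1, hy1, hu]; field_simp; linear_combination hd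
  rcases hl with h0 | h0 | h0 | h0 | h0 | h0
  · subst h0
    have : (s - 1) * (s + 1) = 0 := by
      have h3 : (s ^ 2 - 1) ^ 2 = 0 := by rw [← hd]; ring
      have := pow_eq_zero_iff (two_ne_zero) |>.mp h3
      linear_combination this
    rcases mul_eq_zero.mp this with h | h
    · left; linear_combination h
    · right; left; linear_combination h
  · subst h0
    have : u * (u - 4) = 0 := by linear_combination -e2
    rcases mul_eq_zero.mp this with h | h
    · right; right; left; rw [h] at hus; linear_combination -hus
    · right; right; right; linear_combination -hus + s * h
  · subst h0
    exfalso
    refine h.contra 3 (-3) 0 (-3) 2 ((u + 2) / 2) y' y1 (by simp [map_ofNat, fu]) fy' fy1 ?_ ?_ ?_ ?_ ?_ ?_ ?_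
    · push_cast; linear_combination -e2 / 4
    · push_cast; linear_combination hy'
    · push_cast; linear_combination e1
    · norm_num
    · intro hh; rcases hh.rat with hh | hh <;> norm_num at hh
    · norm_num
    · norm_num
  · exfalso
    have hu2 : u = 2 * s' := by
      have : (u - 2 * s') ^ 2 = 0 := by linear_combination -e2 + 4 * h0
      have := pow_eq_zero_iff (two_ne_zero) |>.mp this
      linear_combination this
    have hn : ¬ SqQ (-3) 0 1 := by intro hh; have := hh.norm; norm_num at this
    rcases h.two (-3) 0 1 (-6) 2 (2 * s' - 1) y1 (s - s⁻¹) (by simp [map_ofNat, fs']) fy1 (by simp [map_ofNat, fs])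
      (by push_cast; linear_combination 4 * h0) (by push_cast; linear_combination e1 + hu2)
      (by
        have : (s - s⁻¹) ^ 2 = u ^ 2 - 4 := by rw [hu]; field_simp; ring
        push_cast
        linear_combination this + (u + 2 * s') * hu2 + 4 * h0) (by norm_num) hn with hh | hh
    · have := hh.norm; norm_num at this
    · rcases hh.finer 12 (by norm_num) with hh | hh <;> norm_num at hh
  · exfalso
    have hn : ¬ SqQ (-1) 0 (-1) := by
      intro hh; rcases hh.finer 1 (by norm_num) with hh | hh <;> norm_num at hh
    have := h.normSq (-1) 0 (-1) (-1) 2 2 0 s' ((u - 2 * s') / 2) y1 fs' (by simp [map_ofNat, fu, fs']) fy1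
      (by push_cast; linear_combination h0) (by push_cast; linear_combination -e2 / 4 + h0)
      (by push_cast; linear_combination e1) (by norm_num) hn
    norm_num at this
    rcases this.rat with hh | hh <;> norm_num at hh
  · exfalso
    have hw : (s' - 2) ^ 2 = 3 := by linear_combination h0
    have hw0 : s' - 2 ≠ 0 := by intro h; rw [h] at hw; norm_num at hw
    have hn : ¬ SqQ 3 2 1 := by
      intro hh; rcases hh.finer 1 (by norm_num) with hh | hh <;> norm_num at hh
    obtain ⟨ρ, hρ⟩ : ∃ ρ, ρ = (u - 2 * s') / (2 * (s' - 2)) := ⟨_, rfl⟩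
    have hρ' : 2 * (s' - 2) * ρ = u - 2 * s' := by rw [hρ]; field_simp
    have hρ2 : ρ ^ 2 = s' := by
      have : 12 * ρ ^ 2 = 12 * s' := by
        linear_combination (2 * (s' - 2) * ρ + (u - 2 * s')) * hρ' - 4 * ρ ^ 2 * hw - e2 + 4 * h0
      linear_combination this / 12
    have := h.normSq 3 2 1 3 2 0 2 (s' - 2) ρ y1 (by simp [map_ofNat, fs'])
      (by rw [hρ]; simp [map_ofNat, fu, fs']) fy1
      (by push_cast; linear_combination hw) (by push_cast; linear_combination hρ2)
      (by push_cast; linear_combination e1 - hρ') (by norm_num) hn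
    norm_num at this
    rcases this.rat with hh | hh <;> norm_num at hh
end

/-- The list for `E₁`. -/
theorem list_E1 (K : Type*) [Field K] [NumberField K] (h8 : ¬ 8 ∣ Module.finrank ℚ K)
    (hfin : {p : K × K | p.2 ^ 2 = p.1 ^ 3 - p.1 ^ 2 + p.1}.Finite) (s y : K)
    (hy : y ^ 2 = s ^ 3 - s ^ 2 + s) :
    s = 0 ∨ s = 1 ∨ s = -1 ∨ s ^ 2 - s + 1 = 0 ∨ s ^ 2 + 1 = 0 ∨ s ^ 2 - 4 * s + 1 = 0 := by
  by_contra hcon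
  have hD := Deg8.ofCond h8
  let B : Set (K × K) := {p | p.2 ^ 2 = p.1 ^ 3 - p.1 ^ 2 + p.1 ∧
    ¬ (p.1 = 0 ∨ p.1 = 1 ∨ p.1 = -1 ∨ p.1 ^ 2 - p.1 + 1 = 0 ∨ p.1 ^ 2 + 1 = 0 ∨
      p.1 ^ 2 - 4 * p.1 + 1 = 0)}
  have hB0 : ∀ p ∈ B, p.2 ≠ 0 := by
    rintro ⟨s, y⟩ ⟨h1, h2⟩ h0
    simp only at h0 h1 h2
    subst h0
    have : s * (s ^ 2 - s + 1) = 0 := by linear_combination -h1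
    rcases mul_eq_zero.mp this with h | h
    · exact h2 (Or.inl h)
    · exact h2 (Or.inr (Or.inr (Or.inr (Or.inl h))))
  refine no_orbit K h8 (-1) (Or.inr rfl) B (hfin.subset fun p hp => hp.1) ⟨(s, y), hy, hcon⟩ ?_ hB0 ?_
  · rintro ⟨s, y⟩ ⟨h1, h2⟩
    simp only at h1 ⊢
    linear_combination h1
  · rintro ⟨s, y⟩ hp
    have hy0 : y ≠ 0 := hB0 _ hp
    obtain ⟨h1, h2⟩ := hp
    simp only at h1 h2
    have h3 := dbl_on (-1) s y (by linear_combination h1) hy0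
    have hd : 4 * y ^ 2 * ((s ^ 2 - 1) ^ 2 / (4 * y ^ 2)) = (s ^ 2 - 1) ^ 2 := by field_simp
    refine ⟨((s ^ 2 - 1) ^ 2 / (4 * y ^ 2),
      ((s ^ 2 - 1) * (s ^ 4 + 2 * (-1) * s ^ 3 + 6 * s ^ 2 + 2 * (-1) * s + 1) / (8 * y ^ 3))),
      ⟨?_, ?_⟩, hd⟩
    · simp only; linear_combination h3
    · intro hl
      simp only at hl
      have := half_E1 hD s y _ _ rfl rfl rfl rfl h1 hy0 (h3.trans (by ring)) hd hl
      tauto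

section
variable {L : Type*} [Field L] [CharZero L] {σ : L →+* L}

/-- Halving on the Jacobi quartic `Y² = x⁴ + x² + 1`. -/
theorem half_core (h : Deg8 σ) (x Y z A B : L) (fx : σ x = x) (fY : σ Y = Y) (fz : σ z = z)
    (fA : σ A = A) (fB : σ B = B) (hx : x ≠ 0) (hY : Y ^ 2 = x ^ 4 + x ^ 2 + 1)
    (hz : 2 * x * Y * z = 1 - x ^ 4) (hA : A ^ 2 = z ^ 2 - z + 1) (hB : B ^ 2 = z ^ 2 + z + 1)
    (hl : z = 0 ∨ z ^ 2 = 1 ∨ z ^ 2 = -1 ∨ z ^ 4 + z ^ 2 + 1 = 0) :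
    x ^ 2 = 1 ∨ x ^ 2 = -1 ∨ ((x + x⁻¹) ^ 2 - 4) ^ 2 = 12 ∨ (x + x⁻¹) ^ 2 = 2 := by
  obtain ⟨m, hm⟩ : ∃ m, m = x + x⁻¹ := ⟨_, rfl⟩
  obtain ⟨ρ, hρ⟩ : ∃ m, m = x - x⁻¹ := ⟨_, rfl⟩
  obtain ⟨y1, hy1⟩ : ∃ y1, y1 = Y / x := ⟨_, rfl⟩
  rw [← hm]
  have fm : σ m = m := by rw [hm]; simp [map_ofNat, fx]
  have fρ : σ ρ = ρ := by rw [hρ]; simp [map_ofNat, fx]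
  have fy1 : σ y1 = y1 := by rw [hy1]; simp [map_ofNat, fx, fY]
  have e1 : y1 ^ 2 = m ^ 2 - 1 := by
    rw [hy1, hm, div_pow, hY]; field_simp; ring
  have e2 : ρ ^ 2 = m ^ 2 - 4 := by rw [hρ, hm]; field_simp; ring
  have e3 : 2 * y1 * z = - (m * ρ) := by
    rw [hρ, hm, hy1]; field_simp; linear_combination hz
  have e4 : 4 * (m ^ 2 - 1) * z ^ 2 = m ^ 2 * (m ^ 2 - 4) := by
    rw [← e1, ← e2]; linear_combination (2 * y1 * z - m * ρ) * e3
  rcases hl with h0 | h0 | h0 | h0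
  · subst h0
    have : (x ^ 2 - 1) * (x ^ 2 + 1) = 0 := by linear_combination hz
    rcases mul_eq_zero.mp this with h | h
    · left; linear_combination h
    · right; left; linear_combination h
  · right; right; left
    rw [h0] at e4; linear_combination -e4
  · rw [h0] at e4
    have : (m ^ 2 - 2) * (m ^ 2 + 2) = 0 := by linear_combination -e4
    rcases mul_eq_zero.mp this with h' | h'
    · right; right; right; linear_combination h'
    · exfalso
      refine h.three (-2) (-6) (-1) m ρ z fm fρ fz ?_ ?_ ?_ ?_ ?_ ?_ ?_ ?_ ?_ ?_
      · push_cast; linear_combination h'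
      · push_cast; linear_combination e2 + h'
      · push_cast; exact h0
      all_goals norm_num
  · exfalso
    have hms : m ^ 2 = 2 + 2 * z ^ 2 := by
      have : (m ^ 2 - 2 - 2 * z ^ 2) ^ 2 = 0 := by linear_combination -e4 + 4 * h0
      have := pow_eq_zero_iff (two_ne_zero) |>.mp this
      linear_combination this
    have hz0 : z ≠ 0 := by rintro rfl; norm_num at h0
    have key : ∃ q, σ q = q ∧ q ^ 2 = -2 := by
      have : (z ^ 2 + z + 1) * (z ^ 2 - z + 1) = 0 := by linear_combination h0
      rcases mul_eq_zero.mp this with h' | h'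
      · refine ⟨A / z ^ 2, by simp [map_ofNat, fA, fz], ?_⟩
        rw [div_pow, hA]; field_simp
        linear_combination (2 * z ^ 2 - 2 * z + 1) * h'
      · refine ⟨B / z ^ 2, by simp [map_ofNat, fB, fz], ?_⟩
        rw [div_pow, hB]; field_simp
        linear_combination (2 * z ^ 2 + 2 * z + 1) * h'
    obtain ⟨q, fq, hq⟩ := key
    have hn : ¬ SqQ (-3) 0 1 := by intro hh; have := hh.norm; norm_num at this
    rcases h.two (-3) 0 1 (-2) 0 (1 + 2 * z ^ 2) y1 q (by simp [map_ofNat, fz]) fy1 fq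
      (by push_cast; linear_combination 4 * h0) (by push_cast; linear_combination e1 + hms)
      (by push_cast; linear_combination hq) (by norm_num) hn with hh | hh
    · rcases hh.rat with hh | hh <;> norm_num at hh
    · have := hh.norm; norm_num at this

/-- Killing the remaining halves, given a further square. -/
theorem half_kill (h : Deg8 σ) (m ρ η : L) (fm : σ m = m) (fρ : σ ρ = ρ) (fη : σ η = η)
    (hρ : ρ ^ 2 = m ^ 2 - 4) (hη : η ^ 2 = (m - 1) * (m + 2) ∨ η ^ 2 = m * (m - 1))
    (hl : (m ^ 2 - 4) ^ 2 = 12 ∨ m ^ 2 = 2) : False := by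
  rcases hl with hl | hl
  · obtain ⟨w, hw⟩ : ∃ w, w = (m ^ 2 - 4) / 2 := ⟨_, rfl⟩
    have fw : σ w = w := by rw [hw]; simp [map_ofNat, fm]
    have hw3 : w ^ 2 = 3 := by rw [hw]; linear_combination hl / 4
    have hm2 : m ^ 2 = 4 + 2 * w := by rw [hw]; ring
    have hn : ¬ SqQ 3 0 2 := by intro hh; have := hh.norm; norm_num at this
    have hm : (m - (1 + w)) * (m + (1 + w)) = 0 := by linear_combination hm2 - hw3
    have c1 : w ^ 2 = ((3 : ℚ) : L) := by push_cast; exact hw3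
    have c2 : ρ ^ 2 = ((0 : ℚ) : L) + ((2 : ℚ) : L) * w := by
      push_cast; linear_combination hρ + hm2
    rcases mul_eq_zero.mp hm with hm | hm <;> rcases hη with hη | hη
    · exact h.contra 3 0 2 3 3 w ρ η fw fρ fη c1 c2
        (by push_cast; linear_combination hη + hm + hm2) (by norm_num) hn (by norm_num)
        (by norm_num)
    · exact h.contra 3 0 2 3 1 w ρ η fw fρ fη c1 c2
        (by push_cast; linear_combination hη - hm + hm2) (by norm_num) hn (by norm_num)
        (by norm_num)
    · exact h.contra 3 0 2 1 1 w ρ η fw fρ fη c1 c2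
        (by push_cast; linear_combination hη + hm + hm2) (by norm_num) hn (by norm_num)
        (by norm_num)
    · exact h.contra 3 0 2 5 3 w ρ η fw fρ fη c1 c2
        (by push_cast; linear_combination hη - hm + hm2) (by norm_num) hn (by norm_num)
        (by norm_num)
  · have hn : ¬ SqQ 2 (-2) 0 := by intro hh; rcases hh.rat with hh | hh <;> norm_num at hh
    have c1 : m ^ 2 = ((2 : ℚ) : L) := by push_cast; exact hl
    have c2 : ρ ^ 2 = ((-2 : ℚ) : L) + ((0 : ℚ) : L) * m := by
      push_cast; linear_combination hρ + hl
    rcases hη with hη | hη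
    · exact h.contra 2 (-2) 0 0 1 m ρ η fm fρ fη c1 c2
        (by push_cast; linear_combination hη + hl) (by norm_num) hn (by norm_num) (by norm_num)
    · exact h.contra 2 (-2) 0 2 (-1) m ρ η fm fρ fη c1 c2
        (by push_cast; linear_combination hη + hl) (by norm_num) hn (by norm_num) (by norm_num)

/-- Doubled point on the `D_AB` curve. -/
theorem dbl_AB (x Y : L) (hx : x ≠ 0) (hY : Y ^ 2 = x ^ 4 + x ^ 2 + 1) (hY0 : Y ≠ 0) :
    (((1 + x ^ 2) * Y - x * (1 - x ^ 2)) / (2 * x * Y)) ^ 2 =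
      ((1 - x ^ 4) / (2 * x * Y)) ^ 2 - (1 - x ^ 4) / (2 * x * Y) + 1 ∧
    (((1 + x ^ 2) * Y + x * (1 - x ^ 2)) / (2 * x * Y)) ^ 2 =
      ((1 - x ^ 4) / (2 * x * Y)) ^ 2 + (1 - x ^ 4) / (2 * x * Y) + 1 := by
  constructor
  · field_simp
    linear_combination (1 - x ^ 2) ^ 2 * hY
  · field_simp
    linear_combination (1 - x ^ 2) ^ 2 * hY
end

/-- The list for `D_AB`. -/
theorem list_AB (K : Type*) [Field K] [NumberField K] (h8 : ¬ 8 ∣ Module.finrank ℚ K)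
    (hfin : {p : K × K | p.2 ^ 2 = p.1 ^ 3 + p.1 ^ 2 + p.1}.Finite) (x A B : K)
    (hA : A ^ 2 = x ^ 2 - x + 1) (hB : B ^ 2 = x ^ 2 + x + 1) :
    x = 0 ∨ x ^ 2 = 1 ∨ x ^ 2 = -1 ∨ x ^ 4 + x ^ 2 + 1 = 0 := by
  by_contra hcon
  have hD := Deg8.ofCond h8
  let S : Set (K × K) := {p | ∃ x A B : K, A ^ 2 = x ^ 2 - x + 1 ∧ B ^ 2 = x ^ 2 + x + 1 ∧
    p = (x ^ 2, x * (A * B)) ∧ ¬ (x = 0 ∨ x ^ 2 = 1 ∨ x ^ 2 = -1 ∨ x ^ 4 + x ^ 2 + 1 = 0)}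
  have hcur : ∀ p ∈ S, p.2 ^ 2 = p.1 ^ 3 + p.1 ^ 2 + p.1 := by
    rintro _ ⟨x, A, B, hA, hB, rfl, h⟩
    simp only
    linear_combination x ^ 2 * B ^ 2 * hA + x ^ 2 * (x ^ 2 - x + 1) * hB
  have hnz : ∀ x A B : K, A ^ 2 = x ^ 2 - x + 1 → B ^ 2 = x ^ 2 + x + 1 →
      ¬ (x = 0 ∨ x ^ 2 = 1 ∨ x ^ 2 = -1 ∨ x ^ 4 + x ^ 2 + 1 = 0) → x ≠ 0 ∧ A * B ≠ 0 := by
    intro x A B hA hB h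
    refine ⟨fun h0 => h (Or.inl h0), fun h0 => h (Or.inr (Or.inr (Or.inr ?_)))⟩
    have : (A * B) ^ 2 = x ^ 4 + x ^ 2 + 1 := by
      linear_combination B ^ 2 * hA + (x ^ 2 - x + 1) * hB
    rw [← this, h0]; ring
  refine no_orbit K h8 1 (Or.inl rfl) S (hfin.subset hcur) ⟨_, x, A, B, hA, hB, rfl, hcon⟩ ?_ ?_ ?_
  · intro p hp; rw [hcur p hp]; ring
  · rintro _ ⟨x, A, B, hA, hB, rfl, h⟩
    exact mul_ne_zero (hnz x A B hA hB h).1 (hnz x A B hA hB h).2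
  · rintro _ ⟨x, A, B, hA, hB, rfl, h⟩
    obtain ⟨hx, hAB⟩ := hnz x A B hA hB h
    have hY : (A * B) ^ 2 = x ^ 4 + x ^ 2 + 1 := by
      linear_combination B ^ 2 * hA + (x ^ 2 - x + 1) * hB
    obtain ⟨hA', hB'⟩ := dbl_AB x (A * B) hx hY hAB
    have hz : 2 * x * (A * B) * ((1 - x ^ 4) / (2 * x * (A * B))) = 1 - x ^ 4 := mul_div_cancel₀ _ (mul_ne_zero (mul_ne_zero two_ne_zero hx) hAB)
    refine ⟨_, ⟨_, _, _, hA', hB', rfl, ?_⟩, ?_⟩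
    · intro hl
      have hc := half_core hD x (A * B) _ _ _ rfl rfl rfl rfl rfl hx hY hz hA' hB' hl
      have hk : ((x + x⁻¹) ^ 2 - 4) ^ 2 = 12 ∨ (x + x⁻¹) ^ 2 = 2 := by tauto
      refine half_kill hD (x + x⁻¹) (x - x⁻¹) (A * (x + 1) / x) rfl rfl rfl ?_ (Or.inl ?_) hk
      · field_simp; ring
      · rw [div_pow, mul_pow, hA]; field_simp; ring
    · simp only
      have hA0 : A ≠ 0 := left_ne_zero_of_mul hAB
      have hB0 : B ≠ 0 := right_ne_zero_of_mul hAB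
      field_simp
      ring


theorem split_four (x y a b : ℤ) (hx : 2 ∣ x) (hxy : IsCoprime x y) (hab : IsCoprime a b)
    (hx0 : x ≠ 0) (h : x * y = 2 * a * b) :
    ∃ k l m n : ℤ, x = 2 * k * m ∧ y = l * n ∧ a = l * m ∧ b = k * n ∧ IsCoprime k l ∧
      IsCoprime m n := by
  obtain ⟨x1, rfl⟩ := hx
  have hx1 : x1 ≠ 0 := by rintro rfl; simp at hx0
  have hg : (Int.gcd x1 a : ℤ) ≠ 0 := by
    intro h0
    have := Int.gcd_eq_zero_iff.mp (by exact_mod_cast h0)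
    exact hx1 this.1
  obtain ⟨k, hk⟩ := Int.gcd_dvd_left x1 a
  obtain ⟨l, hl⟩ := Int.gcd_dvd_right x1 a
  have hkl : IsCoprime k l := by
    have h1 := Int.gcd_eq_gcd_ab x1 a
    refine ⟨Int.gcdA x1 a, Int.gcdB x1 a, ?_⟩
    generalize Int.gcdA x1 a = u at *
    generalize Int.gcdB x1 a = v at *
    generalize (Int.gcd x1 a : ℤ) = g at *
    apply mul_left_cancel₀ hg
    rw [hk, hl] at h1
    linear_combination -h1
  generalize (Int.gcd x1 a : ℤ) = m at *
  subst hk hl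
  have h2 : k * y = l * b := by
    have : (2 * m) * (k * y) = (2 * m) * (l * b) := by linear_combination h
    exact mul_left_cancel₀ (by simpa using hg) this
  obtain ⟨n, rfl⟩ : k ∣ b := hkl.dvd_of_dvd_mul_left ⟨y, h2.symm⟩
  have hk0 : k ≠ 0 := by rintro rfl; simp at hx1
  have hy : y = l * n := by
    apply mul_left_cancel₀ hk0; linear_combination h2
  refine ⟨k, l, m, n, by ring, hy, by ring, rfl, hkl, ?_⟩
  exact (IsCoprime.of_mul_left_left hab).of_mul_right_right

theorem ratio_lemma (k l P Q : ℤ) (hkl : IsCoprime k l) (hk : k ≠ 0)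
    (h : k ^ 2 * P = l ^ 2 * Q) : ∃ g, P = l ^ 2 * g ∧ Q = k ^ 2 * g := by
  obtain ⟨g, rfl⟩ : k ^ 2 ∣ Q := (hkl.pow (m := 2) (n := 2)).dvd_of_dvd_mul_left ⟨P, h.symm⟩
  refine ⟨g, ?_, rfl⟩
  apply mul_left_cancel₀ (pow_ne_zero 2 hk); linear_combination h

theorem dvd_three (g m n : ℤ) (hmn : IsCoprime m n) (h1 : g ∣ 3 * m ^ 2) (h2 : g ∣ 3 * n ^ 2) :
    g = 1 ∨ g = -1 ∨ g = 3 ∨ g = -3 := by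
  obtain ⟨u, v, huv⟩ := hmn.pow (m := 2) (n := 2)
  have : g ∣ 3 := by
    have h3 : (3 : ℤ) = u * (3 * m ^ 2) + v * (3 * n ^ 2) := by linear_combination -3 * huv
    rw [h3]
    exact dvd_add (h1.mul_left _) (h2.mul_left _)
  have h4 : g.natAbs ∣ 3 := by simpa using Int.natAbs_dvd_natAbs.mpr this
  rcases (Nat.dvd_prime Nat.prime_three).mp h4 with h | h <;> omega

theorem pyth (x y z : ℤ) (h : x ^ 2 + y ^ 2 = z ^ 2) (hc : IsCoprime x y) (hx : x % 2 = 1)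
    (hz : z ≠ 0) : ∃ m n : ℤ, x = m ^ 2 - n ^ 2 ∧ y = 2 * m * n ∧ z ^ 2 = (m ^ 2 + n ^ 2) ^ 2 ∧
      IsCoprime m n ∧ (m % 2 = 0 ∧ n % 2 = 1 ∨ m % 2 = 1 ∧ n % 2 = 0) := by
  have hp : PythagoreanTriple x y |z| := by
    unfold PythagoreanTriple
    have : |z| * |z| = z ^ 2 := by rw [abs_mul_abs_self]; ring
    rw [this, ← h]; ring
  obtain ⟨m, n, h1, h2, h3, h4, h5, -⟩ :=
    hp.coprime_classification' (Int.isCoprime_iff_gcd_eq_one.mp hc) hx (abs_pos.mpr hz)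
  exact ⟨m, n, h1, h2, by rw [← h3, sq_abs], Int.isCoprime_iff_gcd_eq_one.mpr h4, h5⟩

theorem sq_mod4 (l : ℤ) (h : l % 2 = 1) : ∃ j, l ^ 2 = 4 * j + 1 := by
  obtain ⟨i, rfl⟩ : ∃ i, l = 2 * i + 1 := ⟨l / 2, by omega⟩
  exact ⟨i ^ 2 + i, by ring⟩

theorem odd_mul {l n : ℤ} (h : (l * n) % 2 = 1) : l % 2 = 1 ∧ n % 2 = 1 := by
  rw [← Int.odd_iff] at h
  have := Int.odd_mul.mp h
  exact ⟨Int.odd_iff.mp this.1, Int.odd_iff.mp this.2⟩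

theorem small_abs (k m l n : ℤ) (hk : k ≠ 0) (hm : m ≠ 0) (hl : l ≠ 0) (hn : n ≠ 0) :
    m.natAbs < (2 * k * m * (l * n)).natAbs ∧ k.natAbs < (2 * k * m * (l * n)).natAbs := by
  have h1 : 1 ≤ k.natAbs := by omega
  have h2 : 1 ≤ m.natAbs := by omega
  have h3 : 1 ≤ l.natAbs := by omega
  have h4 : 1 ≤ n.natAbs := by omega
  simp only [Int.natAbs_mul]
  have h5 : 1 ≤ l.natAbs * n.natAbs := Nat.mul_pos h3 h4
  have h6 : m.natAbs ≤ k.natAbs * m.natAbs := Nat.le_mul_of_pos_left _ h1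
  have h7 : k.natAbs ≤ k.natAbs * m.natAbs := Nat.le_mul_of_pos_right _ h2
  have h8 : 2 * (k.natAbs * m.natAbs) ≤ 2 * (k.natAbs * m.natAbs) * (l.natAbs * n.natAbs) :=
    Nat.le_mul_of_pos_right _ h5
  have h9 : Int.natAbs 2 * k.natAbs * m.natAbs * (l.natAbs * n.natAbs) =
    2 * (k.natAbs * m.natAbs) * (l.natAbs * n.natAbs) := by
      have : Int.natAbs 2 = 2 := rfl
      rw [this]; ring
  omega

theorem descent1 : ∀ (N : ℕ) (x y z : ℤ), (x * y).natAbs < N → x * y ≠ 0 → IsCoprime x y →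
    x % 2 = 0 → y % 2 = 1 → x ^ 4 - x ^ 2 * y ^ 2 + y ^ 4 = z ^ 2 → False := by
  intro N
  induction N with
  | zero => intro x y z h; omega
  | succ N ih =>
    intro x y z hN hxy0 hco hx hy h
    have hx0 : x ≠ 0 := left_ne_zero_of_mul hxy0
    have hy0 : y ≠ 0 := right_ne_zero_of_mul hxy0
    have hc2 : IsCoprime (x ^ 2 - y ^ 2) (x * y) := by
      apply IsCoprime.mul_right
      · have h2 : IsCoprime (-(y ^ 2) + x * x) x :=
          IsCoprime.add_mul_left_left ((hco.symm.pow_left).neg_left) x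
        have e : x ^ 2 - y ^ 2 = -(y ^ 2) + x * x := by ring
        rw [e]; exact h2
      · have h2 : IsCoprime (x ^ 2 + y * (-y)) y :=
          IsCoprime.add_mul_left_left (hco.pow_left) (-y)
        have e : x ^ 2 - y ^ 2 = x ^ 2 + y * (-y) := by ring
        rw [e]; exact h2
    have hodd : (x ^ 2 - y ^ 2) % 2 = 1 := by
      obtain ⟨i, rfl⟩ : ∃ i, x = 2 * i := ⟨x / 2, by omega⟩
      obtain ⟨j, hj⟩ := sq_mod4 y hy
      rw [hj, show (2 * i) ^ 2 = 4 * i ^ 2 by ring]; omega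
    have hz0 : z ≠ 0 := by
      rintro rfl
      nlinarith [sq_nonneg (x ^ 2 - y ^ 2), mul_self_pos.mpr hxy0]
    obtain ⟨a, b, h1, h2, h3, h4, -⟩ := pyth _ _ z (by linear_combination h) hc2 hodd hz0
    obtain ⟨k, l, m, n, rfl, rfl, rfl, rfl, hkl, hmn⟩ :=
      split_four x y a b (by omega) hco h4 hx0 h2
    have hk0 : k ≠ 0 := by rintro rfl; simp at hx0
    have hm0 : m ≠ 0 := by rintro rfl; simp at hx0
    have hl0 : l ≠ 0 := by rintro rfl; simp at hy0
    have hn0 : n ≠ 0 := by rintro rfl; simp at hy0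
    obtain ⟨ho1, ho2⟩ := odd_mul hy
    obtain ⟨g, hg1, hg2⟩ := ratio_lemma k l (4 * m ^ 2 + n ^ 2) (m ^ 2 + n ^ 2) hkl hk0
      (by linear_combination h1)
    have hg : g = 1 := by
      have hgp : 0 < g := by
        have : 0 < k ^ 2 * g := by rw [← hg2]; positivity
        exact pos_of_mul_pos_right this (by positivity)
      rcases dvd_three g m n hmn ⟨l ^ 2 - k ^ 2, by linear_combination hg1 - hg2⟩
        ⟨4 * k ^ 2 - l ^ 2, by linear_combination 4 * hg2 - hg1⟩ with h | h | h | h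
      · exact h
      · omega
      · exfalso
        subst h
        have hm3 : m % 3 = 0 ∧ n % 3 = 0 := by
          have : (m ^ 2 + n ^ 2) % 3 = 0 := by rw [hg2]; omega
          have h1 : m % 3 = 0 ∨ m % 3 = 1 ∨ m % 3 = 2 := by omega
          have h2 : n % 3 = 0 ∨ n % 3 = 1 ∨ n % 3 = 2 := by omega
          rcases h1 with h1 | h1 | h1 <;> rcases h2 with h2 | h2 | h2 <;>
            simp [pow_two, Int.add_emod, Int.mul_emod, h1, h2] at this ⊢
        have h5 : IsUnit (3 : ℤ) := hmn.isUnit_of_dvd' (by omega) (by omega)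
        rw [Int.isUnit_iff] at h5
        omega
      · omega
    subst hg
    have hl2 : n ^ 2 + (2 * m) ^ 2 = l ^ 2 := by linear_combination hg1
    have hcn : IsCoprime n (2 * m) := by
      apply IsCoprime.mul_right _ hmn.symm
      exact ⟨1, -(n / 2), by omega⟩
    obtain ⟨c, d, k1, k2, k3, k4, k5⟩ := pyth n (2 * m) l hl2 hcn ho2 hl0
    have hmcd : m = c * d := by linarith
    have hq : c ^ 4 - c ^ 2 * d ^ 2 + d ^ 4 = k ^ 2 := by
      rw [hmcd, k1] at hg2; linear_combination hg2
    have hsm := (small_abs k m l n hk0 hm0 hl0 hn0).1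
    rcases k5 with ⟨p1, p2⟩ | ⟨p1, p2⟩
    · exact ih c d k (by rw [← hmcd]; omega) (by rw [← hmcd]; exact hm0) k4 p1 p2 hq
    · exact ih d c k (by rw [mul_comm, ← hmcd]; omega) (by rw [mul_comm, ← hmcd]; exact hm0)
        k4.symm p2 p1 (by linear_combination hq)

theorem descent2 : ∀ (N : ℕ) (x y z : ℤ), (x * y).natAbs < N → x * y ≠ 0 → IsCoprime x y →
    x % 2 = 0 → y % 2 = 1 → x ^ 4 + x ^ 2 * y ^ 2 + y ^ 4 = z ^ 2 → False := by
  intro N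
  induction N with
  | zero => intro x y z h; omega
  | succ N ih =>
    intro x y z hN hxy0 hco hx hy h
    have hx0 : x ≠ 0 := left_ne_zero_of_mul hxy0
    have hy0 : y ≠ 0 := right_ne_zero_of_mul hxy0
    have hc2 : IsCoprime z (x * y) := by
      have h1 : IsCoprime (z ^ 2) (x * y) := by
        apply IsCoprime.mul_right
        · have h2 : IsCoprime (y ^ 4 + x * (x ^ 3 + x * y ^ 2)) x :=
            IsCoprime.add_mul_left_left (hco.symm.pow_left) _
          have e : z ^ 2 = y ^ 4 + x * (x ^ 3 + x * y ^ 2) := by rw [← h]; ring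
          rw [e]; exact h2
        · have h2 : IsCoprime (x ^ 4 + y * (x ^ 2 * y + y ^ 3)) y :=
            IsCoprime.add_mul_left_left (hco.pow_left) _
          have e : z ^ 2 = x ^ 4 + y * (x ^ 2 * y + y ^ 3) := by rw [← h]; ring
          rw [e]; exact h2
      exact (IsCoprime.pow_left_iff (by norm_num)).mp h1
    have hodd : z % 2 = 1 := by
      have : (z * z) % 2 = 1 := by
        obtain ⟨i, rfl⟩ : ∃ i, x = 2 * i := ⟨x / 2, by omega⟩
        obtain ⟨j, hj⟩ := sq_mod4 y hy
        have : z * z = 2 * (8 * i ^ 4 + 2 * i ^ 2 * y ^ 2 + 8 * j ^ 2 + 4 * j) + 1 := by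
          linear_combination -h + (y ^ 2 + 4 * j + 1) * hj
        omega
      exact (odd_mul this).1
    have hs0 : x ^ 2 + y ^ 2 ≠ 0 := by positivity
    obtain ⟨a, b, h1, h2, h3, h4, -⟩ := pyth z (x * y) (x ^ 2 + y ^ 2)
      (by linear_combination -h) hc2 hodd hs0
    have h3' : x ^ 2 + y ^ 2 = a ^ 2 + b ^ 2 := by
      have := sq_eq_sq₀ (a := x ^ 2 + y ^ 2) (b := a ^ 2 + b ^ 2) (by positivity) (by positivity)
      exact this.mp h3
    obtain ⟨k, l, m, n, rfl, rfl, rfl, rfl, hkl, hmn⟩ :=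
      split_four x y a b (by omega) hco h4 hx0 h2
    have hk0 : k ≠ 0 := by rintro rfl; simp at hx0
    have hm0 : m ≠ 0 := by rintro rfl; simp at hx0
    have hl0 : l ≠ 0 := by rintro rfl; simp at hy0
    have hn0 : n ≠ 0 := by rintro rfl; simp at hy0
    obtain ⟨ho1, ho2⟩ := odd_mul hy
    obtain ⟨g, hg1, hg2⟩ := ratio_lemma k l (4 * m ^ 2 - n ^ 2) (m ^ 2 - n ^ 2) hkl hk0
      (by linear_combination h3')
    obtain ⟨jl, hjl⟩ := sq_mod4 l ho1
    obtain ⟨jn, hjn⟩ := sq_mod4 n ho2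
    have hsm := small_abs k m l n hk0 hm0 hl0 hn0
    have fin : ∀ c d e : ℤ, (c * d).natAbs < (2 * k * m * (l * n)).natAbs → c * d ≠ 0 →
        IsCoprime c d → (c % 2 = 0 ∧ d % 2 = 1 ∨ c % 2 = 1 ∧ d % 2 = 0) →
        c ^ 4 + c ^ 2 * d ^ 2 + d ^ 4 = e ^ 2 → False := by
      intro c d e q1 q2 q3 q4 q5
      rcases q4 with ⟨p1, p2⟩ | ⟨p1, p2⟩
      · exact ih c d e (by omega) q2 q3 p1 p2 q5
      · exact ih d c e (by rw [mul_comm]; omega) (by rw [mul_comm]; exact q2)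
          q3.symm p2 p1 (by linear_combination q5)
    have h2odd : ∀ t : ℤ, t % 2 = 1 → IsCoprime t 2 := by
      intro t ht
      exact ⟨1, -(t / 2), by omega⟩
    rcases dvd_three g m n hmn ⟨l ^ 2 - k ^ 2, by linear_combination hg1 - hg2⟩
        ⟨l ^ 2 - 4 * k ^ 2, by linear_combination hg1 - 4 * hg2⟩ with h | h | h | h
    · subst h; omega
    · subst h
      have hcl : IsCoprime l (2 * m) := by
        apply IsCoprime.mul_right (h2odd l ho1)
        have h1 : IsCoprime (l ^ 2) m := by
          have e : l ^ 2 = n ^ 2 + m * (-4 * m) := by linarith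
          rw [e]; exact IsCoprime.add_mul_left_left hmn.symm.pow_left _
        exact (IsCoprime.pow_left_iff (by norm_num)).mp h1
      obtain ⟨c, d, k1, k2, k3, k4, k5⟩ := pyth l (2 * m) n (by linarith) hcl ho1 hn0
      have hmcd : m = c * d := by linarith
      exact fin c d k (by rw [← hmcd]; exact hsm.1) (by rw [← hmcd]; exact hm0) k4 k5
        (by rw [hmcd, k3] at hg2; linear_combination -hg2)
    · subst h
      have hl2 : l ^ 2 = m ^ 2 + k ^ 2 := by linarith
      have hn2 : n ^ 2 + (2 * k) ^ 2 = l ^ 2 := by linarith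
      have hcl : IsCoprime n (2 * k) := by
        apply IsCoprime.mul_right (h2odd n ho2)
        have h1 : IsCoprime (n ^ 2) k := by
          have e : n ^ 2 = l ^ 2 + k * (-4 * k) := by linear_combination hn2
          rw [e]; exact IsCoprime.add_mul_left_left hkl.symm.pow_left _
        exact (IsCoprime.pow_left_iff (by norm_num)).mp h1
      obtain ⟨c, d, k1, k2, k3, k4, k5⟩ := pyth n (2 * k) l hn2 hcl ho2 hl0
      have hmcd : k = c * d := by linarith
      exact fin c d m (by rw [← hmcd]; exact hsm.2) (by rw [← hmcd]; exact hk0) k4 k5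
        (by rw [hmcd, k3] at hl2; linear_combination hl2)
    · subst h; omega

theorem quartic1 (x y z : ℤ) (h0 : x * y ≠ 0) (hc : IsCoprime x y)
    (h : x ^ 4 - x ^ 2 * y ^ 2 + y ^ 4 = z ^ 2) : x ^ 2 = y ^ 2 := by
  by_contra hne
  rcases Int.emod_two_eq_zero_or_one x with hx | hx <;>
    rcases Int.emod_two_eq_zero_or_one y with hy | hy
  · have := hc.isUnit_of_dvd' (x := (2 : ℤ)) (by omega) (by omega)
    rw [Int.isUnit_iff] at this; omega
  · exact descent1 _ x y z (Nat.lt_succ_self _) h0 hc hx hy h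
  · exact descent1 _ y x z (Nat.lt_succ_self _) (by rwa [mul_comm]) hc.symm hy hx
      (by linear_combination h)
  · have hc2 : IsCoprime (x * y) (x ^ 2 - y ^ 2) := by
      apply IsCoprime.symm
      apply IsCoprime.mul_right
      · have h2 : IsCoprime (-(y ^ 2) + x * x) x :=
          IsCoprime.add_mul_left_left ((hc.symm.pow_left).neg_left) x
        have e : x ^ 2 - y ^ 2 = -(y ^ 2) + x * x := by ring
        rw [e]; exact h2
      · have h2 : IsCoprime (x ^ 2 + y * (-y)) y :=
          IsCoprime.add_mul_left_left (hc.pow_left) (-y)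
        have e : x ^ 2 - y ^ 2 = x ^ 2 + y * (-y) := by ring
        rw [e]; exact h2
    have hodd : (x * y) % 2 = 1 := by simp [Int.mul_emod, hx, hy]
    have hz0 : z ≠ 0 := by
      rintro rfl
      nlinarith [sq_nonneg (x ^ 2 - y ^ 2), mul_self_pos.mpr h0]
    obtain ⟨a, b, h1, h2, -, h4, h5⟩ := pyth _ _ z (by linear_combination h) hc2 hodd hz0
    have hab : a * b ≠ 0 := by
      intro h; apply hne; linear_combination h2 + 2 * h
    obtain ⟨j, hj⟩ := sq_mod4 x hx
    obtain ⟨i, hi⟩ := sq_mod4 y hy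
    have hq : a ^ 4 - a ^ 2 * b ^ 2 + b ^ 4 = (2 * i + 2 * j + 1) ^ 2 := by
      have e1 : 2 * i + 2 * j + 1 = x ^ 2 - a * b := by linarith
      have e2 : y ^ 2 = x ^ 2 - 2 * a * b := by linarith
      have e3 : (x * y) ^ 2 = (a ^ 2 - b ^ 2) ^ 2 := by rw [h1]
      rw [e1]
      linear_combination -e3 + x ^ 2 * e2
    rcases h5 with ⟨p, q⟩ | ⟨p, q⟩
    · exact descent1 _ a b _ (Nat.lt_succ_self _) hab h4 p q hq
    · exact descent1 _ b a (2 * i + 2 * j + 1) (Nat.lt_succ_self _) (by rwa [mul_comm]) h4.symm q p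
        (by linear_combination hq)

theorem quartic2 (x y z : ℤ) (h0 : x * y ≠ 0) (hc : IsCoprime x y)
    (h : x ^ 4 + x ^ 2 * y ^ 2 + y ^ 4 = z ^ 2) : False := by
  rcases Int.emod_two_eq_zero_or_one x with hx | hx <;>
    rcases Int.emod_two_eq_zero_or_one y with hy | hy
  · have := hc.isUnit_of_dvd' (x := (2 : ℤ)) (by omega) (by omega)
    rw [Int.isUnit_iff] at this; omega
  · exact descent2 _ x y z (Nat.lt_succ_self _) h0 hc hx hy h
  · exact descent2 _ y x z (Nat.lt_succ_self _) (by rwa [mul_comm]) hc.symm hy hx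
      (by linear_combination h)
  · obtain ⟨j, hj⟩ := sq_mod4 x hx
    obtain ⟨i, hi⟩ := sq_mod4 y hy
    have e : z * z = 4 * (4 * j ^ 2 + 4 * i ^ 2 + 4 * i * j + 3 * i + 3 * j) + 3 := by
      linear_combination -h + (x ^ 2 + 4 * j + 1) * hj + (y ^ 2 + 4 * i + 1) * hi + y ^ 2 * hj +
        (4 * j + 1) * hi
    have h3 := Int.emod_two_eq_zero_or_one z
    rcases h3 with h3 | h3
    · obtain ⟨w, rfl⟩ : ∃ w, z = 2 * w := ⟨z / 2, by omega⟩
      have : 2 * w * (2 * w) = 4 * (w * w) := by ring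
      omega
    · obtain ⟨w, hw⟩ := sq_mod4 z h3
      have : z * z = 4 * w + 1 := by rw [← hw]; ring
      omega

/-- common reduction: rational points of `y² = x(x² + εx + 1)` come from quartics -/
theorem to_quartic (ε : ℤ) (hε : ε = 1 ∨ ε = -1) (x y : ℚ)
    (h : y ^ 2 = x ^ 3 + ε * x ^ 2 + x) (hx : x ≠ 0) :
    ∃ u v w : ℤ, u * v ≠ 0 ∧ IsCoprime u v ∧ u ^ 4 + ε * u ^ 2 * v ^ 2 + v ^ 4 = w ^ 2 ∧
      x * v ^ 2 = u ^ 2 := by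
  set p := x.num
  set q : ℤ := (x.den : ℤ)
  have hq : 0 < q := Int.natCast_pos.mpr x.den_pos
  have hqQ : (q : ℚ) ≠ 0 := by exact_mod_cast hq.ne'
  have hxe : x = p / q := (Rat.num_div_den x).symm
  have hpq : IsCoprime p q := by
    rw [Int.isCoprime_iff_gcd_eq_one]
    exact x.reduced
  have hxp : 0 < x := by
    have h1 : 0 ≤ x * (x ^ 2 + ε * x + 1) := by
      have : x * (x ^ 2 + ε * x + 1) = y ^ 2 := by rw [h]; ring
      rw [this]; positivity
    have h2 : 0 < x ^ 2 + ε * x + 1 := by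
      rcases hε with rfl | rfl <;> push_cast <;> nlinarith [sq_nonneg (x + 1), sq_nonneg (x - 1)]
    have h3 : 0 ≤ x := by
      by_contra hneg
      push Not at hneg
      nlinarith
    exact lt_of_le_of_ne h3 (Ne.symm hx)
  have hp : 0 < p := Rat.num_pos.mpr hxp
  have hc1 : IsCoprime (p ^ 2 + ε * p * q + q ^ 2) (p * q) := by
    apply IsCoprime.mul_right
    · have h2 : IsCoprime (q ^ 2 + p * (p + ε * q)) p :=
        IsCoprime.add_mul_left_left (hpq.symm.pow_left) _
      have e : p ^ 2 + ε * p * q + q ^ 2 = q ^ 2 + p * (p + ε * q) := by ring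
      rw [e]; exact h2
    · have h2 : IsCoprime (p ^ 2 + q * (q + ε * p)) q :=
        IsCoprime.add_mul_left_left (hpq.pow_left) _
      have e : p ^ 2 + ε * p * q + q ^ 2 = p ^ 2 + q * (q + ε * p) := by ring
      rw [e]; exact h2
  have hsqQ : ((p * q * (p ^ 2 + ε * p * q + q ^ 2) : ℤ) : ℚ) = (y * q ^ 2) ^ 2 := by
    have : (y * q ^ 2) ^ 2 = y ^ 2 * q ^ 4 := by ring
    rw [this, h, hxe]; push_cast; field_simp
  have hsq : IsSquare (p * q * (p ^ 2 + ε * p * q + q ^ 2)) := by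
    rw [← Rat.isSquare_intCast_iff, hsqQ]
    exact ⟨_, pow_two _⟩
  obtain ⟨s, hs⟩ := hsq
  have h1 : p * q * (p ^ 2 + ε * p * q + q ^ 2) = s ^ 2 := by rw [hs, pow_two]
  have hpos : 0 < p ^ 2 + ε * p * q + q ^ 2 := by
    rcases hε with rfl | rfl <;> nlinarith [sq_nonneg (p - q), mul_pos hp hq]
  obtain ⟨m, hm⟩ := Int.sq_of_isCoprime hc1.symm h1
  obtain ⟨n, hn⟩ := Int.sq_of_isCoprime hc1 (by rw [mul_comm]; exact h1)
  have hm' : p * q = m ^ 2 := by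
    rcases hm with h | h
    · exact h
    · nlinarith [mul_pos hp hq, sq_nonneg m]
  have hn' : p ^ 2 + ε * p * q + q ^ 2 = n ^ 2 := by
    rcases hn with h | h
    · exact h
    · nlinarith [sq_nonneg n]
  obtain ⟨u, hu⟩ := Int.sq_of_isCoprime hpq hm'
  obtain ⟨v, hv⟩ := Int.sq_of_isCoprime hpq.symm (by rw [mul_comm]; exact hm')
  have hu' : p = u ^ 2 := by
    rcases hu with h | h
    · exact h
    · nlinarith [sq_nonneg u]
  have hv' : q = v ^ 2 := by
    rcases hv with h | h
    · exact h
    · nlinarith [sq_nonneg v]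
  refine ⟨u, v, n, ?_, ?_, ?_, ?_⟩
  · rintro h0
    rcases mul_eq_zero.mp h0 with rfl | rfl
    · simp at hu'; omega
    · simp at hv'; omega
  · rw [hu', hv'] at hpq
    exact (IsCoprime.pow_iff (by norm_num) (by norm_num)).mp hpq
  · rw [hu', hv'] at hn'; linear_combination hn'
  · have : (x * q : ℚ) = p := by rw [hxe]; field_simp
    rw [hu', hv'] at this
    exact_mod_cast this

theorem rat_E1 (x y : ℚ) (h : y ^ 2 = x ^ 3 - x ^ 2 + x) : x = 0 ∨ x = 1 := by
  by_cases hx : x = 0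
  · exact Or.inl hx
  right
  obtain ⟨u, v, w, h0, hc, h1, h2⟩ := to_quartic (-1) (Or.inr rfl) x y
    (by push_cast; linear_combination h) hx
  have h3 := quartic1 u v w h0 hc (by linear_combination h1)
  have hv : (v : ℚ) ^ 2 ≠ 0 := by
    have := right_ne_zero_of_mul h0
    positivity
  have h4 : (u : ℚ) ^ 2 = (v : ℚ) ^ 2 := by exact_mod_cast h3
  rw [h4] at h2
  exact mul_right_cancel₀ hv (by linear_combination h2)

theorem rat_E1m (x y : ℚ) (h : y ^ 2 = x ^ 3 + x ^ 2 + x) : x = 0 := by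
  by_contra hx
  obtain ⟨u, v, w, h0, hc, h1, h2⟩ := to_quartic 1 (Or.inl rfl) x y
    (by push_cast; linear_combination h) hx
  exact quartic2 u v w h0 hc (by linear_combination h1)


/-- The input from the arithmetic of the base field, expressed through the involution `σ`. -/
structure Ctx {L : Type*} [Field L] [CharZero L] (σ : L →+* L) : Prop where
  inv : ∀ x, σ (σ x) = x
  H1 : ∀ s τ, σ s = s → σ τ = τ → τ ^ 2 = s ^ 3 - s ^ 2 + s → s = 0 ∨ s = 1 ∨
    (Deg8 σ ∧ (s = -1 ∨ s ^ 2 - s + 1 = 0 ∨ s ^ 2 + 1 = 0 ∨ s ^ 2 - 4 * s + 1 = 0))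
  H0 : ∀ x A B, σ x = x → σ A = A → σ B = B → A ^ 2 = x ^ 2 - x + 1 → B ^ 2 = x ^ 2 + x + 1 →
    x = 0 ∨ (Deg8 σ ∧ (x ^ 2 = 1 ∨ x ^ 2 = -1 ∨ x ^ 4 + x ^ 2 + 1 = 0))
  H0' : ∀ x Y, σ x = x → σ Y = Y → Y ^ 2 = x ^ 4 + x ^ 2 + 1 → x = 0 ∨
    (Deg8 σ ∧ (x ^ 2 = 1 ∨ x ^ 2 = -1 ∨ x ^ 4 + x ^ 2 + 1 = 0 ∨
      ((x + x⁻¹) ^ 2 - 4) ^ 2 = 12 ∨ (x + x⁻¹) ^ 2 = 2))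

/-- Non-trivial points in the new coordinates. -/
structure Pt {L : Type*} [Field L] (x V A B : L) : Prop where
  hV : V ^ 2 = x ^ 2 + 1
  hA : A ^ 2 = x ^ 2 - x + 1
  hB : B ^ 2 = x ^ 2 + x + 1
  x0 : x ≠ 0
  V0 : V ≠ 0
  A0 : A ≠ 0
  B0 : B ≠ 0
  x1 : x ^ 2 ≠ 1
  t1 : 2 * x ^ 2 - x + 2 ≠ 0
  t2 : 2 * x ^ 2 + x + 2 ≠ 0

section
variable {L : Type*} [Field L] [CharZero L] {σ : L →+* L} {x V A B : L}

theorem Pt.neg (P : Pt x V A B) : Pt (-x) V B A :=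
  ⟨by rw [P.hV]; ring, by rw [P.hB]; ring, by rw [P.hA]; ring, neg_ne_zero.mpr P.x0, P.V0, P.B0,
    P.A0, by rw [neg_sq]; exact P.x1, fun h => P.t2 (by linear_combination h),
    fun h => P.t1 (by linear_combination h)⟩

theorem Pt.swap (P : Pt x V A B) : Pt x⁻¹ (V / x) (A / x) (B / x) := by
  have hx := P.x0
  refine ⟨?_, ?_, ?_, inv_ne_zero hx, div_ne_zero P.V0 hx, div_ne_zero P.A0 hx,
    div_ne_zero P.B0 hx, ?_, ?_, ?_⟩
  · rw [div_pow, P.hV]; field_simp; ring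
  · rw [div_pow, P.hA]; field_simp; ring
  · rw [div_pow, P.hB]; field_simp; ring
  · intro h; apply P.x1; field_simp at h; exact h.symm
  · intro h; apply P.t1; field_simp at h; linear_combination h
  · intro h; apply P.t2; field_simp at h; linear_combination h

theorem Pt.Y2 (P : Pt x V A B) : (A * B) ^ 2 = x ^ 4 + x ^ 2 + 1 := by
  linear_combination B ^ 2 * P.hA + (x ^ 2 - x + 1) * P.hB

theorem Pt.YV (P : Pt x V A B) : (A * B) ^ 2 = V ^ 4 - V ^ 2 + 1 := by
  linear_combination P.Y2 - (V ^ 2 + x ^ 2) * P.hV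

theorem Pt.Y0 (P : Pt x V A B) : A * B ≠ 0 := mul_ne_zero P.A0 P.B0

theorem sq_pm {a b : L} (h : a ^ 2 = b ^ 2) : a = b ∨ a = -b := sq_eq_sq_iff_eq_or_eq_neg.mp h

theorem nsqA : ¬ SqQ (-1) 0 1 := by
  intro h; rcases h.finer 1 (by norm_num) with h | h <;> norm_num at h
theorem nsqB : ¬ SqQ 3 2 1 := by
  intro h; rcases h.finer 1 (by norm_num) with h | h <;> norm_num at h
theorem nsqC : ¬ SqQ (-1) (-1) 1 := by intro h; have := h.norm; norm_num at this
theorem nsqD : ¬ SqQ 3 1 1 := by intro h; have := h.norm; norm_num at this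

/-- Case analysis on `V²`, once `V Y` is fixed. -/
theorem Ctx.V2 (c : Ctx σ) (P : Pt x V A B) (f : σ (V ^ 2) = V ^ 2)
    (fVY : σ (V * (A * B)) = V * (A * B)) : Deg8 σ ∧ (V ^ 2 = -1 ∨ V ^ 4 = -1 ∨
      (V ^ 2 - 2) ^ 2 = 3) := by
  rcases c.H1 (V ^ 2) (V * (A * B)) f fVY (by linear_combination V ^ 2 * P.YV) with h | h | ⟨d, h⟩
  · exact absurd h (pow_ne_zero 2 P.V0)
  · exfalso; apply pow_ne_zero 2 P.x0; linear_combination h - P.hV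
  · refine ⟨d, ?_⟩
    rcases h with h | h | h | h
    · exact Or.inl h
    · exfalso; apply pow_ne_zero 2 P.Y0; linear_combination h + P.YV
    · right; left; linear_combination h
    · right; right; linear_combination h

theorem caseI1 (c : Ctx σ) (P : Pt x V A B) (fx : σ x = x) (fV : σ V = V)
    (fY : σ (A * B) = A * B) : False := by
  obtain ⟨d, h | h | h⟩ := c.V2 P (by rw [map_pow, fV]) (by rw [map_mul, fV, fY])
  · refine d.three (-1) 3 (-2) V (A * B) x fV fY fx ?_ ?_ ?_ ?_ ?_ ?_ ?_ ?_ ?_ ?_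
    · push_cast; exact h
    · push_cast; linear_combination P.YV + (V ^ 2 - 2) * h
    · push_cast; linear_combination h - P.hV
    all_goals norm_num
  · refine d.contra (-1) 0 1 (-1) 1 (V ^ 2) V x (by rw [map_pow, fV]) fV fx ?_ ?_ ?_ ?_ nsqA ?_ ?_
    · push_cast; linear_combination h
    · push_cast; ring
    · push_cast; linear_combination -P.hV
    all_goals norm_num
  · refine d.contra 3 2 1 1 1 (V ^ 2 - 2) V x (by simp [map_ofNat, fV]) fV fx ?_ ?_ ?_ ?_ nsqB ?_ ?_
    · push_cast; linear_combination h
    · push_cast; ring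
    · push_cast; linear_combination -P.hV
    all_goals norm_num

theorem caseI2 (c : Ctx σ) (P : Pt x V A B) (fx : σ x = x) (fA : σ A = A)
    (fB : σ B = B) : False := by
  rcases c.H0 x A B fx fA fB P.hA P.hB with h | ⟨-, h | h | h⟩
  · exact P.x0 h
  · exact P.x1 h
  · apply pow_ne_zero 2 P.V0; linear_combination P.hV + h
  · apply pow_ne_zero 2 P.Y0; linear_combination P.Y2 + h

theorem caseI3 (c : Ctx σ) (P : Pt x V A B) (fx : σ x = x) (fY : σ (A * B) = A * B)
    (fVA : σ (V * A) = V * A) : False := by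
  have hx := P.x0
  rcases c.H0' x (A * B) fx fY P.Y2 with h | ⟨d, h | h | h | h⟩
  · exact P.x0 h
  · exact P.x1 h
  · apply pow_ne_zero 2 P.V0; linear_combination P.hV + h
  · apply pow_ne_zero 2 P.Y0; linear_combination P.Y2 + h
  · refine half_kill d (x + x⁻¹) (x - x⁻¹) (V * A / x) (by simp [fx]) (by simp [fx])
      (by rw [map_div₀, fVA, fx]) ?_ (Or.inr ?_) h
    · field_simp; ring
    · rw [div_pow, mul_pow, P.hV, P.hA]; field_simp; ring

theorem caseI4 (c : Ctx σ) (P : Pt x V A B) (fx : σ x = x) (fA : σ A = A)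
    (fVY : σ (V * (A * B)) = V * (A * B)) : False := by
  have fV : σ (V ^ 2) = V ^ 2 := by rw [P.hV]; simp [fx]
  obtain ⟨d, h | h | h⟩ := c.V2 P fV fVY
  · refine d.contra (-2) (-3) 0 (-1) (-1) x (V * (A * B)) A fx fVY fA ?_ ?_ ?_ ?_ ?_ ?_ ?_
    · push_cast; linear_combination h - P.hV
    · push_cast; linear_combination V ^ 2 * P.YV + (V ^ 4 - 2 * V ^ 2 + 3) * h
    · push_cast; linear_combination P.hA - P.hV + h
    · norm_num
    · intro h; rcases h.rat with h | h <;> norm_num at h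
    all_goals norm_num
  · have := d.normSq (-1) (-1) 1 0 1 (-1) 0 (V ^ 2) x A fV fx fA
      (by push_cast; linear_combination h) (by push_cast; linear_combination -P.hV)
      (by push_cast; linear_combination P.hA - P.hV) (by norm_num) nsqC
    rcases this.finer 1 (by norm_num) with h | h <;> norm_num at h
  · have := d.normSq 3 1 1 2 1 (-1) 0 (V ^ 2 - 2) x A (by rw [map_sub, fV, map_ofNat]) fx fA
      (by push_cast; linear_combination h) (by push_cast; linear_combination -P.hV)
      (by push_cast; linear_combination P.hA - P.hV) (by norm_num) nsqD
    rcases this.finer 3 (by norm_num) with h | h <;> norm_num at h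

theorem caseI5 (c : Ctx σ) (P : Pt x V A B) (fx : σ x = -x) (fV : σ V = V) : False := by
  have h1 : σ A ^ 2 = B ^ 2 := by rw [← map_pow, P.hA, P.hB]; simp [fx]
  have key : ∀ S Y : L, σ S = S → σ Y = Y → Y ^ 2 = (A * B) ^ 2 → S ^ 2 = 2 * V ^ 2 + 2 * Y →
      σ (V * (A * B)) = V * (A * B) → False := by
    intro S Y fS fY hY hS fVY
    rw [P.YV] at hY
    obtain ⟨d, h | h | h⟩ := c.V2 P (by rw [map_pow, fV]) fVY
    · refine d.contra 3 (-1) 0 (-2) 2 Y V S fY fV fS ?_ ?_ ?_ ?_ ?_ ?_ ?_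
      · push_cast; linear_combination hY + (V ^ 2 - 2) * h
      · push_cast; linear_combination h
      · push_cast; linear_combination hS + 2 * h
      · norm_num
      · intro h; rcases h.rat with h | h <;> norm_num at h
      all_goals norm_num
    · have : Y = V ^ 3 ∨ Y = -V ^ 3 :=
        sq_pm (by linear_combination hY + (1 - V ^ 2) * h)
      have key2 : ∀ e : ℚ, e ^ 2 = 1 → Y = e * V ^ 3 → False := by
        intro e he hYe
        have := d.normSq (-1) 0 1 0 2 0 (2 * e) (V ^ 2) V S (by rw [map_pow, fV]) fV fS
          (by push_cast; linear_combination h) (by push_cast; ring)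
          (by push_cast; rw [hS, hYe]; ring) (by norm_num) nsqA
        have h2 : (2 * e) ^ 2 = 4 := by linear_combination 4 * he
        rw [h2] at this
        have := this.norm; norm_num at this
      rcases this with h | h
      · exact key2 1 (by norm_num) (by rw [h]; push_cast; ring)
      · exact key2 (-1) (by norm_num) (by rw [h]; push_cast; ring)
    · have : Y = (V ^ 2 - 2) * V ∨ Y = -((V ^ 2 - 2) * V) :=
        sq_pm (by linear_combination hY - (V ^ 2 - 1) * h)
      have key2 : ∀ e : ℚ, e ^ 2 = 1 → Y = e * ((V ^ 2 - 2) * V) → False := by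
        intro e he hYe
        have := d.normSq 3 2 1 4 2 0 (2 * e) (V ^ 2 - 2) V S (by simp [map_ofNat, fV]) fV fS
          (by push_cast; linear_combination h) (by push_cast; ring)
          (by push_cast; rw [hS, hYe]; ring) (by norm_num) nsqB
        have h2 : (2 * e) ^ 2 = 4 := by linear_combination 4 * he
        rw [h2] at this
        have := this.norm; norm_num at this
      rcases this with h | h
      · exact key2 1 (by norm_num) (by rw [h]; push_cast; ring)
      · exact key2 (-1) (by norm_num) (by rw [h]; push_cast; ring)
  rcases sq_pm h1 with h | h
  · have h' : σ B = A := by rw [← h, c.inv]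
    exact key (A + B) (A * B) (by rw [map_add, h, h', add_comm]) (by rw [map_mul, h, h', mul_comm])
      rfl (by linear_combination P.hA + P.hB - 2 * P.hV)
      (by rw [map_mul, map_mul, fV, h, h']; ring)
  · have h' : σ B = -A := by rw [← c.inv A, h, map_neg, neg_neg]
    exact key (A - B) (-(A * B)) (by rw [map_sub, h, h']; ring) (by rw [map_neg, map_mul, h, h']; ring)
      (by ring) (by linear_combination P.hA + P.hB - 2 * P.hV)
      (by rw [map_mul, map_mul, fV, h, h']; ring)

theorem caseI (c : Ctx σ) (P : Pt x V A B) (h : σ x ^ 2 = x ^ 2) :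
    σ x = x ∧ σ V = V ∧ (σ A = A ∨ σ B = B) := by
  have hV : σ V ^ 2 = V ^ 2 := by rw [← map_pow, P.hV, map_add, map_pow, h, map_one]
  rcases sq_pm h with fx | fx
  · have hA : σ A ^ 2 = A ^ 2 := by rw [← map_pow, P.hA]; simp [fx]
    have hB : σ B ^ 2 = B ^ 2 := by rw [← map_pow, P.hB]; simp [fx]
    refine ⟨fx, ?_⟩
    rcases sq_pm hV with fV | fV <;> rcases sq_pm hA with fA | fA <;> rcases sq_pm hB with fB | fB
    · exact ⟨fV, Or.inl fA⟩
    · exact ⟨fV, Or.inl fA⟩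
    · exact ⟨fV, Or.inr fB⟩
    · exact (caseI1 c P fx fV (by rw [map_mul, fA, fB]; ring)).elim
    · exact (caseI2 c P fx fA fB).elim
    · exact (caseI4 c P fx fA (by rw [map_mul, map_mul, fV, fA, fB]; ring)).elim
    · exact (caseI4 c P.neg (by rw [map_neg, fx]) fB
        (by rw [map_mul, map_mul, fV, fA, fB]; ring)).elim
    · exact (caseI3 c P fx (by rw [map_mul, fA, fB]; ring) (by rw [map_mul, fV, fA]; ring)).elim
  · exfalso
    rcases sq_pm hV with fV | fV
    · exact caseI5 c P fx fV
    · exact caseI5 c P.swap (by rw [map_inv₀, fx, inv_neg]) (by rw [map_div₀, fx, fV, neg_div_neg_eq])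
end


section
variable {L : Type*} [Field L] [CharZero L] {σ : L →+* L} {x V A B : L}

/-- Addition law on the Jacobi quartic. -/
theorem jac_add (e x u Y Z : L) (hY : Y ^ 2 = x ^ 4 + e * x ^ 2 + 1)
    (hZ : Z ^ 2 = u ^ 4 + e * u ^ 2 + 1) (hq : 1 - (x * u) ^ 2 ≠ 0) :
    (((1 + (x * u) ^ 2) * (Y * Z + e * (x * u)) + 2 * (x * u) * (x ^ 2 + u ^ 2)) /
      (1 - (x * u) ^ 2) ^ 2) ^ 2 = ((x * Z + u * Y) / (1 - (x * u) ^ 2)) ^ 4 +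
        e * ((x * Z + u * Y) / (1 - (x * u) ^ 2)) ^ 2 + 1 := by
  rw [div_pow, div_pow, div_pow]
  rw [div_eq_iff (pow_ne_zero _ (pow_ne_zero _ hq))]
  have h1 : ∀ q m n : L, q ≠ 0 → m = n ^ 4 + e * n ^ 2 * q ^ 2 + q ^ 4 →
      m = (n ^ 4 / q ^ 4 + e * (n ^ 2 / q ^ 2) + 1) * (q ^ 2) ^ 2 := by
    intro q m n hq h
    rw [h]; field_simp
  apply h1 _ _ _ hq
  linear_combination (-e * u ^ 6 * x ^ 4 + Z ^ 2 * u ^ 4 * x ^ 4 - u ^ 4 * x ^ 4 +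
    e * u ^ 4 * x ^ 2 - 4 * Y * Z * u ^ 3 * x - Y ^ 2 * u ^ 4 - 4 * Z ^ 2 * u ^ 2 * x ^ 2 - u ^ 4 -
    e * u ^ 2 + Z ^ 2) * hY + (u ^ 4 * x ^ 8 - 4 * u ^ 2 * x ^ 6 - 3 * e * u ^ 2 * x ^ 4 -
    4 * Y * Z * u * x ^ 3 - Z ^ 2 * x ^ 4 - 4 * u ^ 2 * x ^ 2 + 1) * hZ

/-- Addition law on the `D_AB` curve. -/
theorem ab_add (x u A B C D : L) (hA : A ^ 2 = x ^ 2 - x + 1) (hB : B ^ 2 = x ^ 2 + x + 1)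
    (hC : C ^ 2 = u ^ 2 - u + 1) (hD : D ^ 2 = u ^ 2 + u + 1) (hq : 1 - (x * u) ^ 2 ≠ 0) :
    (((1 - x * u) * (A * C) + (1 + x * u) * (A * D + B * C) - (1 - x * u) * (B * D)) /
      (2 * (1 - (x * u) ^ 2))) ^ 2 =
      ((x * (C * D) + u * (A * B)) / (1 - (x * u) ^ 2)) ^ 2 -
        (x * (C * D) + u * (A * B)) / (1 - (x * u) ^ 2) + 1 := by
  rw [div_pow, div_pow]
  rw [div_eq_iff (pow_ne_zero _ (mul_ne_zero two_ne_zero hq))]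
  have h1 : ∀ q m n : L, q ≠ 0 → m = 4 * (n ^ 2 - n * q + q ^ 2) →
      m = (n ^ 2 / q ^ 2 - n / q + 1) * (2 * q) ^ 2 := by
    intro q m n hq h
    rw [h]; field_simp; ring
  apply h1 _ _ _ hq
  linear_combination (-2 * C * D * u ^ 2 * x ^ 2 + C ^ 2 * u ^ 2 * x ^ 2 + D ^ 2 * u ^ 2 * x ^ 2 -
    4 * B ^ 2 * u ^ 2 - 2 * C ^ 2 * u * x + 2 * D ^ 2 * u * x + 2 * C * D + C ^ 2 + D ^ 2) * hA +
    (2 * C * D * u ^ 2 * x ^ 2 + C ^ 2 * u ^ 2 * x ^ 2 + D ^ 2 * u ^ 2 * x ^ 2 + 2 * C ^ 2 * u * x -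
      2 * D ^ 2 * u * x - 4 * u ^ 2 * x ^ 2 + 4 * u ^ 2 * x - 2 * C * D + C ^ 2 + D ^ 2 -
      4 * u ^ 2) * hB +
    (-2 * A * B * u ^ 2 * x ^ 2 + 2 * u ^ 2 * x ^ 4 - 4 * D ^ 2 * x ^ 2 + 2 * u ^ 2 * x ^ 2 +
      4 * u * x ^ 2 + 2 * A * B + 2 * x ^ 2 + 2) * hC +
    (2 * A * B * u ^ 2 * x ^ 2 + 2 * u ^ 2 * x ^ 4 - 2 * u ^ 2 * x ^ 2 - 2 * A * B - 2 * x ^ 2 +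
      2) * hD

theorem sqrt_neg_two {z A B : L} (fz : σ z = z) (fA : σ A = A) (fB : σ B = B)
    (hA : A ^ 2 = z ^ 2 - z + 1) (hB : B ^ 2 = z ^ 2 + z + 1) (h0 : z ^ 4 + z ^ 2 + 1 = 0) :
    ∃ q, σ q = q ∧ q ^ 2 = -2 := by
  have hz0 : z ≠ 0 := by rintro rfl; norm_num at h0
  have : (z ^ 2 + z + 1) * (z ^ 2 - z + 1) = 0 := by linear_combination h0
  rcases mul_eq_zero.mp this with h' | h'
  · refine ⟨A / z ^ 2, by simp [fA, fz], ?_⟩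
    rw [div_pow, hA]; field_simp
    linear_combination (2 * z ^ 2 - 2 * z + 1) * h'
  · refine ⟨B / z ^ 2, by simp [fB, fz], ?_⟩
    rw [div_pow, hB]; field_simp
    linear_combination (2 * z ^ 2 + 2 * z + 1) * h'

theorem Ctx.listA (c : Ctx σ) (P : Pt x V A B) (hq : 1 - (x * σ x) ^ 2 ≠ 0) :
    ∃ x0 Y0, σ x0 = x0 ∧ σ Y0 = Y0 ∧
      x0 * (1 - (x * σ x) ^ 2) = x * σ (A * B) + σ x * (A * B) ∧
      Y0 * (1 - (x * σ x) ^ 2) ^ 2 = (1 + (x * σ x) ^ 2) * (A * B * σ (A * B) + x * σ x) +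
        2 * (x * σ x) * (x ^ 2 + σ x ^ 2) ∧ Y0 ^ 2 = x0 ^ 4 + x0 ^ 2 + 1 ∧
      (x0 = 0 ∨ (Deg8 σ ∧ (x0 ^ 2 = 1 ∨ (x0 ^ 2 = -1 ∧ ∃ ρ, σ ρ = ρ ∧ ρ ^ 2 = x0) ∨
        (x0 ^ 4 + x0 ^ 2 + 1 = 0 ∧ ∃ q, σ q = q ∧ q ^ 2 = -2)))) := by
  have hA' : σ A ^ 2 = σ x ^ 2 - σ x + 1 := by rw [← map_pow, P.hA]; simp
  have hB' : σ B ^ 2 = σ x ^ 2 + σ x + 1 := by rw [← map_pow, P.hB]; simp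
  have hY' : (σ A * σ B) ^ 2 = σ x ^ 4 + 1 * σ x ^ 2 + 1 := by
    linear_combination σ B ^ 2 * hA' + (σ x ^ 2 - σ x + 1) * hB'
  have e1 := jac_add 1 x (σ x) (A * B) (σ A * σ B) (by rw [P.Y2]; ring) hY' hq
  have e2 := ab_add x (σ x) A B (σ A) (σ B) P.hA P.hB hA' hB' hq
  have e3 := ab_add (-x) (-σ x) B A (σ B) (σ A) P.neg.hA P.neg.hB (by rw [hB']; ring)
    (by rw [hA']; ring) (by rw [neg_mul_neg]; exact hq)
  rw [neg_mul_neg] at e3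
  obtain ⟨x0, hx0⟩ : ∃ x0, x0 = (x * (σ A * σ B) + σ x * (A * B)) / (1 - (x * σ x) ^ 2) := ⟨_, rfl⟩
  have hx0' : (-x * (σ B * σ A) + -σ x * (B * A)) / (1 - (x * σ x) ^ 2) = -x0 := by
    rw [hx0]; ring
  rw [← hx0] at e1 e2
  rw [hx0'] at e3
  have fx0 : σ x0 = x0 := by
    rw [hx0]; simp only [map_div₀, map_add, map_mul, map_sub, map_one, map_pow, c.inv]
    congr 1
    · ring
    · ring
  refine ⟨x0, _, fx0, ?_, ?_, ?_, e1.trans (by ring), ?_⟩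
  · simp only [map_div₀, map_add, map_mul, map_sub, map_one, map_pow, map_ofNat, c.inv]
    congr 1
    · ring
    · ring
  · rw [hx0, map_mul, div_mul_cancel₀ _ hq]
  · rw [map_mul, div_mul_cancel₀ _ (pow_ne_zero 2 hq)]; ring
  · generalize hA0 : ((1 - x * σ x) * (A * σ A) + (1 + x * σ x) * (A * σ B + B * σ A) -
      (1 - x * σ x) * (B * σ B)) / (2 * (1 - (x * σ x) ^ 2)) = A0 at e2
    generalize hB0 : ((1 - x * σ x) * (B * σ B) + (1 + x * σ x) * (B * σ A + A * σ B) -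
      (1 - x * σ x) * (A * σ A)) / (2 * (1 - (x * σ x) ^ 2)) = B0 at e3
    have fA0 : σ A0 = A0 := by
      rw [← hA0]
      simp only [map_div₀, map_add, map_mul, map_sub, map_one, map_pow, map_ofNat, c.inv]
      congr 1
      · ring
      · ring
    have fB0 : σ B0 = B0 := by
      rw [← hB0]
      simp only [map_div₀, map_add, map_mul, map_sub, map_one, map_pow, map_ofNat, c.inv]
      congr 1
      · ring
      · ring
    have e3' : B0 ^ 2 = x0 ^ 2 + x0 + 1 := by rw [e3]; ring
    rcases c.H0 x0 A0 B0 fx0 fA0 fB0 e2 e3' with h | ⟨d, h | h | h⟩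
    · exact Or.inl h
    · exact Or.inr ⟨d, Or.inl h⟩
    · exact Or.inr ⟨d, Or.inr (Or.inl ⟨h, B0, fB0, by linear_combination e3' + h⟩)⟩
    · exact Or.inr ⟨d, Or.inr (Or.inr ⟨h, sqrt_neg_two fx0 fA0 fB0 e2 e3' h⟩)⟩

theorem Ctx.listV (c : Ctx σ) (P : Pt x V A B) (hq : 1 - (V * σ V) ^ 2 ≠ 0) :
    ∃ v Y1, σ v = v ∧ σ Y1 = Y1 ∧
      v * (1 - (V * σ V) ^ 2) = V * σ (A * B) + σ V * (A * B) ∧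
      Y1 * (1 - (V * σ V) ^ 2) ^ 2 = (1 + (V * σ V) ^ 2) * (A * B * σ (A * B) - V * σ V) +
        2 * (V * σ V) * (V ^ 2 + σ V ^ 2) ∧ Y1 ^ 2 = v ^ 4 - v ^ 2 + 1 ∧
      (v = 0 ∨ v ^ 2 = 1 ∨ (Deg8 σ ∧ (v ^ 2 = -1 ∨ v ^ 4 - v ^ 2 + 1 = 0 ∨ v ^ 4 = -1 ∨
        (v ^ 2 - 2) ^ 2 = 3))) := by
  have hY' : σ (A * B) ^ 2 = σ V ^ 4 + (-1) * σ V ^ 2 + 1 := by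
    rw [← map_pow, P.YV]; simp; ring
  have e1 := jac_add (-1) V (σ V) (A * B) (σ (A * B)) (by rw [P.YV]; ring) hY' hq
  obtain ⟨v, hv⟩ : ∃ v, v = (V * σ (A * B) + σ V * (A * B)) / (1 - (V * σ V) ^ 2) := ⟨_, rfl⟩
  rw [← hv] at e1
  have fv : σ v = v := by
    rw [hv]; simp only [map_div₀, map_add, map_mul, map_sub, map_one, map_pow, c.inv]
    congr 1
    · ring
    · ring
  generalize hY1 : ((1 + (V * σ V) ^ 2) * (A * B * σ (A * B) + (-1) * (V * σ V)) +
    2 * (V * σ V) * (V ^ 2 + σ V ^ 2)) / (1 - (V * σ V) ^ 2) ^ 2 = Y1 at e1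
  have fY1 : σ Y1 = Y1 := by
    rw [← hY1]
    simp only [map_div₀, map_add, map_mul, map_sub, map_neg, map_one, map_pow, map_ofNat, c.inv]
    congr 1
    · ring
    · ring
  have e1' : Y1 ^ 2 = v ^ 4 - v ^ 2 + 1 := by rw [e1]; ring
  refine ⟨v, Y1, fv, fY1, ?_, ?_, e1', ?_⟩
  · rw [hv, div_mul_cancel₀ _ hq]
  · rw [← hY1, div_mul_cancel₀ _ (pow_ne_zero 2 hq)]; ring
  · rcases c.H1 (v ^ 2) (v * Y1) (by rw [map_pow, fv]) (by rw [map_mul, fv, fY1])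
      (by linear_combination v ^ 2 * e1') with h | h | ⟨d, h | h | h | h⟩
    · left; exact pow_eq_zero_iff (two_ne_zero) |>.mp h
    · exact Or.inr (Or.inl h)
    · exact Or.inr (Or.inr ⟨d, Or.inl h⟩)
    · exact Or.inr (Or.inr ⟨d, Or.inr (Or.inl (by linear_combination h))⟩)
    · exact Or.inr (Or.inr ⟨d, Or.inr (Or.inr (Or.inl (by linear_combination h)))⟩)
    · exact Or.inr (Or.inr ⟨d, Or.inr (Or.inr (Or.inr (by linear_combination h)))⟩)
end


section
variable {L : Type*} [Field L] [CharZero L] {σ : L →+* L} {x V A B : L}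

theorem nsqE : ¬ SqQ 3 (-1) 0 := by intro h; rcases h.rat with h | h <;> norm_num at h
theorem nsqF : ¬ SqQ (-3) (-1) 0 := by intro h; rcases h.rat with h | h <;> norm_num at h
theorem nsqG : ¬ SqQ (-1) 0 (-1) := by
  intro h; rcases h.finer 1 (by norm_num) with h | h <;> norm_num at h
theorem nsqH : ¬ SqQ 3 6 3 := by
  intro h; rcases h.finer 3 (by norm_num) with h | h <;> norm_num at h

theorem II0_kill (d : Deg8 σ) (m v E : L) (fm : σ m = m) (fv : σ v = v) (fE : σ E = E)
    (hb : v ^ 2 * (m ^ 2 - 1) = m * (m + 2))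
    (hE : E ^ 2 = m ^ 2 - 1 ∨ E ^ 2 = (m ^ 2 - 1) * (m ^ 2 - 4))
    (hl : v ^ 2 = -1 ∨ v ^ 4 - v ^ 2 + 1 = 0 ∨ v ^ 4 = -1 ∨ (v ^ 2 - 2) ^ 2 = 3) : False := by
  rcases hl with h | h | h | h
  · have hm : 2 * m ^ 2 + 2 * m - 1 = 0 := by rw [h] at hb; linear_combination -hb
    have fw : σ (2 * m + 1) = 2 * m + 1 := by simp [map_ofNat, fm]
    have hw : (2 * m + 1) ^ 2 = ((3 : ℚ) : L) := by push_cast; linear_combination 2 * hm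
    have hρ : v ^ 2 = ((-1 : ℚ) : L) + ((0 : ℚ) : L) * (2 * m + 1) := by
      push_cast; linear_combination h
    rcases hE with hE | hE
    · refine d.contra 3 (-1) 0 0 (-1 / 2) _ v E fw fv fE hw hρ ?_ ?_ nsqE ?_ ?_
      · push_cast; linear_combination hE + hm / 2
      all_goals norm_num
    · refine d.contra 3 (-1) 0 (3 / 4) (3 / 2) _ v E fw fv fE hw hρ ?_ ?_ nsqE ?_ ?_
      · push_cast; linear_combination hE + (m ^ 2 / 2 - m / 2 - 7 / 4) * hm
      all_goals norm_num
  · have hm : m = -v ^ 2 := by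
      have h1 : (m + v ^ 2) ^ 2 * (v ^ 2 - 1) = 0 := by
        linear_combination hb + (2 * m + v ^ 2) * h
      have h2 : v ^ 2 - 1 ≠ 0 := by
        intro h0
        have : (1 : L) = 0 := by linear_combination h - v ^ 2 * h0
        exact one_ne_zero this
      have h3 := (mul_eq_zero.mp h1).resolve_right h2
      have := pow_eq_zero_iff (two_ne_zero) |>.mp h3
      linear_combination this
    have hv2 : v ^ 2 = -m := by rw [hm]; ring
    have hm2 : m ^ 2 + m + 1 = 0 := by rw [hm]; linear_combination h
    have fw : σ (2 * m + 1) = 2 * m + 1 := by simp [map_ofNat, fm]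
    have hw : (2 * m + 1) ^ 2 = ((-3 : ℚ) : L) := by push_cast; linear_combination 4 * hm2
    have hρ : (v * m) ^ 2 = ((-1 : ℚ) : L) + ((0 : ℚ) : L) * (2 * m + 1) := by
      push_cast; linear_combination m ^ 2 * hv2 - (m - 1) * hm2
    have fρ : σ (v * m) = v * m := by rw [map_mul, fv, fm]
    rcases hE with hE | hE
    · refine d.contra (-3) (-1) 0 (-3 / 2) (-1 / 2) _ _ E fw fρ fE hw hρ ?_ ?_ nsqF ?_ ?_
      · push_cast; linear_combination hE + hm2
      all_goals norm_num
    · refine d.contra (-3) (-1) 0 6 3 _ _ E fw fρ fE hw hρ ?_ ?_ nsqF ?_ ?_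
      · push_cast; linear_combination hE + (m ^ 2 - m - 5) * hm2
      all_goals norm_num
  · obtain ⟨j, hj⟩ : ∃ j, j = v ^ 2 := ⟨_, rfl⟩
    have hj2 : j ^ 2 = -1 := by rw [hj]; linear_combination h
    have fj : σ j = j := by rw [hj, map_pow, fv]
    rw [← hj] at hb
    obtain ⟨ρ, hρ⟩ : ∃ ρ, ρ = (1 - j) * m + 1 := ⟨_, rfl⟩
    have fρ : σ ρ = ρ := by rw [hρ]; simp [fj, fm]
    have hρ2 : ρ ^ 2 = -j := by rw [hρ]; linear_combination -(1 - j) * hb + hj2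
    have hz : m ^ 2 - 1 = -1 / 2 + j / 2 - j * ρ := by
      rw [hρ]; linear_combination -(1 + j) / 2 * hb + (m ^ 2 / 2 - 1 / 2 - m) * hj2
    have c1 : j ^ 2 = ((-1 : ℚ) : L) := by push_cast; exact hj2
    have c2 : ρ ^ 2 = ((0 : ℚ) : L) + ((-1 : ℚ) : L) * j := by push_cast; linear_combination hρ2
    rcases hE with hE | hE
    · have := d.normSq (-1) 0 (-1) (-1 / 2) (1 / 2) 0 (-1) j ρ E fj fρ fE c1 c2
        (by push_cast; linear_combination hE + hz) (by norm_num) nsqG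
      rcases this.finer (3 / 2) (by norm_num) with h | h <;> norm_num at h
    · have := d.normSq (-1) 0 (-1) (3 / 2) (-1) 1 4 j ρ E fj fρ fE c1 c2
        (by
          push_cast
          linear_combination hE + (m ^ 2 - 4 + (-1 / 2 + j / 2 - j * ρ)) * hz + j ^ 2 * hρ2 +
            (1 / 4 - ρ - j) * hj2) (by norm_num) nsqG
      have := this.norm; norm_num at this
  · obtain ⟨w, hw⟩ : ∃ w, w = v ^ 2 - 2 := ⟨_, rfl⟩
    have hw2 : w ^ 2 = 3 := by rw [hw]; exact h
    have fw : σ w = w := by rw [hw]; simp [map_ofNat, fv]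
    have hvw : v ^ 2 = 2 + w := by rw [hw]; ring
    rw [hvw] at hb
    obtain ⟨ρ, hρ⟩ : ∃ ρ, ρ = 1 - (1 + w) * m := ⟨_, rfl⟩
    have fρ : σ ρ = ρ := by rw [hρ]; simp [fw, fm]
    have hρ2 : ρ ^ 2 = 6 + 3 * w := by rw [hρ]; linear_combination (1 + w) * hb + hw2
    have hz : m ^ 2 - 1 = 3 / 2 - w / 2 - (2 - w) * ρ := by
      rw [hρ]; linear_combination -(1 - w) / 2 * hb + (-m ^ 2 / 2 + m + 1 / 2) * hw2
    have c1 : w ^ 2 = ((3 : ℚ) : L) := by push_cast; exact hw2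
    have c2 : ρ ^ 2 = ((6 : ℚ) : L) + ((3 : ℚ) : L) * w := by push_cast; linear_combination hρ2
    rcases hE with hE | hE
    · have := d.normSq 3 6 3 (3 / 2) (-1 / 2) (-2) 1 w ρ E fw fρ fE c1 c2
        (by push_cast; linear_combination hE + hz) (by norm_num) nsqH
      rcases this.finer (3 / 2) (by norm_num) with h | h <;> norm_num at h
    · have := d.normSq 3 6 3 (9 / 2) (-3) (-3) 2 w ρ E fw fρ fE c1 c2
        (by
          push_cast
          linear_combination hE + (m ^ 2 - 4 + (3 / 2 - w / 2 - (2 - w) * ρ)) * hz +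
            (w ^ 2 - 4 * w + 4) * hρ2 + (-ρ + 3 * w - 23 / 4) * hw2) (by norm_num) nsqH
      have := this.norm; norm_num at this

theorem caseII0_core (c : Ctx σ) (P : Pt x V A B) (κ : L) (hκ : κ = 1 ∨ κ = -1) (fx : σ x = x⁻¹)
    (fV : σ V = κ * V / x) (fY : σ (A * B) = κ * (A * B) / x ^ 2) : False := by
  have hx := P.x0
  have fκ : σ κ = κ := by rcases hκ with rfl | rfl <;> simp
  have hκ2 : κ ^ 2 = 1 := by rcases hκ with rfl | rfl <;> ring
  obtain ⟨m, hm⟩ : ∃ m, m = x + x⁻¹ := ⟨_, rfl⟩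
  have fm : σ m = m := by rw [hm, map_add, map_inv₀, fx, inv_inv, add_comm]
  have hmx : x ^ 2 + 1 = m * x := by rw [hm]; field_simp
  have hV : V ^ 2 = m * x := by rw [P.hV, hmx]
  obtain ⟨y, hy⟩ : ∃ y, y = A * B / x := ⟨_, rfl⟩
  have hYy : A * B = y * x := by rw [hy]; field_simp
  have hy0 : y ≠ 0 := by rw [hy]; exact div_ne_zero P.Y0 hx
  have hy2 : y ^ 2 = m ^ 2 - 1 := by
    rw [hy, div_pow, P.Y2, hm]; field_simp; ring
  have fy : σ y = κ * y := by
    rw [hy, map_div₀, fY, fx]; field_simp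
  have hN : V * σ V = κ * m := by
    rw [fV, mul_div_assoc', div_eq_iff hx]; linear_combination κ * hV
  have hN2 : (V * σ V) ^ 2 = m ^ 2 := by rw [hN, mul_pow, hκ2, one_mul]
  have hq : 1 - (V * σ V) ^ 2 ≠ 0 := by
    rw [hN2]; intro h0; apply pow_ne_zero 2 hy0; rw [hy2]; linear_combination -h0
  have hE : ∃ E, σ E = E ∧ (E ^ 2 = m ^ 2 - 1 ∨ E ^ 2 = (m ^ 2 - 1) * (m ^ 2 - 4)) := by
    rcases hκ with rfl | rfl
    · exact ⟨y, by rw [fy, one_mul], Or.inl hy2⟩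
    · refine ⟨y * (x - x⁻¹), ?_, Or.inr ?_⟩
      · rw [map_mul, map_sub, map_inv₀, fy, fx, inv_inv]; ring
      · rw [mul_pow, hy2, hm]; field_simp; ring
  obtain ⟨E, fE, hE⟩ := hE
  obtain ⟨v, Y1, fv, fY1, hv, -, -, hl⟩ := c.listV P hq
  have hb : v ^ 2 * (m ^ 2 - 1) = m * (m + 2) := by
    have h1 : v * (1 - m ^ 2) * x = κ * V * y * (1 + x) := by
      rw [← hN2, hv, fY, fV, hYy]; field_simp
    have h2 : (v ^ 2 * (m ^ 2 - 1)) * ((m ^ 2 - 1) * x ^ 2) = (m * (m + 2)) * ((m ^ 2 - 1) * x ^ 2) := by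
      linear_combination (v * (1 - m ^ 2) * x + κ * V * y * (1 + x)) * h1 +
        V ^ 2 * y ^ 2 * (1 + x) ^ 2 * hκ2 + y ^ 2 * (1 + x) ^ 2 * hV + m * x * (1 + x) ^ 2 * hy2 +
        m * x * (m ^ 2 - 1) * hmx
    refine mul_right_cancel₀ (mul_ne_zero ?_ (pow_ne_zero 2 hx)) h2
    rw [← hy2]; exact pow_ne_zero 2 hy0
  rcases hl with h | h | ⟨d, h⟩
  · rw [h] at hb
    have : m * (m + 2) = 0 := by rw [← hb]; ring
    rcases mul_eq_zero.mp this with h0 | h0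
    · apply pow_ne_zero 2 P.V0; rw [hV, h0, zero_mul]
    · have : x = -1 := by
        have : (x + 1) ^ 2 = 0 := by linear_combination hmx + x * h0
        have := pow_eq_zero_iff (two_ne_zero) |>.mp this
        linear_combination this
      apply P.x1; rw [this]; ring
  · rw [h] at hb
    apply P.t2
    linear_combination 2 * hmx - x * hb
  · exact II0_kill d m v E fm fv fE hb hE h

theorem caseII0 (c : Ctx σ) (P : Pt x V A B) (hr : (x * σ x) ^ 2 = 1) : False := by
  have hx := P.x0
  have hx' : σ x ≠ 0 := by simpa using hx
  have h1 : (σ V * x) ^ 2 = V ^ 2 := by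
    rw [mul_pow, ← map_pow, P.hV, map_add, map_pow, map_one]; linear_combination hr
  obtain ⟨κ, hκ, hV⟩ : ∃ κ : L, (κ = 1 ∨ κ = -1) ∧ σ V * x = κ * V := by
    rcases sq_pm h1 with h | h
    · exact ⟨1, Or.inl rfl, by rw [h, one_mul]⟩
    · exact ⟨-1, Or.inr rfl, by rw [h]; ring⟩
  have fκ : σ κ = κ := by rcases hκ with rfl | rfl <;> simp
  have hκ2 : κ ^ 2 = 1 := by rcases hκ with rfl | rfl <;> ring
  have hr1 : x * σ x = 1 := by
    have h2 := congrArg σ hV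
    rw [map_mul, map_mul, fκ, c.inv] at h2
    have h3 : V * (x * σ x) = V * 1 := by linear_combination x * h2 + κ * hV + V * hκ2
    exact mul_left_cancel₀ P.V0 h3
  have fx : σ x = x⁻¹ := eq_inv_of_mul_eq_one_right hr1
  have fV : σ V = κ * V / x := by rw [← hV]; field_simp
  have h4 : (σ (A * B) * x ^ 2) ^ 2 = (A * B) ^ 2 := by
    rw [mul_pow, ← map_pow, P.Y2, map_add, map_add, map_pow, map_pow, map_one]
    linear_combination (x ^ 3 * σ x ^ 3 + x ^ 2 * σ x ^ 2 + x * σ x + 1 + x ^ 2 * (x * σ x + 1)) * hr1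
  obtain ⟨θ, hθ, hY⟩ : ∃ κ : L, (κ = 1 ∨ κ = -1) ∧ σ (A * B) = κ * (A * B) / x ^ 2 := by
    rcases sq_pm h4 with h | h
    · exact ⟨1, Or.inl rfl, by rw [one_mul, eq_div_iff (pow_ne_zero 2 hx)]; exact h⟩
    · exact ⟨-1, Or.inr rfl, by rw [eq_div_iff (pow_ne_zero 2 hx), h]; ring⟩
  by_cases hθκ : θ = κ
  · subst hθκ
    exact caseII0_core c P θ hθ fx fV hY
  · have h5 : κ = -θ := by
      rcases hθ with rfl | rfl <;> rcases hκ with rfl | rfl <;> simp_all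
    subst h5
    refine caseII0_core c P.neg θ hθ (by rw [map_neg, fx, inv_neg]) (by rw [fV]; field_simp) ?_
    rw [mul_comm B A, hY, neg_sq]
end


section
variable {L : Type*} [Field L] [CharZero L] {σ : L →+* L} {x V A B : L}

theorem nsqI : ¬ SqQ 3 3 (1 / 2) := by intro h; have := h.norm; norm_num at this
theorem nsqJ : ¬ SqQ (-3) (-2) 0 := by intro h; rcases h.rat with h | h <;> norm_num at h

theorem II1_m {m b : L} (h : b ^ 2 + b + 1 = 0) (hb : b * (1 - m ^ 2) = m * (m + 2)) : m = b := by
  have h1 : (m - b) ^ 2 = 0 := by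
    linear_combination b * hb + (m ^ 2) * h
  have := pow_eq_zero_iff (two_ne_zero) |>.mp h1
  linear_combination this

theorem II1_kill1 (d : Deg8 σ) (m x₀ l F : L) (fm : σ m = m) (fl : σ l = l)
    (fF : σ F = F) (hb : x₀ ^ 2 * (1 - m ^ 2) = m * (m + 2)) (hl : l ^ 2 = 4 - m ^ 2)
    (hF : F ^ 2 = 1 - m ^ 2 ∨ F ^ 2 = -(1 - m ^ 2))
    (h : x₀ ^ 2 = 1 ∨ (x₀ ^ 4 + x₀ ^ 2 + 1 = 0 ∧ ∃ q, σ q = q ∧ q ^ 2 = -2)) : False := by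
  have fw : σ (2 * m + 1) = 2 * m + 1 := by simp [map_ofNat, fm]
  rcases h with h | ⟨h, q, fq, hq⟩
  · have hm : 2 * m ^ 2 + 2 * m - 1 = 0 := by rw [h] at hb; linear_combination -hb
    have hw : (2 * m + 1) ^ 2 = ((3 : ℚ) : L) := by push_cast; linear_combination 2 * hm
    have hρ : l ^ 2 = ((3 : ℚ) : L) + ((1 / 2 : ℚ) : L) * (2 * m + 1) := by
      push_cast; linear_combination hl - hm / 2
    rcases hF with hF | hF
    · refine d.contra 3 3 (1 / 2) 0 (1 / 2) _ l F fw fl fF hw hρ ?_ ?_ nsqI ?_ ?_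
      · push_cast; linear_combination hF - hm / 2
      all_goals norm_num
    · refine d.contra 3 3 (1 / 2) 0 (-1 / 2) _ l F fw fl fF hw hρ ?_ ?_ nsqI ?_ ?_
      · push_cast; linear_combination hF + hm / 2
      all_goals norm_num
  · have hm := II1_m (m := m) (b := x₀ ^ 2) (by linear_combination h) hb
    have hm2 : m ^ 2 + m + 1 = 0 := by rw [hm]; linear_combination h
    have hw : (2 * m + 1) ^ 2 = ((-3 : ℚ) : L) := by push_cast; linear_combination 4 * hm2
    have hρ : q ^ 2 = ((-2 : ℚ) : L) + ((0 : ℚ) : L) * (2 * m + 1) := by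
      push_cast; linear_combination hq
    rcases hF with hF | hF
    · refine d.contra (-3) (-2) 0 (3 / 2) (1 / 2) _ q F fw fq fF hw hρ ?_ ?_ nsqJ ?_ ?_
      · push_cast; linear_combination hF - hm2
      all_goals norm_num
    · refine d.contra (-3) (-2) 0 (-3 / 2) (-1 / 2) _ q F fw fq fF hw hρ ?_ ?_ nsqJ ?_ ?_
      · push_cast; linear_combination hF + hm2
      all_goals norm_num

theorem II1_kill2 (d : Deg8 σ) (m x₀ j E : L) (fm : σ m = m) (fx : σ x₀ = x₀) (fj : σ j = j)
    (fE : σ E = E) (hb : x₀ ^ 2 * (1 - m ^ 2) = m * (m + 2)) (hj : j ^ 2 = -1)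
    (hE : E ^ 2 = 1 - m ^ 2 ∨ E ^ 2 = (1 - m ^ 2) * (4 - m ^ 2))
    (h : x₀ ^ 2 = 1 ∨ (x₀ ^ 2 = -1 ∧ ∃ ρ, σ ρ = ρ ∧ ρ ^ 2 = x₀) ∨
      (x₀ ^ 4 + x₀ ^ 2 + 1 = 0 ∧ ∃ q, σ q = q ∧ q ^ 2 = -2)) : False := by
  have fw : σ (2 * m + 1) = 2 * m + 1 := by simp [map_ofNat, fm]
  rcases h with h | ⟨h, ρ, fρ, hρ⟩ | ⟨h, q, fq, hq⟩
  · have hm : 2 * m ^ 2 + 2 * m - 1 = 0 := by rw [h] at hb; linear_combination -hb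
    have hw : (2 * m + 1) ^ 2 = ((3 : ℚ) : L) := by push_cast; linear_combination 2 * hm
    have hρ : j ^ 2 = ((-1 : ℚ) : L) + ((0 : ℚ) : L) * (2 * m + 1) := by
      push_cast; linear_combination hj
    rcases hE with hE | hE
    · refine d.contra 3 (-1) 0 0 (1 / 2) _ j E fw fj fE hw hρ ?_ ?_ nsqE ?_ ?_
      · push_cast; linear_combination hE - hm / 2
      all_goals norm_num
    · refine d.contra 3 (-1) 0 (3 / 4) (3 / 2) _ j E fw fj fE hw hρ ?_ ?_ nsqE ?_ ?_
      · push_cast; linear_combination hE + (m ^ 2 / 2 - m / 2 - 7 / 4) * hm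
      all_goals norm_num
  · have hm : m = -1 / 2 := by rw [h] at hb; linear_combination -hb / 2
    have c1 : x₀ ^ 2 = ((-1 : ℚ) : L) := by push_cast; exact h
    have c2 : ρ ^ 2 = ((0 : ℚ) : L) + ((1 : ℚ) : L) * x₀ := by push_cast; linear_combination hρ
    have key : ∀ u : ℚ, E ^ 2 = u → ¬ IsSquare u → ¬ IsSquare (-u) → ¬ IsSquare (u / 2) →
        ¬ IsSquare (-u / 2) → False := by
      intro u hu h1 h2 h3 h4
      rcases d.two (-1) 0 1 u 0 x₀ ρ E fx fρ fE c1 c2 (by rw [hu]; push_cast; ring)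
        (by norm_num) nsqA with h | h
      · rcases h.rat with h | h
        · exact h1 h
        · exact h2 (by simpa using h)
      · rcases h.finer u (by ring) with h | h
        · apply h3; convert h using 1; ring
        · apply h4; convert h using 1; ring
    rcases hE with hE | hE
    · refine key (3 / 4) ?_ ?_ ?_ ?_ ?_
      · rw [hE, hm]; push_cast; norm_num
      all_goals norm_num
    · refine key (45 / 16) ?_ ?_ ?_ ?_ ?_
      · rw [hE, hm]; push_cast; norm_num
      all_goals norm_num
  · have hm := II1_m (m := m) (b := x₀ ^ 2) (by linear_combination h) hb
    have hm2 : m ^ 2 + m + 1 = 0 := by rw [hm]; linear_combination h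
    refine d.three (-1) (-2) (-3) j q (2 * m + 1) fj fq fw ?_ ?_ ?_ ?_ ?_ ?_ ?_ ?_ ?_ ?_
    · push_cast; exact hj
    · push_cast; exact hq
    · push_cast; linear_combination 4 * hm2
    all_goals norm_num

theorem caseII1 (c : Ctx σ) (P : Pt x V A B) (hN : (V * σ V) ^ 2 = 1) (hI : σ x ^ 2 ≠ x ^ 2) :
    False := by
  have hx := P.x0
  have hV0 := P.V0
  have hx' : σ x ≠ 0 := by simpa using hx
  have hY0 := P.Y0
  obtain ⟨δ, hδ, hδV⟩ : ∃ δ : L, (δ = 1 ∨ δ = -1) ∧ V * σ V = δ := by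
    have h0 : (V * σ V) ^ 2 = 1 ^ 2 := by rw [hN, one_pow]
    rcases sq_pm h0 with h | h
    · exact ⟨1, Or.inl rfl, h⟩
    · exact ⟨-1, Or.inr rfl, h⟩
  have fδ : σ δ = δ := by rcases hδ with rfl | rfl <;> simp
  have hδ2 : δ ^ 2 = 1 := by rcases hδ with rfl | rfl <;> ring
  have fV : σ V = δ / V := by rw [← hδV]; field_simp
  have hVV : σ V ^ 2 = σ x ^ 2 + 1 := by rw [← map_pow, P.hV]; simp
  have hxb : σ x ^ 2 * V ^ 2 = -x ^ 2 := by
    linear_combination hN - V ^ 2 * hVV - P.hV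
  obtain ⟨j, hj⟩ : ∃ j, j = σ x * V / x := ⟨_, rfl⟩
  have hj2 : j ^ 2 = -1 := by
    rw [hj, div_pow, mul_pow, hxb]; field_simp
  have hj0 : j ≠ 0 := by rintro rfl; norm_num at hj2
  have hxj : σ x * V = j * x := by rw [hj]; field_simp
  have fj : σ j = -δ * j := by
    have : σ j * j = δ := by
      rw [hj, map_div₀, map_mul, c.inv, fV]; field_simp
    linear_combination σ j * hj2 - j * this
  obtain ⟨μ, hμ⟩ : ∃ μ, μ = x * σ x := ⟨_, rfl⟩
  have fμ : σ μ = μ := by rw [hμ, map_mul, c.inv, mul_comm]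
  have hμV : μ * V = j * x ^ 2 := by rw [hμ]; linear_combination x * hxj
  have hμV2 : μ ^ 2 * V ^ 2 = -x ^ 4 := by
    linear_combination (μ * V + j * x ^ 2) * hμV + x ^ 4 * hj2
  obtain ⟨y, hy⟩ : ∃ y, y = A * B / V := ⟨_, rfl⟩
  have hyV : A * B = y * V := by rw [hy]; field_simp
  have hy0 : y ≠ 0 := by rw [hy]; exact div_ne_zero hY0 hV0
  have hy2 : y ^ 2 = 1 - μ ^ 2 := by
    have : y ^ 2 * V ^ 2 = (1 - μ ^ 2) * V ^ 2 := by
      rw [← mul_pow, ← hyV, P.Y2]; linear_combination hμV2 - P.hV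
    exact mul_right_cancel₀ (pow_ne_zero 2 hV0) this
  have h4 : (σ (A * B) * V ^ 2) ^ 2 = (A * B) ^ 2 := by
    rw [mul_pow, ← map_pow, P.Y2, map_add, map_add, map_pow, map_pow, map_one]
    linear_combination (σ x ^ 2 * V ^ 2 - x ^ 2 + V ^ 2) * hxb + (V ^ 2 + 1) * P.hV
  obtain ⟨θ, hθ, fY⟩ : ∃ κ : L, (κ = 1 ∨ κ = -1) ∧ σ (A * B) = κ * (A * B) / V ^ 2 := by
    rcases sq_pm h4 with h | h
    · exact ⟨1, Or.inl rfl, by rw [one_mul, eq_div_iff (pow_ne_zero 2 hV0)]; exact h⟩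
    · exact ⟨-1, Or.inr rfl, by rw [eq_div_iff (pow_ne_zero 2 hV0), h]; ring⟩
  have fθ : σ θ = θ := by rcases hθ with rfl | rfl <;> simp
  have hθ2 : θ ^ 2 = 1 := by rcases hθ with rfl | rfl <;> ring
  have hδ0 : δ ≠ 0 := by rintro rfl; norm_num at hδ2
  have fy : σ y = θ * δ * y := by
    have h1 : σ y * σ V = σ (A * B) := by rw [hyV, map_mul]
    rw [fV, fY, hyV] at h1
    field_simp at h1
    linear_combination δ * h1 - σ y * hδ2
  obtain ⟨l, hl⟩ : ∃ l, l = V + V⁻¹ := ⟨_, rfl⟩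
  have fl : σ l = δ * l := by
    have : σ (V⁻¹) = δ * V := by
      rw [map_inv₀, fV, inv_div, div_eq_iff hδ0]; linear_combination -V * hδ2
    rw [hl, map_add, this, fV]; field_simp; ring
  have hlV : l * V = V ^ 2 + 1 := by rw [hl]; field_simp
  have hl2 : l ^ 2 = 4 - μ ^ 2 := by
    have : l ^ 2 * V ^ 2 = (4 - μ ^ 2) * V ^ 2 := by
      linear_combination (l * V + V ^ 2 + 1) * hlV + hμV2 + (V ^ 2 + x ^ 2 - 1) * P.hV
    exact mul_right_cancel₀ (pow_ne_zero 2 hV0) this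
  obtain ⟨m, hm⟩ : ∃ m, m = θ * μ := ⟨_, rfl⟩
  have fm : σ m = m := by rw [hm, map_mul, fθ, fμ]
  have hm2 : m ^ 2 = μ ^ 2 := by rw [hm, mul_pow, hθ2, one_mul]
  obtain ⟨x₀, Y₀, fx0, fY0, hx0, -, -, hlist⟩ := c.listA P (by
    rw [← hμ, ← hy2]; exact pow_ne_zero 2 hy0)
  rw [← hμ] at hx0
  have hb : x₀ ^ 2 * (1 - m ^ 2) = m * (m + 2) := by
    have h1 : x₀ * (1 - μ ^ 2) * V = x * y * (θ + j * V) := by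
      have h2 : x₀ * (1 - μ ^ 2) * V * V = x * y * (θ + j * V) * V := by
        rw [hx0, fY, hyV]; field_simp; linear_combination V * hxj
      exact mul_right_cancel₀ hV0 h2
    have h3 : (x₀ ^ 2 * (1 - m ^ 2)) * (y ^ 2 * V ^ 2) = (m * (m + 2)) * (y ^ 2 * V ^ 2) := by
      rw [hm2]
      have e1 : (x₀ ^ 2 * (1 - μ ^ 2)) * (y ^ 2 * V ^ 2) = (x * y * (θ + j * V)) ^ 2 := by
        rw [← h1, hy2]; ring
      rw [e1]
      have e2 : m * (m + 2) * V ^ 2 = -x ^ 4 + 2 * θ * j * x ^ 2 * V := by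
        rw [hm]
        linear_combination (μ ^ 2 * V ^ 2) * hθ2 + hμV2 + 2 * θ * V * hμV
      linear_combination -y ^ 2 * e2 + y ^ 2 * x ^ 2 * (hθ2 + V ^ 2 * hj2 - P.hV)
    refine mul_right_cancel₀ (mul_ne_zero (pow_ne_zero 2 hy0) (pow_ne_zero 2 hV0)) h3
  rw [← hm2] at hy2 hl2
  rcases hlist with h | ⟨d, h⟩
  · rw [h] at hb
    have : m * (m + 2) = 0 := by rw [← hb]; ring
    have hμ0 : μ ≠ 0 := by rw [hμ]; exact mul_ne_zero hx hx'
    have hm0 : m ≠ 0 := by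
      intro h0; rw [h0] at hm2; exact pow_ne_zero 2 hμ0 (by rw [← hm2]; ring)
    have hm4 : m = -2 := by
      have := (mul_eq_zero.mp this).resolve_left hm0
      linear_combination this
    rw [hm4] at hl2
    have hl0 : l = 0 := by
      have : l ^ 2 = 0 := by rw [hl2]; ring
      exact pow_eq_zero_iff (two_ne_zero) |>.mp this
    rw [hl0] at hlV
    have hV2 : V ^ 2 = -1 := by linear_combination -hlV
    apply hI
    linear_combination -hxb + σ x ^ 2 * hV2
  · rcases hδ with rfl | rfl
    · have h' : x₀ ^ 2 = 1 ∨ (x₀ ^ 4 + x₀ ^ 2 + 1 = 0 ∧ ∃ q, σ q = q ∧ q ^ 2 = -2) := by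
        rcases h with h | h | h
        · exact Or.inl h
        · exfalso
          have h1 : x₀ ^ 2 = j ^ 2 := by rw [h.1, hj2]
          have h2 : σ j = j := by
            rcases sq_pm h1 with h | h
            · rw [← h, fx0]
            · have : j = -x₀ := by rw [h, neg_neg]
              rw [this, map_neg, fx0]
          apply hj0; linear_combination (h2 - fj) / (-2)
        · exact Or.inr h
      rcases hθ with rfl | rfl
      · exact II1_kill1 d m x₀ l y fm (by rw [fl, one_mul]) (by rw [fy]; ring) hb hl2
          (Or.inl hy2) h'
      · exact II1_kill1 d m x₀ l (j * y) fm (by rw [fl, one_mul])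
          (by rw [map_mul, fy, fj]; ring) hb hl2
          (Or.inr (by rw [mul_pow, hj2, hy2]; ring)) h'
    · have fj' : σ j = j := by rw [fj]; ring
      rcases hθ with rfl | rfl
      · exact II1_kill2 d m x₀ j (y * l) fm fx0 fj' (by rw [map_mul, fy, fl]; ring) hb hj2
          (Or.inr (by rw [mul_pow, hy2, hl2])) h
      · exact II1_kill2 d m x₀ j y fm fx0 fj' (by rw [fy]; ring) hb hj2 (Or.inl hy2) h

theorem caseII2 (c : Ctx σ) (P : Pt x V A B) (hN : (V * σ V) ^ 2 = (x * σ x) ^ 2)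
    (hI : σ x ^ 2 ≠ x ^ 2) : False := by
  have hx := P.x0
  have hx' : σ x ≠ 0 := by simpa using hx
  refine caseII1 c P.swap ?_ ?_
  · rw [map_div₀, div_mul_div_comm, div_pow, hN, div_self]
    exact pow_ne_zero 2 (mul_ne_zero hx hx')
  · rw [map_inv₀, inv_pow, inv_pow]
    intro h; exact hI (inv_injective h)
end


section
variable {L : Type*} [Field L] [CharZero L] {σ : L →+* L} {x V A B : L}

/-- The relation between the three quotients. -/
theorem relR (r N M a Y₀ b Y₁ c Y₂ e : L) (he : e = N ^ 2 - r ^ 2 - 1)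
    (hM : M ^ 2 = r ^ 4 + r ^ 2 * e + e ^ 2 - r ^ 2 + e + 1)
    (h1 : 1 - r ^ 2 ≠ 0) (h2 : 1 - N ^ 2 ≠ 0) (h3 : r ^ 2 - N ^ 2 ≠ 0)
    (ha : a * (1 - r ^ 2) ^ 2 = r ^ 2 * e + 2 * r ^ 2 + e + 2 * r * M)
    (hY0 : Y₀ * (1 - r ^ 2) ^ 2 = (1 + r ^ 2) * (M + r) + 2 * r * e)
    (hb : b * (1 - N ^ 2) ^ 2 = N ^ 2 * e + e + 2 + 2 * N * M)
    (hY1 : Y₁ * (1 - N ^ 2) ^ 2 = (1 + N ^ 2) * (M - N) + 2 * N * (e + 2))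
    (hc : c * (r ^ 2 - N ^ 2) ^ 2 = N ^ 2 * e + e * r ^ 2 + 2 * r ^ 4 + 2 * N * M * r)
    (hY2 : Y₂ * (r ^ 2 - N ^ 2) ^ 2 = (r ^ 2 + N ^ 2) * (M - N * r) + 2 * N * r * (e + 2 * r ^ 2)) :
    6 - 2 * Y₂ - 3 * (b * c) - 2 * (b * Y₂) - 2 * Y₁ - 2 * (Y₁ * c) - 2 * (Y₁ * Y₂) +
      a * (3 * c + 2 * Y₂ + 3 * b - 6 * (b * c) - 4 * (b * Y₂) + 2 * Y₁ - 4 * (Y₁ * c) -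
        4 * (Y₁ * Y₂)) +
      Y₀ * (-2 - 2 * c - 2 * Y₂ - 2 * b + 4 * (b * c) + 4 * (b * Y₂) - 2 * Y₁ + 4 * (Y₁ * c) +
        6 * (Y₁ * Y₂)) = 0 := by
  subst he
  rw [← eq_div_iff (pow_ne_zero 2 h1)] at ha hY0
  rw [← eq_div_iff (pow_ne_zero 2 h2)] at hb hY1
  rw [← eq_div_iff (pow_ne_zero 2 h3)] at hc hY2
  subst ha hY0 hb hY1 hc hY2
  field_simp
  linear_combination (2 * N ^ 3 * r ^ 5 + 2 * N ^ 5 * r ^ 3 + 6 * M * N ^ 2 * r ^ 4 + 8 * M * N ^ 3 * r ^ 3 + 6 * M *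
    N ^ 4 * r ^ 2 - 4 * N * r ^ 6 + 2 * N ^ 2 * r ^ 5 + 6 * N ^ 3 * r ^ 4 - 6 * N ^ 4 * r ^ 3 - 2 *
    N ^ 5 * r ^ 2 + 4 * N ^ 6 * r + 8 * M * N * r ^ 4 + 8 * M * N ^ 2 * r ^ 3 - 8 * M * N ^ 3 * r ^
    2 - 8 * M * N ^ 4 * r - 2 * N * r ^ 5 - 8 * N ^ 3 * r ^ 3 - 2 * N ^ 5 * r - 8 * M * N * r ^ 3 -
    36 * M * N ^ 2 * r ^ 2 - 8 * M * N ^ 3 * r + 6 * M * N ^ 4 + 6 * M * r ^ 4 + 6 * N * r ^ 4 + 8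
    * N ^ 2 * r ^ 3 - 8 * N ^ 3 * r ^ 2 - 6 * N ^ 4 * r + 2 * N ^ 5 - 2 * r ^ 5 - 8 * M * N * r ^ 2
    + 8 * M * N ^ 2 * r + 8 * M * N ^ 3 - 8 * M * r ^ 3 + 6 * N * r ^ 3 + 6 * N ^ 3 * r + 8 * M * N
    * r + 6 * M * N ^ 2 + 6 * M * r ^ 2 - 2 * N * r ^ 2 + 2 * N ^ 2 * r + 2 * N ^ 3 - 2 * r ^ 3 - 4
    * N * r) * hM
end


/-- Integral coordinates with respect to `1, w, ρ, w ρ`. -/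
structure Quad4 where
  c0 : ℤ
  c1 : ℤ
  c2 : ℤ
  c3 : ℤ

instance : DecidableEq Quad4 := fun s t =>
  decidable_of_iff (s.c0 = t.c0 ∧ s.c1 = t.c1 ∧ s.c2 = t.c2 ∧ s.c3 = t.c3) (by
    cases s; cases t; simp)

namespace Quad4
/-- value -/
def ev {L : Type*} [Field L] (w ρ : L) (s : Quad4) : L := (s.c0 + s.c1 * w) + (s.c2 + s.c3 * w) * ρ
/-- sum -/
def qadd (s t : Quad4) : Quad4 := ⟨s.c0 + t.c0, s.c1 + t.c1, s.c2 + t.c2, s.c3 + t.c3⟩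
/-- scaling -/
def smul (n : ℤ) (t : Quad4) : Quad4 := ⟨n * t.c0, n * t.c1, n * t.c2, n * t.c3⟩
/-- product, where `w² = A`, `ρ² = p + q w` -/
def mul (A p q : ℤ) (s t : Quad4) : Quad4 :=
  ⟨s.c0 * t.c0 + A * (s.c1 * t.c1) + p * (s.c2 * t.c2 + A * (s.c3 * t.c3)) +
      q * (A * (s.c2 * t.c3 + s.c3 * t.c2)),
    s.c0 * t.c1 + s.c1 * t.c0 + p * (s.c2 * t.c3 + s.c3 * t.c2) +
      q * (s.c2 * t.c2 + A * (s.c3 * t.c3)),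
    s.c0 * t.c2 + A * (s.c1 * t.c3) + s.c2 * t.c0 + A * (s.c3 * t.c1),
    s.c0 * t.c3 + s.c1 * t.c2 + s.c2 * t.c1 + s.c3 * t.c0⟩

theorem ev_add {L : Type*} [Field L] (w ρ : L) (s t : Quad4) :
    (qadd s t).ev w ρ = s.ev w ρ + t.ev w ρ := by
  simp only [ev, qadd]; push_cast; ring
theorem ev_smul {L : Type*} [Field L] (w ρ : L) (n : ℤ) (t : Quad4) :
    (smul n t).ev w ρ = n * t.ev w ρ := by
  simp only [ev, smul]; push_cast; ring
theorem ev_mul {L : Type*} [Field L] (w ρ : L) (A p q : ℤ) (hw : w ^ 2 = A) (hρ : ρ ^ 2 = p + q * w)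
    (s t : Quad4) : (mul A p q s t).ev w ρ = s.ev w ρ * t.ev w ρ := by
  simp only [ev, mul]; push_cast
  linear_combination (-(s.c1 * t.c1 : L) - (s.c1 * t.c3 + s.c3 * t.c1) * ρ -
    s.c3 * t.c3 * p - q * (s.c2 * t.c3 + s.c3 * t.c2) - q * s.c3 * t.c3 * w) * hw -
    (s.c2 + s.c3 * w) * (t.c2 + t.c3 * w) * hρ

/-- Eight times the left-hand side of the relation, in terms of doubled variables. -/
def R8 (A p q : ℤ) (a y₀ b y₁ c y₂ : Quad4) : Quad4 :=
  let m := mul A p q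
  let bc := m b c
  let bY₂ := m b y₂
  let y₁c := m y₁ c
  let yy := m y₁ y₂
  qadd (qadd (qadd ⟨48, 0, 0, 0⟩ (smul (-8) (qadd y₁ y₂)))
      (qadd (smul (-6) bc) (smul (-4) (qadd bY₂ (qadd y₁c yy)))))
    (qadd (m a (qadd (qadd (smul 6 (qadd b c)) (smul 4 (qadd y₁ y₂)))
        (qadd (smul (-6) bc) (smul (-4) (qadd bY₂ (qadd y₁c yy))))))
      (m y₀ (qadd (qadd ⟨-8, 0, 0, 0⟩ (smul (-4) (qadd (qadd b c) (qadd y₁ y₂))))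
        (qadd (smul 4 (qadd bc (qadd bY₂ y₁c))) (smul 6 yy)))))

theorem R8_zero {L : Type*} [Field L] [CharZero L] (w ρ : L) (A p q : ℤ) (hw : w ^ 2 = A)
    (hρ : ρ ^ 2 = p + q * w) (hA : ¬ IsSquare (A : ℚ)) (hc : ¬ SqQ A p q)
    {a y₀ b y₁ c y₂ : L} {a' y₀' b' y₁' c' y₂' : Quad4}
    (e1 : 2 * a = a'.ev w ρ) (e2 : 2 * y₀ = y₀'.ev w ρ) (e3 : 2 * b = b'.ev w ρ)
    (e4 : 2 * y₁ = y₁'.ev w ρ) (e5 : 2 * c = c'.ev w ρ) (e6 : 2 * y₂ = y₂'.ev w ρ)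
    (h : 6 - 2 * y₂ - 3 * (b * c) - 2 * (b * y₂) - 2 * y₁ - 2 * (y₁ * c) - 2 * (y₁ * y₂) +
      a * (3 * c + 2 * y₂ + 3 * b - 6 * (b * c) - 4 * (b * y₂) + 2 * y₁ - 4 * (y₁ * c) -
        4 * (y₁ * y₂)) +
      y₀ * (-2 - 2 * c - 2 * y₂ - 2 * b + 4 * (b * c) + 4 * (b * y₂) - 2 * y₁ + 4 * (y₁ * c) +
        6 * (y₁ * y₂)) = 0) : R8 A p q a' y₀' b' y₁' c' y₂' = ⟨0, 0, 0, 0⟩ := by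
  have hz : (R8 A p q a' y₀' b' y₁' c' y₂').ev w ρ = 0 := by
    simp only [R8, ev_add, ev_smul, ev_mul w ρ A p q hw hρ, ← e1, ← e2, ← e3, ← e4, ← e5, ← e6]
    simp only [ev]; push_cast
    linear_combination 8 * h
  generalize R8 A p q a' y₀' b' y₁' c' y₂' = T at hz ⊢
  obtain ⟨k0, k1, k2, k3⟩ := T
  simp only [ev] at hz
  have := lin_indep2 (K := L) A p q w ρ (by push_cast; exact hw) (by push_cast; exact hρ) hA hc
    k0 k1 k2 k3 (by push_cast; exact hz)
  obtain ⟨h0, h1, h2, h3⟩ := this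
  simp only [Int.cast_eq_zero] at h0 h1 h2 h3
  simp [h0, h1, h2, h3]

/-- possibilities over `ℚ(√3, i)` -/
def listI : List (Quad4 × Quad4) :=
  [(⟨2, 0, 0, 0⟩, ⟨2, 0, 0, 0⟩), (⟨2, 0, 0, 0⟩, ⟨-2, 0, 0, 0⟩),
    (⟨-2, 0, 0, 0⟩, ⟨0, 2, 0, 0⟩), (⟨-2, 0, 0, 0⟩, ⟨0, -2, 0, 0⟩),
    (⟨1, 0, 0, 1⟩, ⟨0, 0, 0, 0⟩), (⟨1, 0, 0, -1⟩, ⟨0, 0, 0, 0⟩)]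
/-- possibilities over `ℚ(√3, √2)` -/
def listQ : List (Quad4 × Quad4) :=
  [(⟨2, 0, 0, 0⟩, ⟨2, 0, 0, 0⟩), (⟨2, 0, 0, 0⟩, ⟨-2, 0, 0, 0⟩),
    (⟨4, 2, 0, 0⟩, ⟨0, 0, 3, 1⟩), (⟨4, 2, 0, 0⟩, ⟨0, 0, -3, -1⟩),
    (⟨4, -2, 0, 0⟩, ⟨0, 0, -3, 1⟩), (⟨4, -2, 0, 0⟩, ⟨0, 0, 3, -1⟩)]
/-- possibilities over `ℚ(ζ₈)` -/
def listZ : List (Quad4 × Quad4) :=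
  [(⟨2, 0, 0, 0⟩, ⟨2, 0, 0, 0⟩), (⟨2, 0, 0, 0⟩, ⟨-2, 0, 0, 0⟩),
    (⟨0, 2, 0, 0⟩, ⟨0, 0, 0, 2⟩), (⟨0, 2, 0, 0⟩, ⟨0, 0, 0, -2⟩),
    (⟨0, -2, 0, 0⟩, ⟨0, 0, 2, 0⟩), (⟨0, -2, 0, 0⟩, ⟨0, 0, -2, 0⟩)]
/-- rational possibilities -/
def listE : List (Quad4 × Quad4) :=
  [(⟨2, 0, 0, 0⟩, ⟨2, 0, 0, 0⟩), (⟨2, 0, 0, 0⟩, ⟨-2, 0, 0, 0⟩)]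

theorem decI : ∀ s ∈ listI, ∀ t ∈ listI,
    R8 3 (-1) 0 ⟨2, 0, 0, 0⟩ ⟨0, 2, 0, 0⟩ s.1 s.2 t.1 t.2 = ⟨0, 0, 0, 0⟩ →
    s.2 = ⟨0, 0, 0, 0⟩ ∧ t.2 = ⟨0, 0, 0, 0⟩ ∧ t.1 = ⟨1, 0, 0, -s.1.c3⟩ ∧ s.1.c0 = 1 ∧ s.1.c1 = 0 ∧
      s.1.c2 = 0 ∧ s.1.c3 ^ 2 = 1 := by decide
theorem decQ : ∀ s ∈ listQ, ∀ t ∈ listQ,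
    R8 3 2 0 ⟨2, 0, 0, 0⟩ ⟨0, 2, 0, 0⟩ s.1 s.2 t.1 t.2 ≠ ⟨0, 0, 0, 0⟩ := by decide
theorem decZ : ∀ s ∈ listZ, ∀ t ∈ listZ, ∀ e ∈ [(2 : ℤ), -2],
    R8 (-1) 0 1 ⟨-2, 0, 0, 0⟩ ⟨e, 0, 0, 0⟩ s.1 s.2 t.1 t.2 ≠ ⟨0, 0, 0, 0⟩ := by decide
theorem decE : ∀ s ∈ listE, ∀ t ∈ listE,
    R8 (-3) (-2) 0 ⟨-1, 1, 0, 0⟩ ⟨0, 0, 0, 0⟩ s.1 s.2 t.1 t.2 ≠ ⟨0, 0, 0, 0⟩ := by decide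
end Quad4


section
variable {L : Type*} [Field L] [CharZero L] {σ : L →+* L} {x V A B : L}

theorem zeta_kill (d : Deg8 σ) (i ρ s : L) (fi : σ i = i) (fρ : σ ρ = ρ) (fs : σ s = s)
    (hi : i ^ 2 = -1) (hρ : ρ ^ 2 = i) (hs : s ^ 2 = 3) : False := by
  rcases d.two (-1) 0 1 3 0 i ρ s fi fρ fs (by push_cast; exact hi)
    (by push_cast; linear_combination hρ) (by push_cast; linear_combination hs)
    (by norm_num) nsqA with h | h
  · rcases h.rat with h | h <;> norm_num at h
  · rcases h.finer 3 (by norm_num) with h | h <;> norm_num at h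

theorem three_kill (d : Deg8 σ) (w i q : L) (fw : σ w = w) (fi : σ i = i) (fq : σ q = q)
    (hw : w ^ 2 = 3) (hi : i ^ 2 = -1) (hq : q ^ 2 = 2) : False := by
  refine d.three 3 (-1) 2 w i q fw fi fq ?_ ?_ ?_ ?_ ?_ ?_ ?_ ?_ ?_ ?_
  · push_cast; exact hw
  · push_cast; exact hi
  · push_cast; exact hq
  all_goals norm_num

/-- The fixed data obtained from `Ctx.listV`. -/
structure Half (σ : L →+* L) (v y : L) : Prop where
  fv : σ v = v
  fy : σ y = y
  hy : y ^ 2 = v ^ 4 - v ^ 2 + 1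
  opt : v ^ 2 = 1 ∨ v ^ 2 = -1 ∨ v ^ 4 - v ^ 2 + 1 = 0 ∨ v ^ 4 = -1 ∨ (v ^ 2 - 2) ^ 2 = 3

theorem q_of {w v : L} (fw : σ w = w) (fv : σ v = v) (hw : w ^ 2 = 3) (h : (v ^ 2 - 2) ^ 2 = 3) :
    ∃ q, σ q = q ∧ q ^ 2 = 2 := by
  have h1 : (v ^ 2 - 2) ^ 2 = w ^ 2 := by rw [h, hw]
  rcases sq_pm h1 with h2 | h2
  · exact ⟨v * (w - 1), by simp [fw, fv], by
      linear_combination (w - 1) ^ 2 * h2 + w * hw⟩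
  · exact ⟨v * (-w - 1), by simp [fw, fv], by
      linear_combination (w + 1) ^ 2 * h2 - w * hw⟩

theorem Half.tri {v y w : L} (H : Half σ v y) (fw : σ w = w) (hw : w ^ 2 = 3) :
    v ^ 2 = 1 ∨ (∃ i, σ i = i ∧ i ^ 2 = -1) ∨ (∃ q, σ q = q ∧ q ^ 2 = 2) := by
  rcases H.opt with h | h | h | h | h
  · exact Or.inl h
  · exact Or.inr (Or.inl ⟨v, H.fv, h⟩)
  · refine Or.inr (Or.inl ⟨(2 * v ^ 2 - 1) * w / 3, by simp [map_ofNat, H.fv, fw], ?_⟩)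
    linear_combination 4 * w ^ 2 / 9 * h - hw / 3
  · exact Or.inr (Or.inl ⟨v ^ 2, by rw [map_pow, H.fv], by linear_combination h⟩)
  · exact Or.inr (Or.inr (q_of fw H.fv hw h))

theorem Half.y1 {v y : L} (H : Half σ v y) (h : v ^ 2 = 1) : y = 1 ∨ y = -1 :=
  sq_pm (by linear_combination H.hy + v ^ 2 * h)

theorem Half.repI {v y w i : L} (H : Half σ v y) (d : Deg8 σ) (fw : σ w = w) (hw : w ^ 2 = 3)
    (fi : σ i = i) (hi : i ^ 2 = -1) :
    ∃ s ∈ Quad4.listI, 2 * v ^ 2 = s.1.ev w i ∧ 2 * y = s.2.ev w i := by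
  have hy := H.hy
  rcases H.opt with h | h | h | h | h
  · rcases H.y1 h with h1 | h1
    · refine ⟨(⟨2, 0, 0, 0⟩, ⟨2, 0, 0, 0⟩), by simp [Quad4.listI], ?_, ?_⟩ <;>
        simp only [Quad4.ev, h, h1] <;> push_cast <;> ring
    · refine ⟨(⟨2, 0, 0, 0⟩, ⟨-2, 0, 0, 0⟩), by simp [Quad4.listI], ?_, ?_⟩ <;>
        simp only [Quad4.ev, h, h1] <;> push_cast <;> ring
  · have h1 : y ^ 2 = w ^ 2 := by linear_combination hy + (v ^ 2 - 2) * h - hw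
    rcases sq_pm h1 with h1 | h1
    · refine ⟨(⟨-2, 0, 0, 0⟩, ⟨0, 2, 0, 0⟩), by simp [Quad4.listI], ?_, ?_⟩ <;>
        simp only [Quad4.ev, h, h1] <;> push_cast <;> ring
    · refine ⟨(⟨-2, 0, 0, 0⟩, ⟨0, -2, 0, 0⟩), by simp [Quad4.listI], ?_, ?_⟩ <;>
        simp only [Quad4.ev, h, h1] <;> push_cast <;> ring
  · have hy0 : y = 0 := by rw [h] at hy; exact pow_eq_zero_iff (two_ne_zero) |>.mp hy
    have h1 : (2 * v ^ 2 - 1) ^ 2 = (w * i) ^ 2 := by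
      linear_combination 4 * h - i ^ 2 * hw - 3 * hi
    rcases sq_pm h1 with h1 | h1
    · refine ⟨(⟨1, 0, 0, 1⟩, ⟨0, 0, 0, 0⟩), by simp [Quad4.listI], ?_, ?_⟩ <;>
        simp only [Quad4.ev, hy0] <;> push_cast
      · linear_combination h1
      · ring
    · refine ⟨(⟨1, 0, 0, -1⟩, ⟨0, 0, 0, 0⟩), by simp [Quad4.listI], ?_, ?_⟩ <;>
        simp only [Quad4.ev, hy0] <;> push_cast
      · linear_combination h1
      · ring
  · exact (zeta_kill d (v ^ 2) v w (by rw [map_pow, H.fv]) H.fv fw (by linear_combination h) rfl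
      hw).elim
  · obtain ⟨q, fq, hq⟩ := q_of fw H.fv hw h
    exact (three_kill d w i q fw fi fq hw hi hq).elim

theorem Half.repQ {v y w q : L} (H : Half σ v y) (d : Deg8 σ) (fw : σ w = w) (hw : w ^ 2 = 3)
    (fq : σ q = q) (hq : q ^ 2 = 2) :
    ∃ s ∈ Quad4.listQ, 2 * v ^ 2 = s.1.ev w q ∧ 2 * y = s.2.ev w q := by
  have hy := H.hy
  rcases H.opt with h | h | h | h | h
  · rcases H.y1 h with h1 | h1
    · refine ⟨(⟨2, 0, 0, 0⟩, ⟨2, 0, 0, 0⟩), by simp [Quad4.listQ], ?_, ?_⟩ <;>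
        simp only [Quad4.ev, h, h1] <;> push_cast <;> ring
    · refine ⟨(⟨2, 0, 0, 0⟩, ⟨-2, 0, 0, 0⟩), by simp [Quad4.listQ], ?_, ?_⟩ <;>
        simp only [Quad4.ev, h, h1] <;> push_cast <;> ring
  · exact (three_kill d w v q fw H.fv fq hw h hq).elim
  · refine (three_kill d w ((2 * v ^ 2 - 1) * w / 3) q fw ?_ fq hw ?_ hq).elim
    · simp [map_ofNat, H.fv, fw]
    · linear_combination 4 * w ^ 2 / 9 * h - hw / 3
  · exact (three_kill d w (v ^ 2) q fw (by rw [map_pow, H.fv]) fq hw (by linear_combination h)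
      hq).elim
  · have h1 : (v ^ 2 - 2) ^ 2 = w ^ 2 := by rw [h, hw]
    rcases sq_pm h1 with h2 | h2
    · have h3 : (2 * y) ^ 2 = ((3 + w) * q) ^ 2 := by
        linear_combination 4 * hy - (3 + w) ^ 2 * hq + 4 * h + 12 * h2 - 2 * hw
      rcases sq_pm h3 with h3 | h3
      · refine ⟨(⟨4, 2, 0, 0⟩, ⟨0, 0, 3, 1⟩), by simp [Quad4.listQ], ?_, ?_⟩ <;>
          simp only [Quad4.ev, h3] <;> push_cast
        · linear_combination 2 * h2
        · ring
      · refine ⟨(⟨4, 2, 0, 0⟩, ⟨0, 0, -3, -1⟩), by simp [Quad4.listQ], ?_, ?_⟩ <;>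
          simp only [Quad4.ev, h3] <;> push_cast
        · linear_combination 2 * h2
        · ring
    · have h3 : (2 * y) ^ 2 = ((-3 + w) * q) ^ 2 := by
        linear_combination 4 * hy - (-3 + w) ^ 2 * hq + 4 * h + 12 * h2 - 2 * hw
      rcases sq_pm h3 with h3 | h3
      · refine ⟨(⟨4, -2, 0, 0⟩, ⟨0, 0, -3, 1⟩), by simp [Quad4.listQ], ?_, ?_⟩ <;>
          simp only [Quad4.ev, h3] <;> push_cast
        · linear_combination 2 * h2
        · ring
      · refine ⟨(⟨4, -2, 0, 0⟩, ⟨0, 0, 3, -1⟩), by simp [Quad4.listQ], ?_, ?_⟩ <;>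
          simp only [Quad4.ev, h3] <;> push_cast
        · linear_combination 2 * h2
        · ring

theorem Half.repZ {v y i ρ : L} (H : Half σ v y) (d : Deg8 σ) (fi : σ i = i) (hi : i ^ 2 = -1)
    (fρ : σ ρ = ρ) (hρ : ρ ^ 2 = i) :
    ∃ s ∈ Quad4.listZ, 2 * v ^ 2 = s.1.ev i ρ ∧ 2 * y = s.2.ev i ρ := by
  have hy := H.hy
  rcases H.opt with h | h | h | h | h
  · rcases H.y1 h with h1 | h1
    · refine ⟨(⟨2, 0, 0, 0⟩, ⟨2, 0, 0, 0⟩), by simp [Quad4.listZ], ?_, ?_⟩ <;>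
        simp only [Quad4.ev, h, h1] <;> push_cast <;> ring
    · refine ⟨(⟨2, 0, 0, 0⟩, ⟨-2, 0, 0, 0⟩), by simp [Quad4.listZ], ?_, ?_⟩ <;>
        simp only [Quad4.ev, h, h1] <;> push_cast <;> ring
  · exact (zeta_kill d i ρ y fi fρ H.fy hi hρ (by linear_combination hy + (v ^ 2 - 2) * h)).elim
  · refine (zeta_kill d i ρ ((2 * v ^ 2 - 1) * i) fi fρ ?_ hi hρ ?_).elim
    · simp [map_ofNat, H.fv, fi]
    · linear_combination 4 * i ^ 2 * h - 3 * hi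
  · have h1 : (v ^ 2) ^ 2 = i ^ 2 := by linear_combination h - hi
    rcases sq_pm h1 with h1 | h1
    · have h2 : y ^ 2 = (i * ρ) ^ 2 := by
        linear_combination hy + h - h1 - i ^ 2 * hρ - i * hi
      rcases sq_pm h2 with h2 | h2
      · refine ⟨(⟨0, 2, 0, 0⟩, ⟨0, 0, 0, 2⟩), by simp [Quad4.listZ], ?_, ?_⟩ <;>
          simp only [Quad4.ev, h1, h2] <;> push_cast <;> ring
      · refine ⟨(⟨0, 2, 0, 0⟩, ⟨0, 0, 0, -2⟩), by simp [Quad4.listZ], ?_, ?_⟩ <;>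
          simp only [Quad4.ev, h1, h2] <;> push_cast <;> ring
    · have h2 : y ^ 2 = ρ ^ 2 := by
        linear_combination hy + h - h1 - hρ
      rcases sq_pm h2 with h2 | h2
      · refine ⟨(⟨0, -2, 0, 0⟩, ⟨0, 0, 2, 0⟩), by simp [Quad4.listZ], ?_, ?_⟩ <;>
          simp only [Quad4.ev, h1, h2] <;> push_cast <;> ring
      · refine ⟨(⟨0, -2, 0, 0⟩, ⟨0, 0, -2, 0⟩), by simp [Quad4.listZ], ?_, ?_⟩ <;>
          simp only [Quad4.ev, h1, h2] <;> push_cast <;> ring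
  · exact (zeta_kill d i ρ (v ^ 2 - 2) fi fρ (by simp [map_ofNat, H.fv]) hi hρ h).elim

theorem Half.repE {v y w q : L} (H : Half σ v y) (d : Deg8 σ) (fw : σ w = w) (hw : w ^ 2 = -3)
    (fq : σ q = q) (hq : q ^ 2 = -2) :
    ∃ s ∈ Quad4.listE, 2 * v ^ 2 = s.1.ev w q ∧ 2 * y = s.2.ev w q := by
  have noi : ∀ i, σ i = i → i ^ 2 = -1 → False := by
    intro i fi hi
    refine d.three (-1) (-2) (-3) i q w fi fq fw ?_ ?_ ?_ ?_ ?_ ?_ ?_ ?_ ?_ ?_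
    · push_cast; exact hi
    · push_cast; exact hq
    · push_cast; exact hw
    all_goals norm_num
  rcases H.opt with h | h | h | h | h
  · rcases H.y1 h with h1 | h1
    · refine ⟨(⟨2, 0, 0, 0⟩, ⟨2, 0, 0, 0⟩), by simp [Quad4.listE], ?_, ?_⟩ <;>
        simp only [Quad4.ev, h, h1] <;> push_cast <;> ring
    · refine ⟨(⟨2, 0, 0, 0⟩, ⟨-2, 0, 0, 0⟩), by simp [Quad4.listE], ?_, ?_⟩ <;>
        simp only [Quad4.ev, h, h1] <;> push_cast <;> ring
  · exact (noi v H.fv h).elim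
  · exact (noi (v ^ 3) (by rw [map_pow, H.fv]) (by linear_combination (v ^ 2 + 1) * h)).elim
  · exact (noi (v ^ 2) (by rw [map_pow, H.fv]) (by linear_combination h)).elim
  · exfalso
    refine d.three 3 (-2) (-3) (v ^ 2 - 2) q w (by simp [map_ofNat, H.fv]) fq fw
      ?_ ?_ ?_ ?_ ?_ ?_ ?_ ?_ ?_ ?_
    · push_cast; exact h
    · push_cast; exact hq
    · push_cast; exact hw
    all_goals norm_num

theorem III_core (d : Deg8 σ) (x₀ y₀ v y₁ u y₂ : L) (fx : σ x₀ = x₀) (fy : σ y₀ = y₀)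
    (hy : y₀ ^ 2 = x₀ ^ 4 + x₀ ^ 2 + 1) (H1 : Half σ v y₁) (H2 : Half σ u y₂)
    (hopt : x₀ ^ 2 = 1 ∨ (x₀ ^ 2 = -1 ∧ ∃ ρ, σ ρ = ρ ∧ ρ ^ 2 = x₀) ∨
      (x₀ ^ 4 + x₀ ^ 2 + 1 = 0 ∧ ∃ q, σ q = q ∧ q ^ 2 = -2))
    (hexc : y₁ = 0 → y₂ = 0 → u ^ 2 = 1 - v ^ 2 → (v ^ 2) ^ 2 - v ^ 2 + 1 = 0 → False)
    (hR : 6 - 2 * y₂ - 3 * (v ^ 2 * u ^ 2) - 2 * (v ^ 2 * y₂) - 2 * y₁ - 2 * (y₁ * u ^ 2) -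
        2 * (y₁ * y₂) +
      x₀ ^ 2 * (3 * u ^ 2 + 2 * y₂ + 3 * v ^ 2 - 6 * (v ^ 2 * u ^ 2) - 4 * (v ^ 2 * y₂) + 2 * y₁ -
        4 * (y₁ * u ^ 2) - 4 * (y₁ * y₂)) +
      y₀ * (-2 - 2 * u ^ 2 - 2 * y₂ - 2 * v ^ 2 + 4 * (v ^ 2 * u ^ 2) + 4 * (v ^ 2 * y₂) - 2 * y₁ +
        4 * (y₁ * u ^ 2) + 6 * (y₁ * y₂)) = 0) : False := by
  rcases hopt with h | ⟨h, ρ, fρ, hρ⟩ | ⟨h, q, fq, hq⟩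
  · have hw : y₀ ^ 2 = 3 := by linear_combination hy + (x₀ ^ 2 + 2) * h
    have e1 : ∀ ρ : L, 2 * x₀ ^ 2 = (⟨2, 0, 0, 0⟩ : Quad4).ev y₀ ρ := by
      intro ρ; simp only [Quad4.ev, h]; push_cast; ring
    have e2 : ∀ ρ : L, 2 * y₀ = (⟨0, 2, 0, 0⟩ : Quad4).ev y₀ ρ := by
      intro ρ; simp only [Quad4.ev]; push_cast; ring
    have kI : ∀ i, σ i = i → i ^ 2 = -1 → False := by
      intro i fi hi
      obtain ⟨s, hs, s1, s2⟩ := H1.repI d fy hw fi hi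
      obtain ⟨t, ht, t1, t2⟩ := H2.repI d fy hw fi hi
      have hz := Quad4.R8_zero y₀ i 3 (-1) 0 (by push_cast; exact hw)
        (by push_cast; linear_combination hi) (by norm_num) (by exact_mod_cast nsqE)
        (e1 i) (e2 i) s1 s2 t1 t2 hR
      obtain ⟨k1, k2, k3, k4, k5, k6, k7⟩ := Quad4.decI s hs t ht hz
      have z : (⟨0, 0, 0, 0⟩ : Quad4).ev y₀ i = 0 := by simp [Quad4.ev]
      rw [k1, z] at s2
      rw [k2, z] at t2
      rw [k3] at t1
      simp only [Quad4.ev, k4, k5, k6] at s1 t1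
      push_cast at s1 t1
      have k7' : (s.1.c3 : L) ^ 2 = 1 := by exact_mod_cast k7
      refine hexc (by linear_combination s2 / 2) (by linear_combination t2 / 2)
        (by linear_combination (s1 + t1) / 2) ?_
      linear_combination (2 * v ^ 2 - 1 + (s.1.c3 : L) * y₀ * i) / 4 * s1 +
        y₀ ^ 2 * i ^ 2 / 4 * k7' + i ^ 2 / 4 * hw + 3 / 4 * hi
    have kQ : ∀ q, σ q = q → q ^ 2 = 2 → False := by
      intro i fi hi
      obtain ⟨s, hs, s1, s2⟩ := H1.repQ d fy hw fi hi
      obtain ⟨t, ht, t1, t2⟩ := H2.repQ d fy hw fi hi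
      have hz := Quad4.R8_zero y₀ i 3 2 0 (by push_cast; exact hw)
        (by push_cast; linear_combination hi) (by norm_num)
        (by push_cast; intro h; rcases h.rat with h | h <;> norm_num at h)
        (e1 i) (e2 i) s1 s2 t1 t2 hR
      exact Quad4.decQ s hs t ht hz
    rcases H1.tri fy hw with h1 | ⟨i, fi, hi⟩ | ⟨q, fq, hq⟩
    · rcases H2.tri fy hw with h2 | ⟨i, fi, hi⟩ | ⟨q, fq, hq⟩
      · have key : ∀ e f : ℚ, (y₁ = e) → (y₂ = f) → 3 - 6 * (e + f + e * f) = 0 := by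
          intro e f he hf
          rw [h, h1, h2, he, hf] at hR
          refine (lin_indep (K := L) 3 y₀ (by push_cast; exact hw) (by norm_num) _
            (-2 + 2 * e + 2 * f + 6 * e * f) ?_).1
          push_cast; linear_combination hR
        rcases H1.y1 h1 with k1 | k1 <;> rcases H2.y1 h2 with k2 | k2
        · have := key 1 1 (by rw [k1]; simp) (by rw [k2]; simp); norm_num at this
        · have := key 1 (-1) (by rw [k1]; simp) (by rw [k2]; simp); norm_num at this
        · have := key (-1) 1 (by rw [k1]; simp) (by rw [k2]; simp); norm_num at this
        · have := key (-1) (-1) (by rw [k1]; simp) (by rw [k2]; simp); norm_num at this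
      · exact kI i fi hi
      · exact kQ q fq hq
    · exact kI i fi hi
    · exact kQ q fq hq
  · obtain ⟨s, hs, s1, s2⟩ := H1.repZ d fx h fρ hρ
    obtain ⟨t, ht, t1, t2⟩ := H2.repZ d fx h fρ hρ
    have hy1 : y₀ ^ 2 = 1 ^ 2 := by linear_combination hy + x₀ ^ 2 * h
    have e1 : 2 * x₀ ^ 2 = (⟨-2, 0, 0, 0⟩ : Quad4).ev x₀ ρ := by
      simp only [Quad4.ev, h]; push_cast; ring
    obtain ⟨e, he, e2⟩ : ∃ e ∈ [(2 : ℤ), -2], 2 * y₀ = (⟨e, 0, 0, 0⟩ : Quad4).ev x₀ ρ := by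
      rcases sq_pm hy1 with k | k
      · exact ⟨2, by simp, by simp only [Quad4.ev, k]; push_cast; ring⟩
      · exact ⟨-2, by simp, by simp only [Quad4.ev, k]; push_cast; ring⟩
    have hz := Quad4.R8_zero x₀ ρ (-1) 0 1 (by push_cast; exact h)
        (by push_cast; linear_combination hρ) (by norm_num) (by exact_mod_cast nsqA)
        e1 e2 s1 s2 t1 t2 hR
    exact Quad4.decZ s hs t ht e he hz
  · have fw : σ (2 * x₀ ^ 2 + 1) = 2 * x₀ ^ 2 + 1 := by simp [map_ofNat, fx]
    have hw : (2 * x₀ ^ 2 + 1) ^ 2 = -3 := by linear_combination 4 * h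
    have hy0 : y₀ = 0 := by rw [h] at hy; exact pow_eq_zero_iff (two_ne_zero) |>.mp hy
    obtain ⟨s, hs, s1, s2⟩ := H1.repE d fw hw fq hq
    obtain ⟨t, ht, t1, t2⟩ := H2.repE d fw hw fq hq
    have e1 : 2 * x₀ ^ 2 = (⟨-1, 1, 0, 0⟩ : Quad4).ev (2 * x₀ ^ 2 + 1) q := by
      simp only [Quad4.ev]; push_cast; ring
    have e2 : 2 * y₀ = (⟨0, 0, 0, 0⟩ : Quad4).ev (2 * x₀ ^ 2 + 1) q := by
      simp [Quad4.ev, hy0]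
    have hz := Quad4.R8_zero (2 * x₀ ^ 2 + 1) q (-3) (-2) 0 (by push_cast; exact hw)
        (by push_cast; linear_combination hq) (by norm_num) (by exact_mod_cast nsqJ)
        e1 e2 s1 s2 t1 t2 hR
    exact Quad4.decE s hs t ht hz

theorem Ctx.half (c : Ctx σ) (P : Pt x V A B) (hI : σ x ^ 2 ≠ x ^ 2)
    (hq : 1 - (V * σ V) ^ 2 ≠ 0) : ∃ v y, Half σ v y ∧
      v * (1 - (V * σ V) ^ 2) = V * σ (A * B) + σ V * (A * B) ∧
      y * (1 - (V * σ V) ^ 2) ^ 2 = (1 + (V * σ V) ^ 2) * (A * B * σ (A * B) - V * σ V) +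
        2 * (V * σ V) * (V ^ 2 + σ V ^ 2) := by
  obtain ⟨v, y, fv, fy, hv, hy, hyv, h⟩ := c.listV P hq
  refine ⟨v, y, ⟨fv, fy, hyv, ?_⟩, hv, hy⟩
  rcases h with h | h | ⟨d, h⟩
  · exfalso
    rw [h] at hv
    have hVV : σ V ^ 2 = σ x ^ 2 + 1 := by rw [← map_pow, P.hV]; simp
    have hYY : σ (A * B) ^ 2 = σ V ^ 4 - σ V ^ 2 + 1 := by rw [← map_pow, P.YV]; simp
    have : (1 - (V * σ V) ^ 2) * (σ V ^ 2 - V ^ 2) = 0 := by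
      linear_combination (V * σ (A * B) - σ V * (A * B)) * hv + V ^ 2 * hYY - σ V ^ 2 * P.YV
    have := (mul_eq_zero.mp this).resolve_left hq
    apply hI; linear_combination this - hVV + P.hV
  · exact Or.inl h
  · exact Or.inr h

theorem caseIII (c : Ctx σ) (P : Pt x V A B) (hI : σ x ^ 2 ≠ x ^ 2) (hr : (x * σ x) ^ 2 ≠ 1)
    (hN : (V * σ V) ^ 2 ≠ 1) (hNr : (V * σ V) ^ 2 ≠ (x * σ x) ^ 2) : False := by
  have hx := P.x0
  have hx' : σ x ≠ 0 := by simpa using hx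
  have hVn : σ V ≠ 0 := by simpa using P.V0
  have hVV : σ V ^ 2 = σ x ^ 2 + 1 := by rw [← map_pow, P.hV]; simp
  have hYY : σ (A * B) ^ 2 = σ x ^ 4 + σ x ^ 2 + 1 := by rw [← map_pow, P.Y2]; simp
  have hY := P.Y2
  have hV := P.hV
  have q1 : 1 - (x * σ x) ^ 2 ≠ 0 := fun h => hr (by linear_combination -h)
  have q2 : 1 - (V * σ V) ^ 2 ≠ 0 := fun h => hN (by linear_combination -h)
  have q3 : (x * σ x) ^ 2 - (V * σ V) ^ 2 ≠ 0 := fun h => hNr (by linear_combination -h)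
  obtain ⟨x₀, y₀, fx, fy, h1, h2, h3, hl⟩ := c.listA P q1
  obtain ⟨v, y₁, H1, h4, h5⟩ := c.half P hI q2
  obtain ⟨u, y₂, H2, h6, h7⟩ := c.half P.swap
    (by rw [map_inv₀, inv_pow, inv_pow]; intro h; exact hI (inv_injective h))
    (by
      rw [map_div₀, div_mul_div_comm, div_pow, one_sub_div (pow_ne_zero 2 (mul_ne_zero hx hx'))]
      exact div_ne_zero q3 (pow_ne_zero 2 (mul_ne_zero hx hx')))
  have hl' : Deg8 σ ∧ (x₀ ^ 2 = 1 ∨ (x₀ ^ 2 = -1 ∧ ∃ ρ, σ ρ = ρ ∧ ρ ^ 2 = x₀) ∨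
      (x₀ ^ 4 + x₀ ^ 2 + 1 = 0 ∧ ∃ q, σ q = q ∧ q ^ 2 = -2)) := by
    rcases hl with h | h
    · exfalso
      rw [h] at h1
      have : (1 - (x * σ x) ^ 2) * (σ x ^ 2 - x ^ 2) = 0 := by
        linear_combination (x * σ (A * B) - σ x * (A * B)) * h1 + x ^ 2 * hYY - σ x ^ 2 * P.Y2
      have := (mul_eq_zero.mp this).resolve_left q1
      apply hI; linear_combination this
    · exact h
  obtain ⟨d, hopt⟩ := hl'
  have hswap : A / x * (B / x) = A * B / x ^ 2 := by field_simp
  rw [hswap, map_div₀, map_div₀, map_pow] at h6 h7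
  have h6' : u * ((x * σ x) ^ 2 - (V * σ V) ^ 2) = V * x * σ (A * B) + σ V * σ x * (A * B) := by
    generalize σ (A * B) = Z at *
    generalize A * B = Y at *
    field_simp at h6
    linear_combination h6
  have h7' : y₂ * ((x * σ x) ^ 2 - (V * σ V) ^ 2) ^ 2 =
      ((x * σ x) ^ 2 + (V * σ V) ^ 2) * (A * B * σ (A * B) - (V * σ V) * (x * σ x)) +
        2 * (V * σ V) * (x * σ x) * (V ^ 2 * σ x ^ 2 + σ V ^ 2 * x ^ 2) := by
    generalize σ (A * B) = Z at *
    generalize A * B = Y at *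
    field_simp at h7
    linear_combination h7
  clear h6 h7
  obtain ⟨r, hr'⟩ : ∃ r, r = x * σ x := ⟨_, rfl⟩
  obtain ⟨N, hN'⟩ : ∃ N, N = V * σ V := ⟨_, rfl⟩
  obtain ⟨M, hM'⟩ : ∃ M, M = A * B * σ (A * B) := ⟨_, rfl⟩
  obtain ⟨e, he'⟩ : ∃ e, e = x ^ 2 + σ x ^ 2 := ⟨_, rfl⟩
  have hN0 : N ≠ 0 := by rw [hN']; exact mul_ne_zero P.V0 hVn
  have he : e = N ^ 2 - r ^ 2 - 1 := by
    rw [he', hN', hr', mul_pow, hV, hVV]; ring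
  have hM : M ^ 2 = r ^ 4 + r ^ 2 * e + e ^ 2 - r ^ 2 + e + 1 := by
    rw [hM', mul_pow, hY, hYY, hr', he']; ring
  have ha : x₀ ^ 2 * (1 - r ^ 2) ^ 2 = r ^ 2 * e + 2 * r ^ 2 + e + 2 * r * M := by
    rw [← mul_pow, hr', h1, hM', he']
    linear_combination x ^ 2 * hYY + σ x ^ 2 * hY
  have hy0 : y₀ * (1 - r ^ 2) ^ 2 = (1 + r ^ 2) * (M + r) + 2 * r * e := by
    rw [hr', h2, hM', he']
  have hb : v ^ 2 * (1 - N ^ 2) ^ 2 = N ^ 2 * e + e + 2 + 2 * N * M := by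
    rw [← mul_pow, hN', h4, hM', he']
    linear_combination V ^ 2 * hYY + σ V ^ 2 * hY + (-σ x ^ 2 * σ V ^ 2 + σ x ^ 4 - x ^ 2 * σ V ^ 2 + σ x ^ 2 + 1) * hV + (-σ x ^ 2 * x ^ 2 - σ x ^ 2 + 1) * hVV
  have hy1 : y₁ * (1 - N ^ 2) ^ 2 = (1 + N ^ 2) * (M - N) + 2 * N * (e + 2) := by
    rw [hN', h5, hM', he', hV, hVV]; ring
  have hc : u ^ 2 * (r ^ 2 - N ^ 2) ^ 2 = N ^ 2 * e + e * r ^ 2 + 2 * r ^ 4 + 2 * N * M * r := by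
    rw [← mul_pow, hN', hr', h6', hM', he']
    linear_combination V ^ 2 * x ^ 2 * hYY + σ V ^ 2 * σ x ^ 2 * hY + (σ x ^ 4 * x ^ 2 + σ x ^ 2 * x ^ 2 - σ x ^ 2 * σ V ^ 2 - x ^ 2 * σ V ^ 2 + x ^ 2) * hV + (σ x ^ 2 * x ^ 4 - x ^ 4 - x ^ 2) * hVV
  have hy2 : y₂ * (r ^ 2 - N ^ 2) ^ 2 =
      (r ^ 2 + N ^ 2) * (M - N * r) + 2 * N * r * (e + 2 * r ^ 2) := by
    rw [hN', hr', h7', hM', he', hV, hVV]; ring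
  rw [← hr', ← hN'] at q3
  rw [← hr'] at q1
  rw [← hN'] at q2
  have hR := relR r N M (x₀ ^ 2) y₀ (v ^ 2) y₁ (u ^ 2) y₂ e he hM q1 q2 q3 ha hy0 hb hy1 hc hy2
  refine III_core d x₀ y₀ v y₁ u y₂ fx fy h3 H1 H2 hopt ?_ hR
  intro k1 k2 k3 k4
  rw [k1] at hy1
  rw [k2] at hy2
  rw [k3] at hc
  generalize v ^ 2 = b at *
  have m1 : b * (1 + N ^ 2) = e + 2 := by
    have : (b * (1 + N ^ 2)) * (1 - N ^ 2) ^ 2 = (e + 2) * (1 - N ^ 2) ^ 2 := by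
      linear_combination (1 + N ^ 2) * hb - 2 * N * hy1
    exact mul_right_cancel₀ (pow_ne_zero 2 q2) this
  have m2 : (1 - b) * (r ^ 2 + N ^ 2) = e + 2 * r ^ 2 := by
    have : ((1 - b) * (r ^ 2 + N ^ 2)) * (r ^ 2 - N ^ 2) ^ 2 =
        (e + 2 * r ^ 2) * (r ^ 2 - N ^ 2) ^ 2 := by
      linear_combination (r ^ 2 + N ^ 2) * hc - 2 * N * r * hy2
    exact mul_right_cancel₀ (pow_ne_zero 2 q3) this
  have m3 : N ^ 2 * (b + 1) = 0 := by
    rw [he] at m1 m2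
    linear_combination -b * m1 - m2 + (1 + N ^ 2) * k4
  have m4 := (mul_eq_zero.mp m3).resolve_left (pow_ne_zero 2 hN0)
  have : (3 : L) = 0 := by linear_combination k4 - (b - 2) * m4
  norm_num at this
end


theorem ctx_of_condA {K L : Type*} [Field K] [CharZero K] [Field L] [CharZero L] (f : K →+* L)
    (σ : L →+* L) (hσ : ∀ x, σ (σ x) = x) (hf : ∀ x, σ x = x → ∃ k, f k = x) (h : condA K) :
    Ctx σ := by
  obtain ⟨h1, h2, -⟩ := h
  have key : ∀ x Y : L, σ x = x → σ Y = Y → Y ^ 2 = x ^ 4 + x ^ 2 + 1 → x = 0 := by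
    intro x Y fx fY hY
    obtain ⟨x, rfl⟩ := hf x fx
    obtain ⟨Y, rfl⟩ := hf Y fY
    have hY' : Y ^ 2 = x ^ 4 + x ^ 2 + 1 := by
      apply f.injective
      simpa only [map_pow, map_add, map_one] using hY
    obtain ⟨⟨p, hp⟩, ⟨q, hq⟩⟩ := h2 (x ^ 2) (x * Y) (by linear_combination x ^ 2 * hY')
    have h3 : q ^ 2 = p ^ 3 + p ^ 2 + p := by
      have : (q : K) ^ 2 = (p : K) ^ 3 + (p : K) ^ 2 + (p : K) := by
        rw [hp, hq]; linear_combination x ^ 2 * hY'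
      exact_mod_cast this
    have h4 := rat_E1m p q h3
    rw [h4, Rat.cast_zero] at hp
    rw [pow_eq_zero_iff (two_ne_zero)|>.1 hp.symm, map_zero]
  refine ⟨hσ, ?_, ?_, ?_⟩
  · intro s τ fs fτ hs
    obtain ⟨s, rfl⟩ := hf s fs
    obtain ⟨τ, rfl⟩ := hf τ fτ
    have hs' : τ ^ 2 = s ^ 3 - s ^ 2 + s := by
      apply f.injective
      simpa only [map_pow, map_add, map_sub] using hs
    obtain ⟨⟨p, hp⟩, ⟨q, hq⟩⟩ := h1 s τ hs'
    have h3 : q ^ 2 = p ^ 3 - p ^ 2 + p := by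
      have : (q : K) ^ 2 = (p : K) ^ 3 - (p : K) ^ 2 + (p : K) := by
        rw [hp, hq]; exact hs'
      exact_mod_cast this
    rcases rat_E1 p q h3 with h4 | h4
    · left; rw [← hp, h4, Rat.cast_zero, map_zero]
    · right; left; rw [← hp, h4, Rat.cast_one, map_one]
  · intro x A B fx fA fB hA hB
    left
    exact key x (A * B) fx (by rw [map_mul, fA, fB])
      (by linear_combination B ^ 2 * hA + (x ^ 2 - x + 1) * hB)
  · intro x Y fx fY hY
    exact Or.inl (key x Y fx fY hY)

theorem ctx_of_condB {K L : Type*} [Field K] [NumberField K] [Field L] [CharZero L] (f : K →+* L)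
    (σ : L →+* L) (hσ : ∀ x, σ (σ x) = x) (hf : ∀ x, σ x = x → ∃ k, f k = x) (h : condB K) :
    Ctx σ := by
  obtain ⟨h1, h2, h3⟩ := h
  have h8 : ¬ 8 ∣ Module.finrank ℚ K := by
    have : 0 < Module.finrank ℚ K := Module.finrank_pos
    rcases h3 with h | ⟨k, hk⟩ <;> omega
  have hD : Deg8 σ := (Deg8.ofCond h8).transfer f hf
  have key : ∀ x A B, σ x = x → σ A = A → σ B = B → A ^ 2 = x ^ 2 - x + 1 →
      B ^ 2 = x ^ 2 + x + 1 → x = 0 ∨ x ^ 2 = 1 ∨ x ^ 2 = -1 ∨ x ^ 4 + x ^ 2 + 1 = 0 := by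
    intro x A B fx fA fB hA hB
    obtain ⟨x, rfl⟩ := hf x fx
    obtain ⟨A, rfl⟩ := hf A fA
    obtain ⟨B, rfl⟩ := hf B fB
    have hA' : A ^ 2 = x ^ 2 - x + 1 := by
      apply f.injective
      simpa only [map_pow, map_add, map_sub, map_one] using hA
    have hB' : B ^ 2 = x ^ 2 + x + 1 := by
      apply f.injective
      simpa only [map_pow, map_add, map_sub, map_one] using hB
    have := list_AB K h8 h2 x A B hA' hB'
    rcases this with h | h | h | h <;> replace h := congrArg f h <;>
      simp only [map_pow, map_add, map_one, map_zero, map_neg] at h <;> tauto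
  refine ⟨hσ, ?_, ?_, ?_⟩
  · intro s τ fs fτ hs
    obtain ⟨s, rfl⟩ := hf s fs
    obtain ⟨τ, rfl⟩ := hf τ fτ
    have hs' : τ ^ 2 = s ^ 3 - s ^ 2 + s := by
      apply f.injective
      simpa only [map_pow, map_add, map_sub] using hs
    rcases list_E1 K h8 h1 s τ hs' with h | h | h | h | h | h <;> replace h := congrArg f h <;>
      simp only [map_pow, map_add, map_sub, map_mul, map_one, map_zero, map_neg, map_ofNat] at h <;>
      tauto
  · intro x A B fx fA fB hA hB
    rcases key x A B fx fA fB hA hB with h | h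
    · exact Or.inl h
    · exact Or.inr ⟨hD, h⟩
  · intro x Y fx fY hY
    by_cases hx : x = 0
    · exact Or.inl hx
    refine Or.inr ⟨hD, ?_⟩
    by_cases hY0 : Y = 0
    · right; right; left
      rw [← hY, hY0]; ring
    obtain ⟨hA, hB⟩ := dbl_AB x Y hx hY hY0
    have fz : σ ((1 - x ^ 4) / (2 * x * Y)) = (1 - x ^ 4) / (2 * x * Y) := by
      simp only [map_div₀, map_pow, map_sub, map_mul, map_one, map_ofNat, fx, fY]
    have fA : σ (((1 + x ^ 2) * Y - x * (1 - x ^ 2)) / (2 * x * Y)) =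
        ((1 + x ^ 2) * Y - x * (1 - x ^ 2)) / (2 * x * Y) := by
      simp only [map_div₀, map_pow, map_sub, map_add, map_mul, map_one, map_ofNat, fx, fY]
    have fB : σ (((1 + x ^ 2) * Y + x * (1 - x ^ 2)) / (2 * x * Y)) =
        ((1 + x ^ 2) * Y + x * (1 - x ^ 2)) / (2 * x * Y) := by
      simp only [map_div₀, map_pow, map_sub, map_add, map_mul, map_one, map_ofNat, fx, fY]
    have hz : 2 * x * Y * ((1 - x ^ 4) / (2 * x * Y)) = 1 - x ^ 4 := by
      field_simp
    have := half_core hD x Y _ _ _ fx fY fz fA fB hx hY hz hA hB (key _ _ _ fz fA fB hA hB)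
    tauto

theorem exists_involution (K L : Type*) [Field K] [CharZero K] [Field L] [Algebra K L]
    (hquad : Module.finrank K L = 2) : ∃ σ : L →+* L, (∀ x, σ (σ x) = x) ∧
      ∀ x, σ x = x → ∃ k, algebraMap K L k = x := by
  haveI : Algebra.IsQuadraticExtension K L := ⟨hquad⟩
  have hc : Nat.card (L ≃ₐ[K] L) = 2 := by rw [IsGalois.card_aut_eq_finrank, hquad]
  obtain ⟨a, ha, hu⟩ := (Nat.card_eq_two_iff' (1 : L ≃ₐ[K] L)).1 hc
  refine ⟨(a : L →+* L), ?_, ?_⟩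
  · intro x
    have : a ^ 2 = 1 := by rw [← hc]; exact pow_card_eq_one'
    have h2 := congrArg (fun b : L ≃ₐ[K] L => b x) this
    simpa [sq] using h2
  · intro x hx
    have := (IsGalois.mem_range_algebraMap_iff_fixed (F := K) x).2 (by
      intro b
      by_cases hb : b = 1
      · rw [hb]; rfl
      · rw [hu b hb]; exact hx)
    exact this

theorem pt_of_point {L : Type*} [Field L] [CharZero L] (t X₁ X₃ : L) (hpt : CPt t X₁ X₃)
    (hnt : CNontrivial t X₁ X₃) (htT : ¬ inT t) :
    Pt ((t - t⁻¹) / 2) ((t + t⁻¹) / 2) (X₁ / (2 * t)) (X₃ / (2 * t)) := by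
  obtain ⟨h1, h3⟩ := hpt
  obtain ⟨t0, n1, n2, n3, n4, n5, n6, n7⟩ := hnt
  have hx : (t - t⁻¹) / 2 = (t ^ 2 - 1) / (2 * t) := by field_simp
  have hV : (t + t⁻¹) / 2 = (t ^ 2 + 1) / (2 * t) := by field_simp
  have d0 : (2 * t) ≠ 0 := mul_ne_zero two_ne_zero t0
  rw [hx, hV]
  unfold inT at htT
  refine ⟨?_, ?_, ?_, ?_, ?_, ?_, ?_, ?_, ?_, ?_⟩
  · field_simp; ring
  · rw [div_pow, h1]; field_simp; ring
  · rw [div_pow, h3]; field_simp; ring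
  · refine div_ne_zero (fun h => ?_) d0
    have : (t - 1) * (t + 1) = 0 := by linear_combination h
    rcases mul_eq_zero.1 this with h | h
    · exact n1 (by linear_combination h)
    · exact n2 (by linear_combination h)
  · exact div_ne_zero n5 d0
  · exact div_ne_zero n3 d0
  · exact div_ne_zero n4 d0
  · intro h
    field_simp at h
    have : (t ^ 2 - 2 * t - 1) * (t ^ 2 + 2 * t - 1) = 0 := by linear_combination h
    exact (mul_ne_zero n6 n7) this
  · intro h
    apply htT
    have h' : (t ^ 4 - t ^ 3 + 2 * t ^ 2 + t + 1) = 0 := by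
      have e : 2 * ((t ^ 2 - 1) / (2 * t)) ^ 2 - (t ^ 2 - 1) / (2 * t) + 2 =
        (t ^ 4 - t ^ 3 + 2 * t ^ 2 + t + 1) / (2 * t ^ 2) := by field_simp; ring
      rw [e, div_eq_zero_iff] at h
      exact h.resolve_right (mul_ne_zero two_ne_zero (pow_ne_zero 2 t0))
    rw [h', mul_zero]
  · intro h
    apply htT
    have h' : (t ^ 4 + t ^ 3 + 2 * t ^ 2 - t + 1) = 0 := by
      have e : 2 * ((t ^ 2 - 1) / (2 * t)) ^ 2 + (t ^ 2 - 1) / (2 * t) + 2 =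
        (t ^ 4 + t ^ 3 + 2 * t ^ 2 - t + 1) / (2 * t ^ 2) := by field_simp; ring
      rw [e, div_eq_zero_iff] at h
      exact h.resolve_right (mul_ne_zero two_ne_zero (pow_ne_zero 2 t0))
    rw [h', zero_mul]

theorem quadratic_points_on_C_outside_T
    (K L : Type*) [Field K] [NumberField K] [Field L] [NumberField L] [Algebra K L]
    (hquad : Module.finrank K L = 2)
    (hcond : condA K ∨ condB K)
    (t X₁ X₃ : L) (hpt : CPt t X₁ X₃) (hnt : CNontrivial t X₁ X₃)
    (htT : ¬ inT t) :
    (t ∈ Set.range (algebraMap K L) ∧ X₁ ∈ Set.range (algebraMap K L)) ∨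
    (t ∈ Set.range (algebraMap K L) ∧ X₃ ∈ Set.range (algebraMap K L)) := by
  obtain ⟨σ, hσ, hf⟩ := exists_involution K L hquad
  have c : Ctx σ := hcond.elim (ctx_of_condA (algebraMap K L) σ hσ hf)
    (ctx_of_condB (algebraMap K L) σ hσ hf)
  have P := pt_of_point t X₁ X₃ hpt hnt htT
  have t0 : t ≠ 0 := hnt.1
  have d0 : (2 * t) ≠ 0 := mul_ne_zero two_ne_zero t0
  have ht : t = (t - t⁻¹) / 2 + (t + t⁻¹) / 2 := by ring
  have e1 : X₁ = X₁ / (2 * t) * (2 * t) := by field_simp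
  have e3 : X₃ = X₃ / (2 * t) * (2 * t) := by field_simp
  generalize (t - t⁻¹) / 2 = x at *
  generalize (t + t⁻¹) / 2 = V at *
  generalize X₁ / (2 * t) = A at *
  generalize X₃ / (2 * t) = B at *
  by_cases hI : σ x ^ 2 = x ^ 2
  · obtain ⟨fx, fV, hAB⟩ := caseI c P hI
    have ft : σ t = t := by rw [ht, map_add, fx, fV]
    have f2 : σ (2 * t) = 2 * t := by rw [map_mul, ft, map_ofNat]
    rcases hAB with fA | fB
    · exact Or.inl ⟨hf _ ft, hf _ (by rw [e1, map_mul, fA, f2])⟩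
    · exact Or.inr ⟨hf _ ft, hf _ (by rw [e3, map_mul, fB, f2])⟩
  · exfalso
    by_cases hr : (x * σ x) ^ 2 = 1
    · exact caseII0 c P hr
    by_cases hN : (V * σ V) ^ 2 = 1
    · exact caseII1 c P hN hI
    by_cases hNr : (V * σ V) ^ 2 = (x * σ x) ^ 2
    · exact caseII2 c P hNr hI
    exact caseIII c P hI hr hN hNr
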